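/- Let k > r ≥ 2 be integers with r prime, set j = j_{k,r}, ℓ = ℓ_{k,r}, and m = min{j, ℓ}. Suppose j ≥ 2 and ℓ ≥ 1. If either (i) ℓ = 1, or (ii) m = 2 and k ≥ 2r − 3, or (iii) m ≥ 3 and k ≥ (π(r))³·(r−2), then w_2(k;r) = rk − m(r−2). -/

import Mathlib

/-- `vdwProp r k n` says: every coloring `χ` of `{1,...,n}` with colors `0,...,r-1`
admits, for some color `i < r`, a `k i`-term arithmetic progression
`a, a+d, ..., a+(k i - 1)d` (with `a ≥ 1`, `d ≥ 1`) contained in `{1,...,n}`,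
all of whose elements have color `i`. -/
def vdwProp (r : ℕ) (k : ℕ → ℕ) (n : ℕ) : Prop :=
  ∀ χ : ℕ → ℕ, (∀ x, 1 ≤ x → x ≤ n → χ x < r) →
    ∃ i < r, ∃ a, 1 ≤ a ∧ ∃ d, 1 ≤ d ∧ a + (k i - 1) * d ≤ n ∧
      ∀ t < k i, χ (a + t * d) = i

/-- The length function for `w₂(k;r) = w(k,2,2,...,2;r)`: color `0` must avoid
`k`-term APs, every other color must avoid `2`-term APs. -/
def twoColors (k : ℕ) : ℕ → ℕ := fun i => if i = 0 then k else 2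

/-- `#r`: the product of all primes not exceeding `r`. -/
def primorialUpTo (r : ℕ) : ℕ := ∏ p ∈ Finset.filter Nat.Prime (Finset.range (r + 1)), p

/-- `j_{k,r} = min { j ≥ 0 : gcd(k - j, #r) = 1 }`. -/
noncomputable def jkr (k r : ℕ) : ℕ := sInf {j : ℕ | Nat.gcd (k - j) (primorialUpTo r) = 1}

/-- `ℓ_{k,r} = min { ℓ ≥ 0 : gcd(k - ℓ, #r) = r }`. -/
noncomputable def lkr (k r : ℕ) : ℕ := sInf {l : ℕ | Nat.gcd (k - l) (primorialUpTo r) = r}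

/-- The primes in `[5, n]`. -/
def primesFromFive (n : ℕ) : Finset ℕ := (Finset.Icc 5 n).filter Nat.Prime

/-- The sum of `log p / p` over the primes `5 ≤ p ≤ n`. -/
noncomputable def mertensSum (n : ℕ) : ℝ := ∑ p ∈ primesFromFive n, Real.log p / p

lemma mem_primesFromFive {n p : ℕ} : p ∈ primesFromFive n ↔ 5 ≤ p ∧ p ≤ n ∧ p.Prime := by
  simp [primesFromFive, and_assoc]

lemma le_log_factorial {N : ℕ} (hN : 1 ≤ N) : N * Real.log N - N + 1 ≤ Real.log (N.factorial) := by
  induction N, hN using Nat.le_induction with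
  | base => simp
  | succ n hn ih =>
    have hn' : (0 : ℝ) < n := by exact_mod_cast hn
    rw [Nat.factorial_succ, Nat.cast_mul, Real.log_mul (by positivity) (by positivity)]
    have h1 : Real.log (n + 1) ≤ Real.log n + 1 / n := by
      have := Real.log_le_sub_one_of_pos (show (0 : ℝ) < (n + 1) / n by positivity)
      rw [Real.log_div (by positivity) (by positivity)] at this
      have h2 : ((n : ℝ) + 1) / n - 1 = 1 / n := by field_simp; ring
      linarith
    have h2 : (n : ℝ) * Real.log (n + 1) ≤ n * Real.log n + 1 := by
      have := mul_le_mul_of_nonneg_left h1 hn'.le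
      have h3 : (n : ℝ) * (1 / n) = 1 := by field_simp
      nlinarith
    push_cast
    linarith

lemma log_factorial_le {n : ℕ} (hn : 1 ≤ n) :
    Real.log (n.factorial) ≤ n * Real.log n - n + Real.log n + 1 := by
  induction n, hn using Nat.le_induction with
  | base => simp
  | succ n hn ih =>
    have hn' : (0 : ℝ) < n := by exact_mod_cast hn
    rw [Nat.factorial_succ, Nat.cast_mul, Real.log_mul (by positivity) (by positivity)]
    have h1 : Real.log n ≤ Real.log (n + 1) - 1 / (n + 1) := by
      have := Real.log_le_sub_one_of_pos (show (0 : ℝ) < n / (n + 1) by positivity)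
      rw [Real.log_div (by positivity) (by positivity)] at this
      have h2 : (n : ℝ) / (n + 1) - 1 = - (1 / (n + 1)) := by field_simp; ring
      linarith
    have h2 : ((n : ℝ) + 1) * Real.log n ≤ (n + 1) * Real.log (n + 1) - 1 := by
      have := mul_le_mul_of_nonneg_left h1 (show (0 : ℝ) ≤ n + 1 by positivity)
      have h3 : ((n : ℝ) + 1) * (1 / (n + 1)) = 1 := by field_simp
      nlinarith
    push_cast
    linarith

lemma log_factorial_eq_sum (n : ℕ) :
    Real.log (n.factorial) =
      ∑ p ∈ (Finset.Icc 2 n).filter Nat.Prime, (n.factorial.factorization p : ℝ) * Real.log p := by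
  rw [Real.log_nat_eq_sum_factorization]
  rw [Finsupp.sum]
  apply Finset.sum_subset
  · intro p hp
    simp only [Nat.support_factorization, Nat.mem_primeFactors] at hp
    simp only [Finset.mem_filter, Finset.mem_Icc]
    exact ⟨⟨hp.1.two_le, (hp.1.dvd_factorial).1 hp.2.1⟩, hp.1⟩
  · intro p _ hp
    simp only [Finsupp.mem_support_iff, not_not] at hp
    simp [hp]

lemma filter_prime_Icc_two {n : ℕ} (hn : 3 ≤ n) :
    (Finset.Icc 2 n).filter Nat.Prime = insert 2 (insert 3 (primesFromFive n)) := by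
  ext p
  simp only [Finset.mem_filter, Finset.mem_Icc, Finset.mem_insert, mem_primesFromFive]
  constructor
  · rintro ⟨⟨h1, h2⟩, hp⟩
    rcases lt_or_ge p 5 with h | h
    · interval_cases p
      · simp
      · simp
      · norm_num at hp
    · exact Or.inr (Or.inr ⟨h, h2, hp⟩)
  · rintro (rfl | rfl | h)
    · exact ⟨⟨le_rfl, by omega⟩, Nat.prime_two⟩
    · exact ⟨⟨by norm_num, hn⟩, Nat.prime_three⟩
    · exact ⟨⟨by omega, h.2.1⟩, h.2.2⟩

lemma log_le_of_pow_le_two_pow {p a k : ℕ} (hk : 0 < k) (hp : 0 < p) (h : p ^ k ≤ 2 ^ a) :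
    Real.log p ≤ a / k * 0.6931471808 := by
  have h1 : ((p : ℝ)) ^ k ≤ 2 ^ a := by exact_mod_cast h
  have hp' : (0 : ℝ) < p := by exact_mod_cast hp
  have h2 := Real.log_le_log (by positivity) h1
  rw [Real.log_pow, Real.log_pow] at h2
  have hk' : (0 : ℝ) < k := by exact_mod_cast hk
  have h3 : (a : ℝ) * Real.log 2 ≤ a * 0.6931471808 :=
    mul_le_mul_of_nonneg_left Real.log_two_lt_d9.le (by positivity)
  rw [div_mul_eq_mul_div, le_div_iff₀ hk']
  linarith

lemma log_ge_of_two_pow_le_pow {p a k : ℕ} (hk : 0 < k) (h : 2 ^ a ≤ p ^ k) :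
    a / k * 0.6931471803 ≤ Real.log p := by
  have h1 : (2 : ℝ) ^ a ≤ (p : ℝ) ^ k := by exact_mod_cast h
  have h2 := Real.log_le_log (by positivity) h1
  rw [Real.log_pow, Real.log_pow] at h2
  have hk' : (0 : ℝ) < k := by exact_mod_cast hk
  have h3 : (a : ℝ) * 0.6931471803 ≤ a * Real.log 2 :=
    mul_le_mul_of_nonneg_left Real.log_two_gt_d9.le (by positivity)
  rw [div_mul_eq_mul_div, div_le_iff₀ hk']
  linarith

lemma primesFromFive_ninety_seven : primesFromFive 97 =
    {5, 7, 11, 13, 17, 19, 23, 29, 31, 37, 41, 43, 47, 53, 59, 61, 67, 71, 73, 79, 83, 89, 97} := by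
  decide +kernel

lemma log_div_telescope {j : ℕ} (hj : 49 ≤ j) :
    Real.log (2 * j + 1 : ℕ) / (((2 * j + 1 : ℕ) : ℝ) * ((2 * j + 1 : ℕ) - 1)) ≤
      (Real.log (2 * j - 1) + 1) / (2 * (2 * j - 1)) -
      (Real.log (2 * (j + 1 : ℕ) - 1) + 1) / (2 * (2 * (j + 1 : ℕ) - 1)) := by
  have hj' : (49 : ℝ) ≤ j := by exact_mod_cast hj
  obtain ⟨m, hm⟩ : ∃ m : ℝ, m = 2 * j - 1 := ⟨_, rfl⟩
  have hm97 : 97 ≤ m := by linarith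
  have e1 : ((2 * j + 1 : ℕ) : ℝ) = m + 2 := by push_cast; linarith
  have e2 : (2 * ((j + 1 : ℕ) : ℝ) - 1) = m + 2 := by push_cast; linarith
  rw [e1, e2, ← hm]
  have h1 : Real.log (m + 2) - 2 / m ≤ Real.log m := by
    have := Real.log_le_sub_one_of_pos (show (0 : ℝ) < (m + 2) / m by positivity)
    rw [Real.log_div (by positivity) (by positivity)] at this
    have h2 : (m + 2) / m - 1 = 2 / m := by field_simp; ring
    linarith
  have h3 : 4 * 0.69 ≤ Real.log (m + 2) := by
    have : Real.log ((2 : ℝ) ^ 4) ≤ Real.log (m + 2) := Real.log_le_log (by norm_num) (by linarith)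
    rw [Real.log_pow] at this
    have := Real.log_two_gt_d9
    push_cast at *
    linarith
  set l := Real.log (m + 2)
  have h4 : (l - 2 / m + 1) / (2 * m) ≤ (Real.log m + 1) / (2 * m) := by gcongr
  refine le_trans ?_ (sub_le_sub_right h4 _)
  have h5 : (l - 2 / m + 1) / (2 * m) - (l + 1) / (2 * (m + 2)) - l / ((m + 2) * (m + 2 - 1)) =
      (l * m - 2 * (m + 1)) / (m ^ 2 * (m + 1) * (m + 2)) := by
    have : m + 2 - 1 = m + 1 := by ring
    rw [this]
    field_simp
    ring
  have h6 : 0 ≤ (l * m - 2 * (m + 1)) / (m ^ 2 * (m + 1) * (m + 2)) := by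
    apply div_nonneg _ (by positivity)
    nlinarith
  linarith

lemma sum_primesFromFive_split {f : ℕ → ℝ} (hf : ∀ n, 5 ≤ n → 0 ≤ f n) (N : ℕ) :
    ∑ p ∈ primesFromFive N, f p ≤
      ∑ p ∈ primesFromFive 97, f p + ∑ j ∈ Finset.Ico 49 (N + 49), f (2 * j + 1) := by
  have h1 : ∑ j ∈ Finset.Ico 49 (N + 49), f (2 * j + 1) =
      ∑ n ∈ (Finset.Ico 49 (N + 49)).image (fun j => 2 * j + 1), f n := by
    rw [Finset.sum_image]
    intro a _ b _ h
    simpa using h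
  rw [h1, ← Finset.sum_union]
  · apply Finset.sum_le_sum_of_subset_of_nonneg
    · intro p hp
      rw [mem_primesFromFive] at hp
      rw [Finset.mem_union, mem_primesFromFive, Finset.mem_image]
      rcases le_or_gt p 97 with h | h
      · exact Or.inl ⟨hp.1, h, hp.2.2⟩
      · right
        rcases hp.2.2.eq_two_or_odd' with h2 | ⟨j, hj⟩
        · omega
        · exact ⟨j, Finset.mem_Ico.2 (by omega), hj.symm⟩
    · intro i hi _
      rw [Finset.mem_union, mem_primesFromFive, Finset.mem_image] at hi
      rcases hi with hi | ⟨j, hj, rfl⟩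
      · exact hf _ hi.1
      · rw [Finset.mem_Ico] at hj
        exact hf _ (by omega)
  · rw [Finset.disjoint_left]
    intro p hp hq
    rw [mem_primesFromFive] at hp
    rw [Finset.mem_image] at hq
    obtain ⟨j, hj, rfl⟩ := hq
    rw [Finset.mem_Ico] at hj
    omega

lemma sum_Ico_telescope_le {f V : ℕ → ℝ} {a : ℕ} (h : ∀ j, a ≤ j → f j ≤ V j - V (j + 1))
    (hV : ∀ j, a ≤ j → 0 ≤ V j) (N : ℕ) : ∑ j ∈ Finset.Ico a (N + a), f j ≤ V a := by
  have : ∑ j ∈ Finset.Ico a (N + a), f j ≤ V a - V (N + a) := by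
    induction N with
    | zero => simp
    | succ n ih =>
      rw [show n + 1 + a = (n + a) + 1 by ring, Finset.sum_Ico_succ_top (by omega)]
      have := h (n + a) (by omega)
      linarith
  linarith [hV (N + a) (by omega)]

lemma log_ninety_seven_le : Real.log 97 ≤ 4.598 := by
  have := log_le_of_pow_le_two_pow (p := 97) (a := 199) (k := 30) (by norm_num) (by norm_num)
    (by norm_num)
  norm_num at this
  linarith

lemma sum_log_div_mul_pred_le (N : ℕ) :
    ∑ p ∈ primesFromFive N, Real.log p / ((p : ℝ) * (p - 1)) ≤ 0.247 := by
  have hf : ∀ n : ℕ, 5 ≤ n → 0 ≤ Real.log n / ((n : ℝ) * (n - 1)) := by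
    intro n hn
    have : (5 : ℝ) ≤ n := by exact_mod_cast hn
    have := Real.log_nonneg (show (1 : ℝ) ≤ n by linarith)
    apply div_nonneg this
    nlinarith
  refine (sum_primesFromFive_split hf N).trans ?_
  have hT := sum_Ico_telescope_le (a := 49)
    (f := fun j => Real.log (2 * j + 1 : ℕ) / (((2 * j + 1 : ℕ) : ℝ) * ((2 * j + 1 : ℕ) - 1)))
    (V := fun j => (Real.log (2 * j - 1) + 1) / (2 * (2 * j - 1)))
    (fun j hj => log_div_telescope hj) (fun j hj => by
      have : (49 : ℝ) ≤ j := by exact_mod_cast hj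
      have := Real.log_nonneg (show (1 : ℝ) ≤ 2 * j - 1 by linarith)
      apply div_nonneg <;> linarith) N
  have hV : (Real.log (2 * (49 : ℕ) - 1) + 1) / (2 * (2 * (49 : ℕ) - 1)) ≤ 0.0289 := by
    have := log_ninety_seven_le
    norm_num
    linarith
  have := hT.trans hV
  rw [primesFromFive_ninety_seven]
  have l5 := log_le_of_pow_le_two_pow (p := 5) (a := 70) (k := 30) (by norm_num) (by norm_num) (by norm_num)
  have l7 := log_le_of_pow_le_two_pow (p := 7) (a := 85) (k := 30) (by norm_num) (by norm_num) (by norm_num)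
  have l11 := log_le_of_pow_le_two_pow (p := 11) (a := 104) (k := 30) (by norm_num) (by norm_num) (by norm_num)
  have l13 := log_le_of_pow_le_two_pow (p := 13) (a := 112) (k := 30) (by norm_num) (by norm_num) (by norm_num)
  have l17 := log_le_of_pow_le_two_pow (p := 17) (a := 123) (k := 30) (by norm_num) (by norm_num) (by norm_num)
  have l19 := log_le_of_pow_le_two_pow (p := 19) (a := 128) (k := 30) (by norm_num) (by norm_num) (by norm_num)
  have l23 := log_le_of_pow_le_two_pow (p := 23) (a := 136) (k := 30) (by norm_num) (by norm_num) (by norm_num)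
  have l29 := log_le_of_pow_le_two_pow (p := 29) (a := 146) (k := 30) (by norm_num) (by norm_num) (by norm_num)
  have l31 := log_le_of_pow_le_two_pow (p := 31) (a := 149) (k := 30) (by norm_num) (by norm_num) (by norm_num)
  have l37 := log_le_of_pow_le_two_pow (p := 37) (a := 157) (k := 30) (by norm_num) (by norm_num) (by norm_num)
  have l41 := log_le_of_pow_le_two_pow (p := 41) (a := 161) (k := 30) (by norm_num) (by norm_num) (by norm_num)
  have l43 := log_le_of_pow_le_two_pow (p := 43) (a := 163) (k := 30) (by norm_num) (by norm_num) (by norm_num)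
  have l47 := log_le_of_pow_le_two_pow (p := 47) (a := 167) (k := 30) (by norm_num) (by norm_num) (by norm_num)
  have l64 : ∀ p : ℕ, 0 < p → p ≤ 64 → Real.log p ≤ 4.16 := fun p h0 h => by
    have h1 : p ^ 1 ≤ 2 ^ 6 := by simpa using h
    have := log_le_of_pow_le_two_pow (a := 6) (by norm_num) h0 h1
    norm_num at this
    linarith
  have l97 : ∀ p : ℕ, 0 < p → p ≤ 97 → Real.log p ≤ 4.598 := fun p h0 h => by
    refine le_trans (Real.log_le_log (by exact_mod_cast h0) ?_) log_ninety_seven_le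
    exact_mod_cast h
  have l53 := l64 53 (by norm_num) (by norm_num)
  have l59 := l64 59 (by norm_num) (by norm_num)
  have l61 := l64 61 (by norm_num) (by norm_num)
  have l67 := l97 67 (by norm_num) (by norm_num)
  have l71 := l97 71 (by norm_num) (by norm_num)
  have l73 := l97 73 (by norm_num) (by norm_num)
  have l79 := l97 79 (by norm_num) (by norm_num)
  have l83 := l97 83 (by norm_num) (by norm_num)
  have l89 := l97 89 (by norm_num) (by norm_num)
  have l97 := log_ninety_seven_le
  repeat rw [Finset.sum_insert (by decide)]
  rw [Finset.sum_singleton]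
  norm_num at *
  linarith

lemma log_factorial_le_sum {N : ℕ} (hN : 1 ≤ N) : Real.log (N.factorial) ≤
    (N - 1) * ∑ p ∈ (Finset.Icc 2 N).filter Nat.Prime, Real.log p / (p - 1) := by
  rw [log_factorial_eq_sum, Finset.mul_sum]
  apply Finset.sum_le_sum
  intro p hp
  simp only [Finset.mem_filter, Finset.mem_Icc] at hp
  have h1 := Nat.sub_one_mul_factorization_factorial (n := N) hp.2
  have h2 : (p - 1) * N.factorial.factorization p ≤ N - 1 := by
    rw [h1]
    have : 0 < (Nat.digits p N).sum := by
      rw [Nat.pos_iff_ne_zero]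
      intro h
      have h3 := Nat.modEq_digits_sum
      have : ∀ d ∈ Nat.digits p N, d = 0 := by
        intro d hd
        have := List.single_le_sum (l := Nat.digits p N) (by simp) d hd
        omega
      have h4 := Nat.getLast_digit_ne_zero p (m := N) (by omega)
      exact h4 (this _ (List.getLast_mem _))
    omega
  have h3 : ((p : ℝ) - 1) * N.factorial.factorization p ≤ N - 1 := by
    have : (((p - 1) * N.factorial.factorization p : ℕ) : ℝ) ≤ ((N - 1 : ℕ) : ℝ) := by
      exact_mod_cast h2
    rwa [Nat.cast_mul, Nat.cast_sub (by omega), Nat.cast_sub hN, Nat.cast_one] at this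
  have hp2 : (2 : ℝ) ≤ p := by exact_mod_cast hp.1.1
  have hlog := Real.log_nonneg (show (1 : ℝ) ≤ p by linarith)
  have h4 : (N.factorial.factorization p : ℝ) ≤ (N - 1) / (p - 1) := by
    rw [le_div_iff₀ (by linarith)]
    linarith
  calc _ ≤ ((N : ℝ) - 1) / (p - 1) * Real.log p := mul_le_mul_of_nonneg_right h4 hlog
    _ = _ := by ring

lemma log_three_le : Real.log 3 ≤ 1.0988 := by
  have := log_le_of_pow_le_two_pow (p := 3) (a := 149) (k := 94) (by norm_num) (by norm_num)
    (by norm_num)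
  norm_num at this
  linarith

lemma log_three_ge : 1.09 ≤ Real.log 3 := by
  have := log_ge_of_two_pow_le_pow (p := 3) (a := 158) (k := 100) (by norm_num) (by norm_num)
  norm_num at this
  linarith

lemma mertensSum_nonneg (n : ℕ) : 0 ≤ mertensSum n :=
  Finset.sum_nonneg fun p hp => div_nonneg (Real.log_natCast_nonneg p) (by positivity)

theorem le_mertensSum (N : ℕ) : Real.log (N + 1) - 2.49 ≤ mertensSum N := by
  rcases lt_or_ge N 3 with hN | hN
  · have h1 : Real.log ((N : ℝ) + 1) ≤ 2.49 := by
      have : Real.log ((N : ℝ) + 1) ≤ Real.log 3 := by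
        apply Real.log_le_log (by positivity)
        have : (N : ℝ) ≤ 2 := by exact_mod_cast (by omega : N ≤ 2)
        linarith
      linarith [log_three_le]
    linarith [mertensSum_nonneg N]
  · have hN' : (3 : ℝ) ≤ N := by exact_mod_cast hN
    have h1 := (le_log_factorial (N := N) (by omega)).trans (log_factorial_le_sum (by omega))
    set S := ∑ p ∈ (Finset.Icc 2 N).filter Nat.Prime, Real.log p / (p - 1) with hS
    have h2 : Real.log (N + 1) - 1 ≤ S := by
      have h3 : Real.log (N + 1) ≤ Real.log N + 1 / N := by
        have := Real.log_le_sub_one_of_pos (show (0 : ℝ) < (N + 1) / N by positivity)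
        rw [Real.log_div (by positivity) (by positivity)] at this
        have h2 : ((N : ℝ) + 1) / N - 1 = 1 / N := by field_simp; ring
        linarith
      have h4 : (N : ℝ) * Real.log (N + 1) ≤ N * Real.log N + 1 := by
        have := mul_le_mul_of_nonneg_left h3 (show (0 : ℝ) ≤ N by linarith)
        have h3 : (N : ℝ) * (1 / N) = 1 := by field_simp
        nlinarith
      have h5 : 1 ≤ Real.log ((N : ℝ) + 1) := by
        have : Real.log 3 ≤ Real.log (N + 1) := Real.log_le_log (by norm_num) (by linarith)
        linarith [log_three_ge]
      by_contra! hc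
      have : (N - 1 : ℝ) * S < (N - 1) * (Real.log (N + 1) - 1) :=
        mul_lt_mul_of_pos_left hc (by linarith)
      nlinarith
    have h3 : S ≤ 0.6931471808 + 1.0988 / 2 + (mertensSum N + 0.247) := by
      rw [hS, filter_prime_Icc_two hN, Finset.sum_insert, Finset.sum_insert]
      · have e : ∑ p ∈ primesFromFive N, Real.log p / ((p : ℝ) - 1) = mertensSum N +
            ∑ p ∈ primesFromFive N, Real.log p / ((p : ℝ) * (p - 1)) := by
          rw [mertensSum, ← Finset.sum_add_distrib]
          refine Finset.sum_congr rfl fun p hp => ?_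
          have : (5 : ℝ) ≤ p := by exact_mod_cast (mem_primesFromFive.1 hp).1
          have : (p : ℝ) - 1 ≠ 0 := by linarith
          have : (p : ℝ) ≠ 0 := by linarith
          field_simp
          ring
        rw [e]
        have := sum_log_div_mul_pred_le N
        have := log_three_le
        have := Real.log_two_lt_d9
        norm_num
        linarith
      · simp [mem_primesFromFive]
      · simp [mem_primesFromFive]
    norm_num at h3 ⊢
    linarith

lemma le_factorization_two_factorial {n : ℕ} (hn : 1 ≤ n) :
    n * Real.log 2 - Real.log n - Real.log 2 ≤
      (n.factorial.factorization 2 : ℝ) * Real.log 2 := by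
  have h1 := Nat.sub_one_mul_factorization_factorial (n := n) Nat.prime_two
  have h2 : (Nat.digits 2 n).sum ≤ Nat.log 2 n + 1 := by
    rw [← Nat.length_digits 2 n (by norm_num) (by omega)]
    have := List.sum_le_card_nsmul (Nat.digits 2 n) 1 (fun x hx => by
      have := Nat.digits_lt_base (by norm_num) hx
      omega)
    simpa using this
  have h3 : (2 : ℝ) ^ (Nat.log 2 n) ≤ n := by exact_mod_cast Nat.pow_log_le_self 2 (by omega)
  have h4 := Real.log_le_log (by positivity) h3
  rw [Real.log_pow] at h4
  have h5 : (n : ℝ) ≤ n.factorial.factorization 2 + Nat.log 2 n + 1 := by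
    exact_mod_cast (by omega : n ≤ n.factorial.factorization 2 + Nat.log 2 n + 1)
  have h6 := mul_le_mul_of_nonneg_right h5 (Real.log_nonneg (show (1 : ℝ) ≤ 2 by norm_num))
  linarith

lemma le_factorization_three_factorial {n : ℕ} (hn : 1 ≤ n) :
    n * (Real.log 3 / 2) - Real.log n - Real.log 3 ≤
      (n.factorial.factorization 3 : ℝ) * Real.log 3 := by
  have h1 := Nat.sub_one_mul_factorization_factorial (n := n) Nat.prime_three
  have h2 : (Nat.digits 3 n).sum ≤ (Nat.log 3 n + 1) * 2 := by
    rw [← Nat.length_digits 3 n (by norm_num) (by omega)]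
    have := List.sum_le_card_nsmul (Nat.digits 3 n) 2 (fun x hx => by
      have := Nat.digits_lt_base (by norm_num) hx
      omega)
    simpa using this
  have h3 : (3 : ℝ) ^ (Nat.log 3 n) ≤ n := by exact_mod_cast Nat.pow_log_le_self 3 (by omega)
  have h4 := Real.log_le_log (by positivity) h3
  rw [Real.log_pow] at h4
  have h5 : (n : ℝ) ≤ 2 * n.factorial.factorization 3 + (Nat.log 3 n + 1) * 2 := by
    exact_mod_cast (by omega : n ≤ 2 * n.factorial.factorization 3 + (Nat.log 3 n + 1) * 2)
  have h6 := mul_le_mul_of_nonneg_right h5 (Real.log_nonneg (show (1 : ℝ) ≤ 3 by norm_num))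
  linarith

lemma div_le_factorization_factorial {n p : ℕ} (hp : p.Prime) :
    n / p ≤ n.factorial.factorization p := by
  rw [Nat.factorization_factorial hp (show Nat.log p n < Nat.log p n + 2 by omega)]
  have := Finset.single_le_sum (f := fun i => n / p ^ i) (fun _ _ => Nat.zero_le _)
    (show 1 ∈ Finset.Ico 1 (Nat.log p n + 2) by simp)
  simpa using this

lemma sum_Ico_inv_sub_inv {m n : ℕ} (hmn : m ≤ n) :
    ∑ k ∈ Finset.Ico m n, ((1 : ℝ) / k - 1 / (k + 1 : ℕ)) = 1 / m - 1 / n := by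
  induction n, hmn using Nat.le_induction with
  | base => simp
  | succ n hn ih => rw [Finset.sum_Ico_succ_top hn, ih]; ring

lemma sum_Ico_inv_succ_le {m n : ℕ} (hm : 1 ≤ m) (hmn : m ≤ n) :
    ∑ k ∈ Finset.Ico m n, (1 : ℝ) / (k + 1 : ℕ) ≤ Real.log n - Real.log m := by
  induction n, hmn using Nat.le_induction with
  | base => simp
  | succ n hn ih =>
    rw [Finset.sum_Ico_succ_top hn]
    have hn0 : (0 : ℝ) < n := by exact_mod_cast (by omega : 0 < n)
    have := Real.log_le_sub_one_of_pos (show (0 : ℝ) < n / (n + 1 : ℕ) by positivity)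
    rw [Real.log_div (by positivity) (by positivity)] at this
    have h2 : (n : ℝ) / (n + 1 : ℕ) - 1 = - (1 / (n + 1 : ℕ)) := by push_cast; field_simp; ring
    linarith

lemma sum_log_primesFromFive_le (k : ℕ) :
    ∑ p ∈ primesFromFive k, Real.log p ≤ Real.log 4 * k := by
  refine le_trans ?_ (Chebyshev.theta_le_log4_mul_x (Nat.cast_nonneg k))
  rw [Chebyshev.theta_eq_sum_Icc, Nat.floor_natCast]
  apply Finset.sum_le_sum_of_subset_of_nonneg
  · intro p hp
    rw [mem_primesFromFive] at hp
    simp [hp.2.1, hp.2.2]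
  · intro i _ _
    exact Real.log_natCast_nonneg i

lemma fract_le_sum {n p : ℕ} (hn : 2 ≤ n) (hp : 1 ≤ p) (hpn : p ≤ n) :
    (n : ℝ) / p - (n / p : ℕ) ≤
      ∑ k ∈ Finset.Ico (n / 2) n, if p ≤ k then (n : ℝ) * (1 / k - 1 / (k + 1 : ℕ)) else 0 := by
  have hp' : (0 : ℝ) < p := by exact_mod_cast hp
  have hn' : (0 : ℝ) < n := by exact_mod_cast (by omega : 0 < n)
  rw [← Finset.sum_filter]
  rcases le_or_gt p (n / 2) with h | h
  · have : (Finset.Ico (n / 2) n).filter (fun k => p ≤ k) = Finset.Ico (n / 2) n := by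
      apply Finset.filter_true_of_mem
      intro k hk
      rw [Finset.mem_Ico] at hk
      omega
    rw [this, ← Finset.mul_sum, sum_Ico_inv_sub_inv (by omega)]
    have h1 : (n : ℝ) / p - (n / p : ℕ) ≤ 1 := by
      have : (n : ℝ) < p * ((n / p : ℕ) + 1) := by exact_mod_cast Nat.lt_mul_div_succ n (by omega)
      rw [sub_le_iff_le_add, div_le_iff₀ hp']
      nlinarith
    have h2 : (2 : ℝ) * (n / 2 : ℕ) ≤ n := by exact_mod_cast Nat.mul_div_le n 2
    have h3 : (1 : ℝ) ≤ (n / 2 : ℕ) := by exact_mod_cast (by omega : 1 ≤ n / 2)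
    have h4 : 2 ≤ (n : ℝ) / (n / 2 : ℕ) := by
      rw [le_div_iff₀ (by linarith)]
      exact h2
    have h5 : (n : ℝ) * (1 / (n / 2 : ℕ) - 1 / n) = n / (n / 2 : ℕ) - 1 := by
      field_simp
    linarith
  · have : (Finset.Ico (n / 2) n).filter (fun k => p ≤ k) = Finset.Ico p n := by
      ext k
      simp only [Finset.mem_filter, Finset.mem_Ico]
      omega
    rw [this, ← Finset.mul_sum, sum_Ico_inv_sub_inv hpn]
    have h1 : n / p = 1 := Nat.div_eq_of_lt_le (by omega) (by omega)
    rw [h1]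
    have h5 : (n : ℝ) * (1 / p - 1 / n) = n / p - 1 := by
      field_simp
    rw [h5]
    simp

theorem mertensSum_mul_le {n : ℕ} (hn : 3 ≤ n) :
    n * mertensSum n ≤ n * Real.log n - n + Real.log n + 1
      - (n * Real.log 2 - Real.log n - Real.log 2) - (n * (Real.log 3 / 2) - Real.log n - Real.log 3)
      + Real.log 4 * (n * (Real.log n - Real.log (n / 2 : ℕ))) := by
  have h1 : ∑ p ∈ primesFromFive n, ((n / p : ℕ) : ℝ) * Real.log p ≤
      n * Real.log n - n + Real.log n + 1
      - (n * Real.log 2 - Real.log n - Real.log 2)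
      - (n * (Real.log 3 / 2) - Real.log n - Real.log 3) := by
    have h2 := log_factorial_le (n := n) (by omega)
    rw [log_factorial_eq_sum, filter_prime_Icc_two hn, Finset.sum_insert, Finset.sum_insert] at h2
    · have h3 := le_factorization_two_factorial (n := n) (by omega)
      have h4 := le_factorization_three_factorial (n := n) (by omega)
      have h5 : ∑ p ∈ primesFromFive n, ((n / p : ℕ) : ℝ) * Real.log p ≤
          ∑ p ∈ primesFromFive n, (n.factorial.factorization p : ℝ) * Real.log p := by
        apply Finset.sum_le_sum
        intro p hp
        apply mul_le_mul_of_nonneg_right _ (Real.log_natCast_nonneg p)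
        exact_mod_cast div_le_factorization_factorial (mem_primesFromFive.1 hp).2.2
      push_cast at h2
      linarith
    · simp [mem_primesFromFive]
    · simp [mem_primesFromFive]
  have h2 : n * mertensSum n - ∑ p ∈ primesFromFive n, ((n / p : ℕ) : ℝ) * Real.log p ≤
      Real.log 4 * (n * (Real.log n - Real.log (n / 2 : ℕ))) := by
    calc _ = ∑ p ∈ primesFromFive n, ((n : ℝ) / p - (n / p : ℕ)) * Real.log p := by
          rw [mertensSum, Finset.mul_sum, ← Finset.sum_sub_distrib]
          exact Finset.sum_congr rfl fun p _ => by ring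
      _ ≤ ∑ p ∈ primesFromFive n, (∑ k ∈ Finset.Ico (n / 2) n,
            if p ≤ k then (n : ℝ) * (1 / k - 1 / (k + 1 : ℕ)) else 0) * Real.log p := by
          apply Finset.sum_le_sum
          intro p hp
          rw [mem_primesFromFive] at hp
          exact mul_le_mul_of_nonneg_right (fract_le_sum (by omega) (by omega) hp.2.1)
            (Real.log_natCast_nonneg p)
      _ = ∑ k ∈ Finset.Ico (n / 2) n, (n : ℝ) * (1 / k - 1 / (k + 1 : ℕ)) *
            ∑ p ∈ (primesFromFive n).filter (fun p => p ≤ k), Real.log p := by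
          simp_rw [Finset.sum_mul]
          rw [Finset.sum_comm]
          refine Finset.sum_congr rfl fun k _ => ?_
          rw [Finset.sum_filter, Finset.mul_sum]
          refine Finset.sum_congr rfl fun p _ => ?_
          split_ifs <;> simp
      _ ≤ ∑ k ∈ Finset.Ico (n / 2) n, Real.log 4 * n * (1 / (k + 1 : ℕ)) := by
          apply Finset.sum_le_sum
          intro k hk
          rw [Finset.mem_Ico] at hk
          have hk0 : (0 : ℝ) < k := by exact_mod_cast (by omega : 0 < k)
          have e : (primesFromFive n).filter (fun p => p ≤ k) = primesFromFive k := by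
            ext p
            simp only [Finset.mem_filter, mem_primesFromFive]
            constructor
            · rintro ⟨h, h'⟩; exact ⟨h.1, h', h.2.2⟩
            · rintro h; exact ⟨⟨h.1, by omega, h.2.2⟩, h.2.1⟩
          rw [e]
          have h3 : (1 : ℝ) / k - 1 / (k + 1 : ℕ) = 1 / (k * (k + 1 : ℕ)) := by
            push_cast
            field_simp
            ring
          rw [h3]
          calc _ ≤ (n : ℝ) * (1 / (k * (k + 1 : ℕ))) * (Real.log 4 * k) :=
                mul_le_mul_of_nonneg_left (sum_log_primesFromFive_le k) (by positivity)
            _ = _ := by field_simp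
      _ ≤ _ := by
          rw [← Finset.mul_sum, mul_assoc]
          apply mul_le_mul_of_nonneg_left _ (Real.log_nonneg (by norm_num))
          exact mul_le_mul_of_nonneg_left (sum_Ico_inv_succ_le (by omega) (by omega)) (by positivity)
  linarith

lemma log_sub_log_half_le {n : ℕ} (hn : 2 ≤ n) :
    n * (Real.log n - Real.log (n / 2 : ℕ)) ≤ n * Real.log 2 + n / (n - 1) := by
  have hn' : (2 : ℝ) ≤ n := by exact_mod_cast hn
  have h1 : ((n : ℝ) - 1) / 2 ≤ (n / 2 : ℕ) := by
    have : (n : ℝ) ≤ 2 * (n / 2 : ℕ) + 1 := by exact_mod_cast (by omega : n ≤ 2 * (n / 2) + 1)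
    linarith
  have h2 : Real.log (((n : ℝ) - 1) / 2) ≤ Real.log (n / 2 : ℕ) :=
    Real.log_le_log (by linarith) h1
  rw [Real.log_div (by linarith) (by norm_num)] at h2
  have h3 := Real.log_le_sub_one_of_pos (show (0 : ℝ) < n / (n - 1) by
    apply div_pos <;> linarith)
  rw [Real.log_div (by linarith) (by linarith)] at h3
  have h4 : (n : ℝ) / (n - 1) - 1 = 1 / (n - 1) := by
    have : (n : ℝ) - 1 ≠ 0 := by linarith
    field_simp
    ring
  have h5 : Real.log n - Real.log (n / 2 : ℕ) ≤ Real.log 2 + 1 / (n - 1) := by linarith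
  calc _ ≤ (n : ℝ) * (Real.log 2 + 1 / (n - 1)) := mul_le_mul_of_nonneg_left h5 (by linarith)
    _ = _ := by ring

lemma log_le_div_add {x c : ℝ} (hx : 0 < x) (hc : 0 < c) : Real.log x ≤ x / c + Real.log c - 1 := by
  have := Real.log_le_sub_one_of_pos (show (0 : ℝ) < x / c by positivity)
  rw [Real.log_div (by positivity) (by positivity)] at this
  linarith

lemma log_three_ge_of_pow : 1.098 ≤ Real.log 3 := by
  have := log_ge_of_two_pow_le_pow (p := 3) (a := 84) (k := 53) (by norm_num) (by norm_num)
  norm_num at this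
  linarith

lemma mertensSum_mul_le' {n : ℕ} (hn : 10 ≤ n) :
    n * mertensSum n ≤ n * Real.log n - 1.2772 * n + 3 * Real.log n + 4.34 := by
  have h := mertensSum_mul_le (n := n) (by omega)
  have h1 := log_sub_log_half_le (n := n) (by omega)
  have hn' : (10 : ℝ) ≤ n := by exact_mod_cast hn
  have h2 : (n : ℝ) / (n - 1) ≤ 1.1112 := by
    rw [div_le_iff₀ (by linarith)]
    linarith
  have h4 : Real.log 4 = 2 * Real.log 2 := by
    rw [show (4 : ℝ) = 2 ^ 2 by norm_num, Real.log_pow]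
    norm_num
  have l2 := Real.log_two_lt_d9
  have l2' := Real.log_two_gt_d9
  have l3 := log_three_le
  have l3' := log_three_ge_of_pow
  have h5 : Real.log 4 * (n * (Real.log n - Real.log (n / 2 : ℕ))) ≤
      1.3862943616 * (n * 0.6931471808 + 1.1112) := by
    apply (mul_le_mul_of_nonneg_left h1 (by linarith)).trans
    have : (n : ℝ) * Real.log 2 ≤ n * 0.6931471808 :=
      mul_le_mul_of_nonneg_left l2.le (by linarith)
    apply mul_le_mul (by linarith) (by linarith) _ (by norm_num)
    have : 0 ≤ (n : ℝ) * Real.log 2 := by positivity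
    have : 0 ≤ (n : ℝ) / (n - 1) := div_nonneg (by linarith) (by linarith)
    linarith
  have h6 : (n : ℝ) * 0.6931471803 ≤ n * Real.log 2 :=
    mul_le_mul_of_nonneg_left l2'.le (by linarith)
  have h7 : (n : ℝ) * (1.098 / 2) ≤ n * (Real.log 3 / 2) :=
    mul_le_mul_of_nonneg_left (by linarith) (by linarith)
  linarith

theorem mertensSum_le_of_large {n : ℕ} (hn : 1024 ≤ n) : mertensSum n ≤ Real.log n - 1.25 := by
  have h := mertensSum_mul_le' (n := n) (by omega)
  have hn' : (1024 : ℝ) ≤ n := by exact_mod_cast hn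
  have h1 := log_le_div_add (x := n) (c := 1024) (by linarith) (by norm_num)
  have h2 : Real.log 1024 ≤ 6.932 := by
    rw [show (1024 : ℝ) = 2 ^ 10 by norm_num, Real.log_pow]
    have := Real.log_two_lt_d9
    push_cast
    linarith
  have h3 : (n : ℝ) * mertensSum n ≤ n * (Real.log n - 1.25) := by linarith
  exact le_of_mul_le_mul_left h3 (by linarith)

theorem mertensSum_le_log {n : ℕ} (hn : 1 ≤ n) : mertensSum n ≤ Real.log n := by
  rcases lt_or_ge n 10 with h10 | h10
  · rcases lt_or_ge n 5 with h5 | h5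
    · have : mertensSum n = 0 := by
        rw [mertensSum, primesFromFive, Finset.Icc_eq_empty (by omega)]
        simp
      rw [this]
      exact Real.log_natCast_nonneg n
    · have h1 : mertensSum n ≤ mertensSum 9 := by
        apply Finset.sum_le_sum_of_subset_of_nonneg
        · intro p hp
          rw [mem_primesFromFive] at *
          exact ⟨hp.1, by omega, hp.2.2⟩
        · intro p _ _
          exact div_nonneg (Real.log_natCast_nonneg p) (by positivity)
      have h2 : mertensSum 9 ≤ 1 := by
        have e : primesFromFive 9 = {5, 7} := by decide +kernel
        rw [mertensSum, e, Finset.sum_pair (by norm_num)]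
        have h1 := Real.log_le_sub_one_of_pos (show (0 : ℝ) < 5 / 2 by norm_num)
        have h2 := Real.log_le_sub_one_of_pos (show (0 : ℝ) < 7 / 4 by norm_num)
        rw [Real.log_div (by norm_num) (by norm_num)] at h1 h2
        have h4 : Real.log 4 = 2 * Real.log 2 := by
          rw [show (4 : ℝ) = 2 ^ 2 by norm_num, Real.log_pow]
          norm_num
        have l2 := Real.log_two_lt_d9
        norm_num at *
        linarith
      have h3 : Real.log 3 ≤ Real.log n := Real.log_le_log (by norm_num) (by
        exact_mod_cast (by omega : 3 ≤ n))
      linarith [log_three_ge]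
  · have h := mertensSum_mul_le' h10
    have hn' : (10 : ℝ) ≤ n := by exact_mod_cast h10
    have h1 := log_le_div_add (x := n) (c := 8) (by linarith) (by norm_num)
    have h2 : Real.log 8 ≤ 2.08 := by
      rw [show (8 : ℝ) = 2 ^ 3 by norm_num, Real.log_pow]
      have := Real.log_two_lt_d9
      push_cast
      linarith
    have h3 : (n : ℝ) * mertensSum n ≤ n * Real.log n := by linarith
    exact le_of_mul_le_mul_left h3 (by linarith)

/-- The step function `t ↦ ∑ log p / p` over primes `5 ≤ p ≤ e ^ t`. -/
noncomputable def mertensExp (t : ℝ) : ℝ := mertensSum ⌊Real.exp t⌋₊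

lemma mertensSum_mono : Monotone mertensSum := by
  intro m n h
  apply Finset.sum_le_sum_of_subset_of_nonneg
  · intro p hp
    rw [mem_primesFromFive] at *
    exact ⟨hp.1, hp.2.1.trans h, hp.2.2⟩
  · intro p _ _
    exact div_nonneg (Real.log_natCast_nonneg p) (by positivity)

lemma mertensExp_mono : Monotone mertensExp := fun _ _ h =>
  mertensSum_mono (Nat.floor_le_floor (Real.exp_le_exp.2 h))

lemma le_mertensExp (t : ℝ) : t - 2.49 ≤ mertensExp t := by
  refine le_trans ?_ (le_mertensSum _)
  have h : Real.exp t ≤ (⌊Real.exp t⌋₊ : ℝ) + 1 := (Nat.lt_floor_add_one _).le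
  have := Real.log_le_log (Real.exp_pos t) h
  rw [Real.log_exp] at this
  linarith

lemma log_floor_exp_le {t : ℝ} (ht : 0 ≤ t) : Real.log ⌊Real.exp t⌋₊ ≤ t := by
  have h1 : 1 ≤ ⌊Real.exp t⌋₊ := by
    rw [Nat.one_le_floor_iff]
    exact Real.one_le_exp ht
  have := Real.log_le_log (by exact_mod_cast h1) (Nat.floor_le (Real.exp_pos t).le)
  rwa [Real.log_exp] at this

lemma mertensExp_le {t : ℝ} (ht : 0 ≤ t) : mertensExp t ≤ t := by
  have h1 : 1 ≤ ⌊Real.exp t⌋₊ := by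
    rw [Nat.one_le_floor_iff]
    exact Real.one_le_exp ht
  exact (mertensSum_le_log h1).trans (log_floor_exp_le ht)

lemma mertensExp_le_of_large {t : ℝ} (ht : 10 * Real.log 2 ≤ t) : mertensExp t ≤ t - 1.25 := by
  have h0 : 0 ≤ t := le_trans (by positivity) ht
  have h1 : 1024 ≤ ⌊Real.exp t⌋₊ := by
    apply Nat.le_floor
    have h2 := Real.exp_le_exp.2 ht
    have h3 : Real.exp (10 * Real.log 2) = 1024 := by
      rw [show (10 : ℝ) * Real.log 2 = Real.log (2 ^ 10) by rw [Real.log_pow]; norm_num,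
        Real.exp_log (by norm_num)]
      norm_num
    rw [h3] at h2
    exact_mod_cast h2
  have := mertensSum_le_of_large h1
  have := log_floor_exp_le h0
  unfold mertensExp
  linarith

lemma integral_ite_ge {a b s : ℝ} (g : ℝ → ℝ) (has : a ≤ s) (hsb : s ≤ b)
    (hg : IntervalIntegrable g MeasureTheory.volume s b) :
    IntervalIntegrable (fun t => if s ≤ t then g t else 0) MeasureTheory.volume a b ∧
    ∫ t in a..b, (if s ≤ t then g t else 0) = ∫ t in s..b, g t := by
  have h1 : IntervalIntegrable (fun t => if s ≤ t then g t else 0) MeasureTheory.volume s b := by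
    apply hg.congr
    intro t ht
    rw [Set.uIoc_of_le hsb] at ht
    simp [ht.1.le]
  have h2 : (fun _ => (0 : ℝ)) =ᵐ[MeasureTheory.volume.restrict (Set.uIoc a s)]
      (fun t => if s ≤ t then g t else 0) := by
    rw [Set.uIoc_of_le has, ← MeasureTheory.restrict_Ioo_eq_restrict_Ioc]
    filter_upwards [MeasureTheory.ae_restrict_mem measurableSet_Ioo] with t ht
    simp [ht.2]
  have h3 : IntervalIntegrable (fun t => if s ≤ t then g t else 0) MeasureTheory.volume a s := by
    have : IntervalIntegrable (fun _ => (0 : ℝ)) MeasureTheory.volume a s :=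
      intervalIntegrable_const
    exact this.congr_ae h2
  refine ⟨h3.trans h1, ?_⟩
  rw [← intervalIntegral.integral_add_adjacent_intervals h3 h1]
  have e1 : ∫ t in a..s, (if s ≤ t then g t else 0) = 0 := by
    rw [intervalIntegral.integral_congr_ae_restrict h2.symm]
    simp
  have e2 : ∫ t in s..b, (if s ≤ t then g t else 0) = ∫ t in s..b, g t := by
    apply intervalIntegral.integral_congr
    intro t ht
    rw [Set.uIcc_of_le hsb] at ht
    simp [ht.1]
  rw [e1, e2, zero_add]

lemma mertensExp_eq_sum {r : ℕ} (hr : 1 ≤ r) {t : ℝ} (ht : t ≤ Real.log r) :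
    mertensExp t = ∑ p ∈ primesFromFive r, if Real.log p ≤ t then Real.log p / p else 0 := by
  rw [← Finset.sum_filter, mertensExp, mertensSum]
  apply Finset.sum_congr _ fun _ _ => rfl
  ext p
  rw [Finset.mem_filter, mem_primesFromFive, mem_primesFromFive]
  have key : 5 ≤ p → (p ≤ ⌊Real.exp t⌋₊ ↔ Real.log p ≤ t) := by
    intro hp
    have hp' : (0 : ℝ) < p := by exact_mod_cast (by omega : 0 < p)
    rw [Nat.le_floor_iff (Real.exp_pos t).le, Real.log_le_iff_le_exp hp']
  constructor
  · rintro ⟨h1, h2, h3⟩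
    refine ⟨⟨h1, ?_, h3⟩, (key h1).1 h2⟩
    have h4 := (key h1).1 h2
    have h5 := (Real.log_le_log_iff (by exact_mod_cast (by omega : 0 < p))
      (by exact_mod_cast hr)).1 (h4.trans ht)
    exact_mod_cast h5
  · rintro ⟨⟨h1, _, h3⟩, h4⟩
    exact ⟨h1, (key h1).2 h4, h3⟩

lemma log_primesFromFive {r p : ℕ} (hp : p ∈ primesFromFive r) :
    1 < Real.log p ∧ Real.log p ≤ Real.log r := by
  rw [mem_primesFromFive] at hp
  have h5 : (5 : ℝ) ≤ p := by exact_mod_cast hp.1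
  constructor
  · have : Real.log 3 ≤ Real.log p := Real.log_le_log (by norm_num) (by linarith)
    linarith [log_three_ge]
  · exact Real.log_le_log (by linarith) (by exact_mod_cast hp.2.1)

lemma sum_sub_min_eq_integral {r : ℕ} (hr : 1 ≤ r) {v : ℝ} (hv : 0 ≤ v) (hvr : v ≤ Real.log r) :
    ∑ p ∈ primesFromFive r, Real.log p / p * (v - min (Real.log p) v) =
      ∫ t in (0 : ℝ)..v, mertensExp t := by
  have h1 : ∫ t in (0 : ℝ)..v, mertensExp t = ∫ t in (0 : ℝ)..v,
      ∑ p ∈ primesFromFive r, if min (Real.log p) v ≤ t then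
        (if Real.log p ≤ v then Real.log p / p else 0) else 0 := by
    apply intervalIntegral.integral_congr_ae
    have : ∀ᵐ t : ℝ, t ≠ v := by
      simp [MeasureTheory.ae_iff]
    filter_upwards [this] with t htv ht
    rw [Set.uIoc_of_le hv] at ht
    rw [mertensExp_eq_sum hr (ht.2.trans hvr)]
    refine Finset.sum_congr rfl fun p _ => ?_
    have htv' : t < v := lt_of_le_of_ne ht.2 htv
    by_cases h : Real.log p ≤ t
    · have : Real.log p ≤ v := by linarith
      simp [h, this]
    · by_cases h2 : Real.log p ≤ v
      · simp [h, h2]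
      · simp [h, h2]
  have h2 : ∀ p ∈ primesFromFive r, _ := fun p hp =>
    integral_ite_ge (a := 0) (b := v) (s := min (Real.log p) v)
      (fun _ => if Real.log p ≤ v then Real.log p / p else 0)
      (le_min (Real.log_natCast_nonneg p) hv) (min_le_right _ _) intervalIntegrable_const
  rw [h1, intervalIntegral.integral_finsetSum fun p hp => (h2 p hp).1]
  refine Finset.sum_congr rfl fun p hp => ?_
  rw [(h2 p hp).2, intervalIntegral.integral_const, smul_eq_mul]
  split_ifs with h
  · ring
  · rw [min_eq_right (le_of_not_ge h)]
    simp

lemma le_sum_sub_min {r : ℕ} (hr : 1 ≤ r) {v : ℝ} (hv : 0 ≤ v) (hvr : v ≤ Real.log r) :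
    v ^ 2 / 2 - 2.49 * v ≤
      ∑ p ∈ primesFromFive r, Real.log p / p * (v - min (Real.log p) v) := by
  rw [sum_sub_min_eq_integral hr hv hvr]
  have h1 : ∫ t in (0 : ℝ)..v, (t - 2.49) = v ^ 2 / 2 - 2.49 * v := by
    rw [intervalIntegral.integral_sub (by simp) (by simp)]
    simp
    ring
  rw [← h1]
  apply intervalIntegral.integral_mono_on hv
  · apply Continuous.intervalIntegrable; fun_prop
  · exact mertensExp_mono.intervalIntegrable
  · intro t _
    exact le_mertensExp t

lemma intervalIntegrable_inv_sq {a b : ℝ} (ha : 0 < a) (hab : a ≤ b) :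
    IntervalIntegrable (fun t : ℝ => (t ^ 2)⁻¹) MeasureTheory.volume a b := by
  apply ContinuousOn.intervalIntegrable
  rw [Set.uIcc_of_le hab]
  apply ContinuousOn.inv₀ (by fun_prop)
  intro t ht
  have : 0 < t := lt_of_lt_of_le ha ht.1
  positivity

lemma integral_inv_sq {a b : ℝ} (ha : 0 < a) (hab : a ≤ b) :
    ∫ t in a..b, (t ^ 2)⁻¹ = a⁻¹ - b⁻¹ := by
  have h := intervalIntegral.integral_eq_sub_of_hasDerivAt (a := a) (b := b)
    (f := fun t : ℝ => -t⁻¹) (f' := fun t => (t ^ 2)⁻¹) (fun t ht => by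
      rw [Set.uIcc_of_le hab] at ht
      have := (hasDerivAt_inv (x := t) (by linarith [ht.1])).neg
      simpa [Pi.neg_def] using this) (intervalIntegrable_inv_sq ha hab)
  rw [h]
  ring

lemma sum_div_max_eq_integral {r : ℕ} (hr : 1 ≤ r) {v : ℝ} (hv : 0 < v) (hvr : v ≤ Real.log r) :
    ∑ p ∈ primesFromFive r, Real.log p / p / max (Real.log p) v =
      mertensSum r / Real.log r + ∫ t in v..Real.log r, (t ^ 2)⁻¹ * mertensExp t := by
  have h1 : ∫ t in v..Real.log r, (t ^ 2)⁻¹ * mertensExp t = ∫ t in v..Real.log r,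
      ∑ p ∈ primesFromFive r, if max (Real.log p) v ≤ t then
        (t ^ 2)⁻¹ * (Real.log p / p) else 0 := by
    apply intervalIntegral.integral_congr
    intro t ht
    rw [Set.uIcc_of_le hvr] at ht
    simp only
    rw [mertensExp_eq_sum hr ht.2, Finset.mul_sum]
    refine Finset.sum_congr rfl fun p _ => ?_
    by_cases h : Real.log p ≤ t
    · simp [h, ht.1]
    · simp [h]
  have h2 : ∀ p ∈ primesFromFive r, _ := fun p hp =>
    integral_ite_ge (a := v) (b := Real.log r) (s := max (Real.log p) v)
      (fun t => (t ^ 2)⁻¹ * (Real.log p / p))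
      (le_max_right _ _) (max_le (log_primesFromFive hp).2 hvr)
      ((intervalIntegrable_inv_sq (lt_of_lt_of_le hv (le_max_right _ _))
        (max_le (log_primesFromFive hp).2 hvr)).mul_const _)
  rw [h1, intervalIntegral.integral_finsetSum fun p hp => (h2 p hp).1, mertensSum,
    Finset.sum_div, ← Finset.sum_add_distrib]
  refine Finset.sum_congr rfl fun p hp => ?_
  rw [(h2 p hp).2, intervalIntegral.integral_mul_const,
    integral_inv_sq (lt_of_lt_of_le hv (le_max_right _ _))
        (max_le (log_primesFromFive hp).2 hvr)]
  ring

lemma integral_le_of_le_sub {a b c : ℝ} (ha : 0 < a) (hab : a ≤ b)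
    (h : ∀ t, a ≤ t → mertensExp t ≤ t - c) :
    ∫ t in a..b, (t ^ 2)⁻¹ * mertensExp t ≤ Real.log (b / a) - c * (a⁻¹ - b⁻¹) := by
  have h1 : ∫ t in a..b, (t⁻¹ - (t ^ 2)⁻¹ * c) = Real.log (b / a) - c * (a⁻¹ - b⁻¹) := by
    rw [intervalIntegral.integral_sub, intervalIntegral.integral_mul_const,
      integral_inv_sq ha hab, integral_inv_of_pos ha (by linarith)]
    · ring
    · apply intervalIntegral.intervalIntegrable_inv
      · intro t ht
        rw [Set.uIcc_of_le hab] at ht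
        linarith [ht.1]
      · fun_prop
    · exact (intervalIntegrable_inv_sq ha hab).mul_const _
  rw [← h1]
  apply intervalIntegral.integral_mono_on hab
  · apply mertensExp_mono.intervalIntegrable.continuousOn_mul
    rw [Set.uIcc_of_le hab]
    apply ContinuousOn.inv₀ (by fun_prop)
    intro t ht
    have : 0 < t := lt_of_lt_of_le ha ht.1
    positivity
  · apply IntervalIntegrable.sub
    · apply intervalIntegral.intervalIntegrable_inv
      · intro t ht
        rw [Set.uIcc_of_le hab] at ht
        linarith [ht.1]
      · fun_prop
    · exact (intervalIntegrable_inv_sq ha hab).mul_const _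
  · intro t ht
    have ht0 : 0 < t := by linarith [ht.1]
    have := mul_le_mul_of_nonneg_left (h t ht.1) (show 0 ≤ (t ^ 2)⁻¹ by positivity)
    have e : (t ^ 2)⁻¹ * (t - c) = t⁻¹ - (t ^ 2)⁻¹ * c := by field_simp
    linarith

lemma mertensSum_div_log_le {r : ℕ} (hr : 1024 ≤ r) :
    mertensSum r / Real.log r ≤ 1 - 1.25 * (Real.log r)⁻¹ := by
  have h := mertensSum_le_of_large hr
  have hpos : 0 < Real.log r := Real.log_pos (by exact_mod_cast (by omega : 1 < r))
  rw [div_le_iff₀ hpos]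
  have : (1 - 1.25 * (Real.log r)⁻¹) * Real.log r = Real.log r - 1.25 := by field_simp
  linarith

theorem sum_div_max_le {r : ℕ} (hr : 1024 ≤ r) {v : ℝ} (hv : 10 * Real.log 2 ≤ v)
    (hvr : v ≤ Real.log r) :
    ∑ p ∈ primesFromFive r, Real.log p / p / max (Real.log p) v ≤
      1 + Real.log (Real.log r / v) - 1.25 * v⁻¹ := by
  have hv0 : 0 < v := lt_of_lt_of_le (by positivity) hv
  rw [sum_div_max_eq_integral (by omega) hv0 hvr]
  have h1 := integral_le_of_le_sub hv0 hvr (c := 1.25)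
    (fun t ht => mertensExp_le_of_large (hv.trans ht))
  have h2 := mertensSum_div_log_le hr
  linarith

theorem sum_div_max_le_of_small {r : ℕ} (hr : 1024 ≤ r) {v : ℝ} (hv : 0 < v)
    (hvs : v ≤ 10 * Real.log 2) :
    ∑ p ∈ primesFromFive r, Real.log p / p / max (Real.log p) v ≤
      1 + Real.log (Real.log r / v) - 1.25 * (10 * Real.log 2)⁻¹ := by
  have hs : 10 * Real.log 2 ≤ Real.log r := by
    rw [show (10 : ℝ) * Real.log 2 = Real.log (2 ^ 10) by rw [Real.log_pow]; norm_num]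
    apply Real.log_le_log (by norm_num)
    have : (1024 : ℝ) ≤ r := by exact_mod_cast hr
    linarith
  have hs0 : 0 < 10 * Real.log 2 := by positivity
  have hr0 : 0 < Real.log r := hs0.trans_le hs
  rw [sum_div_max_eq_integral (by omega) hv (hvs.trans hs)]
  have h1 := integral_le_of_le_sub hs0 hs (c := 1.25)
    (fun t ht => mertensExp_le_of_large ht)
  have h1' := integral_le_of_le_sub hv hvs (c := 0)
    (fun t ht => by linarith [mertensExp_le (hv.le.trans ht)])
  have h_integrable : ∀ a b, 0 < a → a ≤ b →
      IntervalIntegrable (fun t => (t ^ 2)⁻¹ * mertensExp t) MeasureTheory.volume a b := by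
    intro a b ha hab
    apply mertensExp_mono.intervalIntegrable.continuousOn_mul
    rw [Set.uIcc_of_le hab]
    apply ContinuousOn.inv₀ (by fun_prop)
    intro t ht
    have : 0 < t := lt_of_lt_of_le ha ht.1
    positivity
  rw [← intervalIntegral.integral_add_adjacent_intervals (h_integrable _ _ hv hvs) (h_integrable _ _ hs0 hs)]
  have h2 := mertensSum_div_log_le hr
  have h3 : Real.log (10 * Real.log 2 / v) + Real.log (Real.log r / (10 * Real.log 2)) =
      Real.log (Real.log r / v) := by
    rw [← Real.log_mul (by positivity) (by positivity)]
    congr 1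
    field_simp
  linarith

theorem sum_inv_primes_Ioc_le {n r : ℕ} (hn : 1024 ≤ n) (hnr : n ≤ r) :
    ∑ p ∈ (primesFromFive r).filter (fun p => n < p), (1 : ℝ) / p ≤
      Real.log (Real.log r / Real.log n) + 1.24 * (Real.log n)⁻¹ := by
  have hn0 : (1024 : ℝ) ≤ n := by exact_mod_cast hn
  have hY : 10 * Real.log 2 ≤ Real.log n := by
    rw [show (10 : ℝ) * Real.log 2 = Real.log (2 ^ 10) by rw [Real.log_pow]; norm_num]
    apply Real.log_le_log (by norm_num)
    linarith
  have hYr : Real.log n ≤ Real.log r := Real.log_le_log (by linarith) (by exact_mod_cast hnr)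
  have hY0 : 0 < Real.log n := lt_of_lt_of_le (by positivity) hY
  have h1 := sum_div_max_le (r := r) (by omega) hY hYr
  rw [← Finset.sum_filter_add_sum_filter_not _ (fun p => n < p)] at h1
  have h2 : ∑ p ∈ (primesFromFive r).filter (fun p => n < p),
      Real.log p / p / max (Real.log p) (Real.log n) =
      ∑ p ∈ (primesFromFive r).filter (fun p => n < p), (1 : ℝ) / p := by
    refine Finset.sum_congr rfl fun p hp => ?_
    rw [Finset.mem_filter] at hp
    have h3 := (log_primesFromFive hp.1).1
    have h4 : Real.log n ≤ Real.log p :=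
      Real.log_le_log (by linarith) (by exact_mod_cast hp.2.le)
    rw [max_eq_left h4]
    have : (p : ℝ) ≠ 0 := by
      have := (mem_primesFromFive.1 hp.1).1
      positivity
    field_simp
  have h3 : ∑ p ∈ (primesFromFive r).filter (fun p => ¬ n < p),
      Real.log p / p / max (Real.log p) (Real.log n) = mertensSum n / Real.log n := by
    rw [mertensSum, Finset.sum_div]
    have e : (primesFromFive r).filter (fun p => ¬ n < p) = primesFromFive n := by
      ext p
      simp only [Finset.mem_filter, mem_primesFromFive]
      constructor
      · rintro ⟨h, h'⟩; exact ⟨h.1, by omega, h.2.2⟩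
      · rintro h; exact ⟨⟨h.1, by omega, h.2.2⟩, by omega⟩
    rw [e]
    refine Finset.sum_congr rfl fun p hp => ?_
    rw [max_eq_right (log_primesFromFive hp).2]
  rw [h2, h3] at h1
  have h4 := le_mertensSum n
  have h5 : Real.log n ≤ Real.log (n + 1) := Real.log_le_log (by linarith) (by linarith)
  have h6 : 1 - 2.49 * (Real.log n)⁻¹ ≤ mertensSum n / Real.log n := by
    rw [le_div_iff₀ hY0]
    have : (1 - 2.49 * (Real.log n)⁻¹) * Real.log n = Real.log n - 2.49 := by field_simp
    linarith
  linarith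

lemma quad_le_mul_log {u : ℝ} (hu : 0 < u) (hu2 : u ≤ 2) :
    0.386 * (u - 1) ^ 2 ≤ u * Real.log u - u + 1 := by
  set φ : ℝ → ℝ := fun u => Real.log u - 0.228 + 0.614 * u⁻¹ - 0.386 * u with hφ
  have hd : ∀ x : ℝ, 0 < x → HasDerivAt φ ((x - 1) * (0.614 - 0.386 * x) / x ^ 2) x := by
    intro x hx
    have h := (((Real.hasDerivAt_log hx.ne').sub_const 0.228).add
      ((hasDerivAt_inv hx.ne').const_mul 0.614)).sub ((hasDerivAt_id x).const_mul 0.386)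
    refine HasDerivAt.congr_deriv (f := φ) h ?_
    field_simp
    ring
  have hc : ∀ s : Set ℝ, (∀ x ∈ s, 0 < x) → ContinuousOn φ s := fun s hs x hx =>
    (hd x (hs x hx)).continuousAt.continuousWithinAt
  have h1 : φ 1 = 0 := by simp [hφ]; norm_num
  have h2 : 0 ≤ φ 2 := by
    have := Real.log_two_gt_d9
    simp only [hφ]
    norm_num at *
    linarith
  have key : 0 ≤ φ u := by
    rcases le_or_gt u 1 with h | h
    · have : AntitoneOn φ (Set.Icc u 1) := by
        apply antitoneOn_of_deriv_nonpos (convex_Icc u 1)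
        · exact hc _ fun x hx => lt_of_lt_of_le hu hx.1
        · intro x hx
          rw [interior_Icc] at hx
          exact (hd x (hu.trans hx.1)).differentiableAt.differentiableWithinAt
        · intro x hx
          rw [interior_Icc] at hx
          rw [(hd x (hu.trans hx.1)).deriv]
          apply div_nonpos_of_nonpos_of_nonneg _ (by positivity)
          have := hx.2
          nlinarith
      rw [← h1]
      exact this ⟨le_rfl, h⟩ ⟨h, le_rfl⟩ h
    · rcases le_or_gt u (0.614 / 0.386) with h' | h'
      · have : MonotoneOn φ (Set.Icc 1 u) := by
          apply monotoneOn_of_deriv_nonneg (convex_Icc 1 u)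
          · exact hc _ fun x hx => lt_of_lt_of_le one_pos hx.1
          · intro x hx
            rw [interior_Icc] at hx
            exact (hd x (one_pos.trans hx.1)).differentiableAt.differentiableWithinAt
          · intro x hx
            rw [interior_Icc] at hx
            rw [(hd x (one_pos.trans hx.1)).deriv]
            apply div_nonneg _ (by positivity)
            have h1 := hx.1
            have h2 : x ≤ 0.614 / 0.386 := hx.2.le.trans h'
            rw [le_div_iff₀ (by norm_num)] at h2
            nlinarith
        rw [← h1]
        exact this ⟨le_rfl, h.le⟩ ⟨h.le, le_rfl⟩ h.le
      · have : AntitoneOn φ (Set.Icc u 2) := by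
          apply antitoneOn_of_deriv_nonpos (convex_Icc u 2)
          · exact hc _ fun x hx => lt_of_lt_of_le hu hx.1
          · intro x hx
            rw [interior_Icc] at hx
            exact (hd x (hu.trans hx.1)).differentiableAt.differentiableWithinAt
          · intro x hx
            rw [interior_Icc] at hx
            rw [(hd x (hu.trans hx.1)).deriv]
            apply div_nonpos_of_nonpos_of_nonneg _ (by positivity)
            have h1 : 0.614 / 0.386 < x := h'.trans hx.1
            have h2 : 1 < x := h.trans hx.1
            rw [div_lt_iff₀ (by norm_num)] at h1
            nlinarith
        exact h2.trans (this ⟨le_rfl, hu2⟩ ⟨hu2, le_rfl⟩ hu2)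
  have h3 := mul_nonneg hu.le key
  have h4 : u * φ u = u * Real.log u - 0.228 * u + 0.614 - 0.386 * u ^ 2 := by
    simp only [hφ]
    field_simp
  nlinarith

lemma mul_log_tangent {u c : ℝ} (hu : 0 < u) (hc : 0 < c) :
    u * Real.log c + u - c ≤ u * Real.log u := by
  have := Real.log_le_sub_one_of_pos (show 0 < c / u by positivity)
  rw [Real.log_div hc.ne' hu.ne'] at this
  have h1 := mul_le_mul_of_nonneg_left this hu.le
  have h2 : u * (c / u - 1) = c - u := by field_simp
  nlinarith

lemma quad_le_mul_log' {u : ℝ} (hu : 0 < u) (hu2 : u ≤ 0.668) :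
    0.386 * (u - 1) ^ 2 + (0.1204 - 0.1803 * u) ≤ u * Real.log u - u + 1 := by
  rcases le_or_gt u 0.4 with h | h
  · have h1 := mul_log_tangent (c := 1 / 4) hu (by norm_num)
    have h2 : Real.log (1 / 4) = - (2 * Real.log 2) := by
      rw [show (1 / 4 : ℝ) = (2 ^ 2)⁻¹ by norm_num, Real.log_inv, Real.log_pow]
      norm_num
    rw [h2] at h1
    have h3 : u * Real.log 2 ≤ u * 0.6931471808 :=
      mul_le_mul_of_nonneg_left Real.log_two_lt_d9.le hu.le
    nlinarith
  · have h1 := mul_log_tangent (c := 0.6) hu (by norm_num)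
    have h2 : -0.5195 ≤ Real.log 0.6 := by
      have h5 := log_le_of_pow_le_two_pow (p := 5) (a := 70) (k := 30) (by norm_num) (by norm_num)
        (by norm_num)
      have := log_three_ge_of_pow
      rw [show (0.6 : ℝ) = 3 / 5 by norm_num, Real.log_div (by norm_num) (by norm_num)]
      norm_num at h5 ⊢
      linarith
    have h3 : u * (-0.5195) ≤ u * Real.log 0.6 := mul_le_mul_of_nonneg_left h2 hu.le
    nlinarith

theorem primeMin_le_psi {r : ℕ} (hr : 2 ^ 30 ≤ r) {v : ℝ} (hv : 0 ≤ v) (hvr : v ≤ Real.log r) :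
    0.772 * v ^ 3 / Real.log r + 0.0348 * v ^ 2 - (0.307 * Real.log r + 1.24) * v ≤
      v ^ 2 - ∑ p ∈ primesFromFive r, (1 : ℝ) / p * min (Real.log p) v ^ 2 := by
  rcases hv.eq_or_lt with rfl | hv
  · have : ∀ p ∈ primesFromFive r, (1 : ℝ) / p * min (Real.log p) 0 ^ 2 = 0 := by
      intro p hp
      rw [min_eq_right (Real.log_natCast_nonneg p)]
      simp
    rw [Finset.sum_eq_zero this]
    simp
  have hZ : 20.79 ≤ Real.log r := by
    have h1 : Real.log (2 ^ 30) ≤ Real.log r :=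
      Real.log_le_log (by norm_num) (by exact_mod_cast hr)
    rw [Real.log_pow] at h1
    have := Real.log_two_gt_d9
    push_cast at h1
    linarith
  set Z := Real.log r with hZdef
  have hZ0 : 0 < Z := by linarith
  have hid : ∑ p ∈ primesFromFive r, (1 : ℝ) / p * min (Real.log p) v ^ 2 =
      v ^ 2 * ∑ p ∈ primesFromFive r, Real.log p / p / max (Real.log p) v -
      ∑ p ∈ primesFromFive r, Real.log p / p * (v - min (Real.log p) v) := by
    rw [Finset.mul_sum, ← Finset.sum_sub_distrib]
    refine Finset.sum_congr rfl fun p hp => ?_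
    have h1 := (log_primesFromFive hp).1
    have hp0 : (p : ℝ) ≠ 0 := by
      have := (mem_primesFromFive.1 hp).1
      positivity
    rcases le_total (Real.log p) v with h | h
    · rw [max_eq_right h, min_eq_left h]
      field_simp
      ring
    · rw [max_eq_left h, min_eq_right h]
      field_simp
      ring
  have h2 := le_sum_sub_min (r := r) (by omega) hv.le hvr
  have hu0 : 0 < 2 * v / Z := by positivity
  have hu2 : 2 * v / Z ≤ 2 := by rw [div_le_iff₀ hZ0]; linarith
  have hlog : Real.log (2 * v / Z) = Real.log 2 - Real.log (Z / v) := by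
    rw [Real.log_div (by positivity) (by positivity), Real.log_div (by positivity) (by positivity),
      Real.log_mul (by norm_num) hv.ne']
    ring
  have l2 := Real.log_two_lt_d9
  have hsc : ∀ E : ℝ, 0.386 * (2 * v / Z - 1) ^ 2 + E ≤
      2 * v / Z * Real.log (2 * v / Z) - 2 * v / Z + 1 →
      v ^ 2 * Real.log (Z / v) + E * (Z * v / 2) ≤
        v ^ 2 * Real.log 2 + (1 - 0.386) * (Z * v / 2) + (0.772 - 1) * v ^ 2
          - 0.772 * v ^ 3 / Z := by
    intro E h
    rw [hlog] at h
    have h3 := mul_le_mul_of_nonneg_right h (show 0 ≤ Z * v / 2 by positivity)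
    have e1 : (0.386 * (2 * v / Z - 1) ^ 2 + E) * (Z * v / 2) =
        0.772 * v ^ 3 / Z - 0.772 * v ^ 2 + 0.193 * Z * v + E * (Z * v / 2) := by
      field_simp
      ring
    have e2 : (2 * v / Z * (Real.log 2 - Real.log (Z / v)) - 2 * v / Z + 1) * (Z * v / 2) =
        v ^ 2 * Real.log 2 - v ^ 2 * Real.log (Z / v) - v ^ 2 + Z * v / 2 := by
      field_simp
    rw [e1, e2] at h3
    linarith
  have hL : v ^ 2 * Real.log 2 ≤ v ^ 2 * 0.6931471808 :=
    mul_le_mul_of_nonneg_left l2.le (by positivity)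
  rw [hid]
  rcases le_or_gt (10 * Real.log 2) v with hvs | hvs
  · have h1 := sum_div_max_le (r := r) (by omega) hvs hvr
    have h3 := mul_le_mul_of_nonneg_left h1 (show 0 ≤ v ^ 2 by positivity)
    have h4 := hsc 0 (by simpa using quad_le_mul_log hu0 hu2)
    have e : v ^ 2 * (1 + Real.log (Real.log r / v) - 1.25 * v⁻¹) =
      v ^ 2 + v ^ 2 * Real.log (Z / v) - 1.25 * v := by
      rw [hZdef]
      field_simp
    rw [e] at h3
    nlinarith
  · have h1 := sum_div_max_le_of_small (r := r) (by omega) hv hvs.le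
    have h3 := mul_le_mul_of_nonneg_left h1 (show 0 ≤ v ^ 2 by positivity)
    have hu3 : 2 * v / Z ≤ 0.668 := by
      rw [div_le_iff₀ hZ0]
      linarith
    have h4 := hsc _ (quad_le_mul_log' hu0 hu3)
    have e : v ^ 2 * (1 + Real.log (Real.log r / v) - 1.25 * (10 * Real.log 2)⁻¹) =
      v ^ 2 + v ^ 2 * Real.log (Z / v) - 1.25 * v ^ 2 * (10 * Real.log 2)⁻¹ := by
      rw [hZdef]
      ring
    rw [e] at h3
    have h5 : 0.14426 ≤ (10 * Real.log 2)⁻¹ := by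
      rw [le_inv_comm₀ (by norm_num) (by positivity)]
      norm_num at l2 ⊢
      linarith
    have h6 : v ^ 2 * 0.14426 ≤ v ^ 2 * (10 * Real.log 2)⁻¹ :=
      mul_le_mul_of_nonneg_left h5 (by positivity)
    have e3 : (0.1204 - 0.1803 * (2 * v / Z)) * (Z * v / 2) = 0.0602 * Z * v - 0.1803 * v ^ 2 := by
      field_simp
      ring
    rw [e3] at h4
    have h7 : 20.79 * v ≤ Z * v := mul_le_mul_of_nonneg_right hZ hv.le
    nlinarith

lemma coprime_six_iff (n : ℕ) : n.Coprime 6 ↔ n % 6 = 1 ∨ n % 6 = 5 := by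
  have h1 : n.Coprime 6 ↔ (n % 6).Coprime 6 := by
    unfold Nat.Coprime
    rw [Nat.gcd_comm, Nat.gcd_rec]
  rw [h1]
  have h2 : n % 6 < 6 := Nat.mod_lt _ (by norm_num)
  interval_cases n % 6 <;> decide

lemma card_coprime_six_Ioc_zero (k : ℕ) :
    ((Finset.Ioc 0 k).filter (fun n => n.Coprime 6)).card = (k + 5) / 6 + (k + 1) / 6 := by
  induction k with
  | zero => simp
  | succ k ih =>
    rw [← Finset.insert_Ioc_right_eq_Ioc_add_one (by omega), Finset.filter_insert]
    have := coprime_six_iff (k + 1)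
    split_ifs with h
    · rw [Finset.card_insert_of_notMem (by simp), ih]
      omega
    · rw [ih]
      omega

lemma card_coprime_six_dvd {m : ℕ} (hm : 0 < m) (hm6 : m.Coprime 6) (a : ℕ) :
    (((Finset.Ioc 0 a).filter (fun n => n.Coprime 6)).filter (fun n => m ∣ n)).card =
      ((Finset.Ioc 0 (a / m)).filter (fun n => n.Coprime 6)).card := by
  symm
  apply Finset.card_bij (fun k _ => m * k)
  · intro k hk
    simp only [Finset.mem_filter, Finset.mem_Ioc] at hk ⊢
    refine ⟨⟨⟨Nat.mul_pos hm hk.1.1, ?_⟩, ?_⟩, dvd_mul_right _ _⟩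
    · have := (Nat.le_div_iff_mul_le hm).1 hk.1.2
      rwa [mul_comm]
    · exact Nat.Coprime.mul_left hm6 hk.2
  · intro x _ y _ h
    exact Nat.eq_of_mul_eq_mul_left hm h
  · intro n hn
    simp only [Finset.mem_filter, Finset.mem_Ioc] at hn
    obtain ⟨⟨⟨h1, h2⟩, h3⟩, k, rfl⟩ := hn
    refine ⟨k, ?_, rfl⟩
    simp only [Finset.mem_filter, Finset.mem_Ioc]
    refine ⟨⟨Nat.pos_of_mul_pos_left h1, ?_⟩, Nat.Coprime.coprime_mul_left h3⟩
    rw [Nat.le_div_iff_mul_le hm, mul_comm]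
    exact h2

lemma abs_card_coprime_six_sub_le {m : ℕ} (hm : 0 < m) (hm6 : m.Coprime 6) (a N : ℕ) :
    |((((Finset.Ioc a (a + N)).filter (fun n => n.Coprime 6)).filter (fun n => m ∣ n)).card : ℝ)
      - N / (3 * m)| ≤ 4 / 3 := by
  have h1 : (((Finset.Ioc a (a + N)).filter (fun n => n.Coprime 6)).filter (fun n => m ∣ n)).card
      + (((Finset.Ioc 0 a).filter (fun n => n.Coprime 6)).filter (fun n => m ∣ n)).card =
      (((Finset.Ioc 0 (a + N)).filter (fun n => n.Coprime 6)).filter (fun n => m ∣ n)).card := by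
    rw [add_comm, ← Finset.card_union_of_disjoint, ← Finset.filter_union, ← Finset.filter_union,
      Finset.Ioc_union_Ioc_eq_Ioc (by omega) (by omega)]
    refine Finset.disjoint_filter_filter (Finset.disjoint_filter_filter ?_)
    rw [Finset.disjoint_left]
    intro x hx hy
    rw [Finset.mem_Ioc] at hx hy
    omega
  have hc : ∀ b : ℕ, ((b : ℝ) / m - 2) / 3 ≤
      ((((Finset.Ioc 0 b).filter (fun n => n.Coprime 6)).filter (fun n => m ∣ n)).card : ℝ) ∧
      ((((Finset.Ioc 0 b).filter (fun n => n.Coprime 6)).filter (fun n => m ∣ n)).card : ℝ) ≤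
        ((b : ℝ) / m + 2) / 3 := by
    intro b
    rw [card_coprime_six_dvd hm hm6, card_coprime_six_Ioc_zero]
    have hm' : (0 : ℝ) < m := by exact_mod_cast hm
    have e1 : ((b / m : ℕ) : ℝ) ≤ b / m := Nat.cast_div_le
    have e2 : (b : ℝ) / m ≤ (b / m : ℕ) + 1 := by
      rw [div_le_iff₀ hm']
      have : b < m * (b / m + 1) := Nat.lt_mul_div_succ b hm
      have : (b : ℝ) < m * ((b / m : ℕ) + 1) := by exact_mod_cast this
      linarith
    set k := b / m
    have e3 : (k : ℝ) ≤ 3 * ((k + 5) / 6 + (k + 1) / 6 : ℕ) + 1 := by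
      exact_mod_cast (by omega : k ≤ 3 * ((k + 5) / 6 + (k + 1) / 6) + 1)
    have e4 : 3 * (((k + 5) / 6 + (k + 1) / 6 : ℕ) : ℝ) ≤ k + 2 := by
      exact_mod_cast (by omega : 3 * ((k + 5) / 6 + (k + 1) / 6) ≤ k + 2)
    constructor <;> linarith
  have h2 := hc a
  have h3 := hc (a + N)
  rw [← h1] at h3
  push_cast at h3
  have hm' : (m : ℝ) ≠ 0 := by positivity
  have h4 : ((a : ℝ) + N) / m = a / m + N / m := by ring
  have h5 : (N : ℝ) / (3 * m) = N / m / 3 := by field_simp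
  rw [h4] at h3
  rw [abs_le, h5]
  constructor <;> linarith

/-- The squarefree integers in `[1, D]` that are coprime to `6`. -/
def sieveSet (D : ℕ) : Finset ℕ := (Finset.Icc 1 D).filter (fun d => Squarefree d ∧ d.Coprime 6)

lemma mem_sieveSet {D d : ℕ} :
    d ∈ sieveSet D ↔ (1 ≤ d ∧ d ≤ D) ∧ Squarefree d ∧ d.Coprime 6 := by
  simp [sieveSet]

lemma mem_sieveSet_of_dvd {D d e : ℕ} (he : e ∈ sieveSet D) (h : d ∣ e) : d ∈ sieveSet D := by
  rw [mem_sieveSet] at *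
  exact ⟨⟨Nat.pos_of_dvd_of_pos h he.1.1, (Nat.le_of_dvd he.1.1 h).trans he.1.2⟩,
    he.2.1.squarefree_of_dvd h, Nat.Coprime.of_dvd_left h he.2.2⟩

lemma sum_moebius_filter_dvd {e f : ℕ} (he : Squarefree e) (hf : 0 < f) :
    ∑ d ∈ e.divisors.filter (fun d => f ∣ d), (ArithmeticFunction.moebius d : ℝ) =
      if e = f then (ArithmeticFunction.moebius f : ℝ) else 0 := by
  by_cases hfe : f ∣ e
  · obtain ⟨k, rfl⟩ := hfe
    have hk0 : k ≠ 0 := by rintro rfl; simp at he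
    have hcop : f.Coprime k := Nat.coprime_of_squarefree_mul he
    have h1 : (f * k).divisors.filter (fun d => f ∣ d) = k.divisors.image (fun c => f * c) := by
      ext d
      simp only [Finset.mem_filter, Nat.mem_divisors, Finset.mem_image]
      constructor
      · rintro ⟨⟨h1, _⟩, c, rfl⟩
        exact ⟨c, ⟨Nat.dvd_of_mul_dvd_mul_left hf h1, hk0⟩, rfl⟩
      · rintro ⟨c, ⟨h1, _⟩, rfl⟩
        exact ⟨⟨mul_dvd_mul_left f h1, by positivity⟩, dvd_mul_right _ _⟩
    rw [h1, Finset.sum_image (fun x _ y _ h => Nat.eq_of_mul_eq_mul_left hf h)]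
    have h2 : ∀ c ∈ k.divisors, (ArithmeticFunction.moebius (f * c) : ℝ) =
        ArithmeticFunction.moebius f * ArithmeticFunction.moebius c := by
      intro c hc
      rw [ArithmeticFunction.isMultiplicative_moebius.map_mul_of_coprime
        (Nat.Coprime.of_dvd_right (Nat.dvd_of_mem_divisors hc) hcop)]
      push_cast
      rfl
    rw [Finset.sum_congr rfl h2, ← Finset.mul_sum]
    have h3 : ∑ c ∈ k.divisors, (ArithmeticFunction.moebius c : ℝ) = if k = 1 then 1 else 0 := by
      have := congrArg (fun g => g k) ArithmeticFunction.coe_zeta_mul_moebius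
      simp only [ArithmeticFunction.coe_zeta_mul_apply, ArithmeticFunction.one_apply] at this
      exact_mod_cast this
    rw [h3]
    by_cases hk : k = 1
    · simp [hk]
    · have : f * k ≠ f := by
        intro h
        exact hk (Nat.eq_of_mul_eq_mul_left hf (by omega))
      simp [hk, this]
  · rw [Finset.filter_false_of_mem, Finset.sum_empty, if_neg]
    · rintro rfl; exact hfe dvd_rfl
    · intro d hd hfd
      exact hfe (hfd.trans (Nat.dvd_of_mem_divisors hd))

/-- The normalized Selberg weights attached to the function `g`. -/
noncomputable def sieveWeight (D : ℕ) (g : ℕ → ℝ) (d : ℕ) : ℝ :=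
  ArithmeticFunction.moebius d * ∑ e ∈ (sieveSet D).filter (fun e => d ∣ e), g e

lemma sum_sieveWeight_filter_dvd (D : ℕ) (g : ℕ → ℝ) {f : ℕ} (hf : 0 < f) :
    ∑ d ∈ (sieveSet D).filter (fun d => f ∣ d), sieveWeight D g d =
      if f ∈ sieveSet D then ArithmeticFunction.moebius f * g f else 0 := by
  calc _ = ∑ d ∈ sieveSet D, ∑ e ∈ sieveSet D, if f ∣ d ∧ d ∣ e then
          (ArithmeticFunction.moebius d : ℝ) * g e else 0 := by
        rw [Finset.sum_filter]
        refine Finset.sum_congr rfl fun d _ => ?_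
        rw [sieveWeight, Finset.sum_filter, Finset.mul_sum]
        split_ifs with h
        · exact Finset.sum_congr rfl fun e _ => by simp [h]
        · simp [h]
    _ = ∑ e ∈ sieveSet D, g e * ∑ d ∈ e.divisors.filter (fun d => f ∣ d),
          (ArithmeticFunction.moebius d : ℝ) := by
        rw [Finset.sum_comm]
        refine Finset.sum_congr rfl fun e he => ?_
        rw [← Finset.sum_filter, Finset.mul_sum]
        apply Finset.sum_congr
        · ext d
          simp only [Finset.mem_filter, Nat.mem_divisors]
          constructor
          · rintro ⟨_, h1, h2⟩
            exact ⟨⟨h2, by have := (mem_sieveSet.1 he).1.1; omega⟩, h1⟩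
          · rintro ⟨⟨h2, _⟩, h1⟩
            exact ⟨mem_sieveSet_of_dvd he h2, h1, h2⟩
        · intro d _
          ring
    _ = ∑ e ∈ sieveSet D, if e = f then ArithmeticFunction.moebius f * g f else 0 := by
        refine Finset.sum_congr rfl fun e he => ?_
        rw [sum_moebius_filter_dvd (mem_sieveSet.1 he).2.1 hf]
        split_ifs with h
        · rw [h]; ring
        · ring
    _ = _ := by
        rw [Finset.sum_ite_eq']

lemma sum_totient_filter_dvd {D d₁ d₂ : ℕ} (h₁ : d₁ ∈ sieveSet D) :
    ∑ e ∈ (sieveSet D).filter (fun e => e ∣ d₁ ∧ e ∣ d₂), (Nat.totient e : ℝ) = d₁.gcd d₂ := by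
  have h0 : d₁ ≠ 0 := by have := (mem_sieveSet.1 h₁).1.1; omega
  have h : (sieveSet D).filter (fun e => e ∣ d₁ ∧ e ∣ d₂) = (d₁.gcd d₂).divisors := by
    ext e
    simp only [Finset.mem_filter, Nat.mem_divisors, Nat.dvd_gcd_iff]
    constructor
    · rintro ⟨_, h⟩
      exact ⟨h, by simp [h0]⟩
    · rintro ⟨h, _⟩
      exact ⟨mem_sieveSet_of_dvd h₁ h.1, h⟩
  rw [h]
  exact_mod_cast Nat.sum_totient _

lemma sum_totient_filter_dvd_not_dvd {D d₁ d₂ p : ℕ} (h₁ : d₁ ∈ sieveSet D)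
    (hp : p.Prime) :
    ∑ e ∈ (sieveSet D).filter (fun e => ¬ p ∣ e ∧ e ∣ d₁ ∧ e ∣ d₂), (Nat.totient e : ℝ) =
      if p ∣ d₁.gcd d₂ then (d₁.gcd d₂ : ℝ) / p else d₁.gcd d₂ := by
  have h0 : d₁ ≠ 0 := by have := (mem_sieveSet.1 h₁).1.1; omega
  have hsq : Squarefree (d₁.gcd d₂) :=
    (mem_sieveSet.1 h₁).2.1.squarefree_of_dvd (Nat.gcd_dvd_left _ _)
  have hpos : d₁.gcd d₂ ≠ 0 := by simp [h0]
  have h : (sieveSet D).filter (fun e => ¬ p ∣ e ∧ e ∣ d₁ ∧ e ∣ d₂) =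
      (d₁.gcd d₂).divisors.filter (fun e => ¬ p ∣ e) := by
    ext e
    simp only [Finset.mem_filter, Nat.mem_divisors, Nat.dvd_gcd_iff]
    constructor
    · rintro ⟨_, h1, h⟩
      exact ⟨⟨h, hpos⟩, h1⟩
    · rintro ⟨⟨h, _⟩, h1⟩
      exact ⟨mem_sieveSet_of_dvd h₁ h.1, h1, h⟩
  rw [h]
  split_ifs with hpg
  · obtain ⟨k, hk⟩ := hpg
    have hk0 : k ≠ 0 := by rintro rfl; simp [hk] at hpos
    have hcop : p.Coprime k := by
      rw [hk] at hsq
      exact Nat.coprime_of_squarefree_mul hsq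
    have h2 : (d₁.gcd d₂).divisors.filter (fun e => ¬ p ∣ e) = k.divisors := by
      ext e
      rw [hk]
      simp only [Finset.mem_filter, Nat.mem_divisors]
      constructor
      · rintro ⟨⟨h1, _⟩, h2⟩
        exact ⟨Nat.Coprime.dvd_of_dvd_mul_left ((Nat.Prime.coprime_iff_not_dvd hp).2 h2).symm h1,
          hk0⟩
      · rintro ⟨h1, _⟩
        refine ⟨⟨h1.mul_left p, mul_ne_zero hp.ne_zero hk0⟩, fun h2 => ?_⟩
        have := Nat.dvd_gcd (dvd_refl p) (h2.trans h1)
        rw [hcop.gcd_eq_one] at this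
        exact hp.one_lt.ne' (Nat.dvd_one.1 this)
    rw [h2, hk]
    have hp0 : (p : ℝ) ≠ 0 := by exact_mod_cast hp.ne_zero
    push_cast
    rw [mul_div_cancel_left₀ _ hp0]
    exact_mod_cast Nat.sum_totient k
  · rw [Finset.filter_true_of_mem]
    · exact_mod_cast Nat.sum_totient _
    · intro e he hpe
      exact hpg (hpe.trans (Nat.dvd_of_mem_divisors he))

lemma inv_lcm_eq {D d₁ d₂ : ℕ} (h₁ : d₁ ∈ sieveSet D) (h₂ : d₂ ∈ sieveSet D) :
    (d₁ : ℝ) * d₂ * (1 / (d₁.lcm d₂ : ℕ)) =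
      ∑ e ∈ (sieveSet D).filter (fun e => e ∣ d₁ ∧ e ∣ d₂), (Nat.totient e : ℝ) := by
  rw [sum_totient_filter_dvd h₁]
  have h1 : (d₁ : ℝ) ≠ 0 := by have := (mem_sieveSet.1 h₁).1.1; positivity
  have h2 : (d₂ : ℝ) ≠ 0 := by have := (mem_sieveSet.1 h₂).1.1; positivity
  have h3 : (d₁.gcd d₂ : ℝ) * (d₁.lcm d₂ : ℕ) = d₁ * d₂ := by exact_mod_cast Nat.gcd_mul_lcm d₁ d₂
  have h4 : ((d₁.lcm d₂ : ℕ) : ℝ) ≠ 0 := by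
    intro h
    rw [h, mul_zero] at h3
    exact mul_ne_zero h1 h2 h3.symm
  rw [← h3]
  field_simp

lemma inv_lcm_prime_eq {D d₁ d₂ p : ℕ} (h₁ : d₁ ∈ sieveSet D) (h₂ : d₂ ∈ sieveSet D)
    (hp : p.Prime) :
    (d₁ : ℝ) * d₂ * (1 / (p.lcm (d₁.lcm d₂) : ℕ)) =
      1 / p * (if p ∣ d₁ then (p : ℝ) else 1) * (if p ∣ d₂ then (p : ℝ) else 1) *
      ∑ e ∈ (sieveSet D).filter (fun e => ¬ p ∣ e ∧ e ∣ d₁ ∧ e ∣ d₂), (Nat.totient e : ℝ) := by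
  rw [sum_totient_filter_dvd_not_dvd h₁ hp]
  have h1 : (d₁ : ℝ) ≠ 0 := by have := (mem_sieveSet.1 h₁).1.1; positivity
  have h2 : (d₂ : ℝ) ≠ 0 := by have := (mem_sieveSet.1 h₂).1.1; positivity
  have h3 : (d₁.gcd d₂ : ℝ) * (d₁.lcm d₂ : ℕ) = d₁ * d₂ := by exact_mod_cast Nat.gcd_mul_lcm d₁ d₂
  have h4 : ((d₁.lcm d₂ : ℕ) : ℝ) ≠ 0 := by
    intro h
    rw [h, mul_zero] at h3
    exact mul_ne_zero h1 h2 h3.symm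
  have hp0 : (p : ℝ) ≠ 0 := by exact_mod_cast hp.ne_zero
  rw [← h3]
  by_cases hd : p ∣ d₁ ∨ p ∣ d₂
  · have h5 : p ∣ d₁.lcm d₂ := by
      rcases hd with h | h
      · exact h.trans (Nat.dvd_lcm_left _ _)
      · exact h.trans (Nat.dvd_lcm_right _ _)
    rw [Nat.lcm_eq_right h5]
    by_cases ha : p ∣ d₁ <;> by_cases hb : p ∣ d₂
    · simp only [ha, hb, if_true, Nat.dvd_gcd ha hb]
      field_simp
    · have : ¬ p ∣ d₁.gcd d₂ := fun h => hb (h.trans (Nat.gcd_dvd_right _ _))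
      simp only [ha, hb, if_true, if_false, this]
      field_simp
    · have : ¬ p ∣ d₁.gcd d₂ := fun h => ha (h.trans (Nat.gcd_dvd_left _ _))
      simp only [ha, hb, if_true, if_false, this]
      field_simp
    · exact absurd hd (by tauto)
  · push Not at hd
    have h5 : ¬ p ∣ d₁.lcm d₂ := by
      intro h
      have := h.trans (Nat.lcm_dvd_mul d₁ d₂)
      rw [hp.dvd_mul] at this
      tauto
    have : ¬ p ∣ d₁.gcd d₂ := fun h => hd.1 (h.trans (Nat.gcd_dvd_left _ _))
    have h6 : p.lcm (d₁.lcm d₂) = p * d₁.lcm d₂ :=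
      Nat.Coprime.lcm_eq_mul ((Nat.Prime.coprime_iff_not_dvd hp).2 h5)
    rw [h6]
    simp only [hd.1, hd.2, if_false, this]
    push_cast
    field_simp

lemma sum_sq_sum_filter_dvd (S s : Finset ℕ) (l : ℕ → ℝ) :
    ∑ n ∈ s, (∑ d ∈ S.filter (fun d => d ∣ n), l d) ^ 2 =
      ∑ d₁ ∈ S, ∑ d₂ ∈ S, l d₁ * l d₂ * ((s.filter (fun n => d₁.lcm d₂ ∣ n)).card : ℝ) := by
  have h1 : ∀ n ∈ s, (∑ d ∈ S.filter (fun d => d ∣ n), l d) ^ 2 =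
      ∑ d₁ ∈ S, ∑ d₂ ∈ S, l d₁ * l d₂ * (if d₁.lcm d₂ ∣ n then 1 else 0) := by
    intro n _
    rw [sq, Finset.sum_filter, Finset.sum_mul_sum]
    refine Finset.sum_congr rfl fun d₁ _ => Finset.sum_congr rfl fun d₂ _ => ?_
    simp only [Nat.lcm_dvd_iff]
    by_cases ha : d₁ ∣ n <;> by_cases hb : d₂ ∣ n <;> simp [ha, hb]
  rw [Finset.sum_congr rfl h1, Finset.sum_comm]
  refine Finset.sum_congr rfl fun d₁ _ => ?_
  rw [Finset.sum_comm]
  refine Finset.sum_congr rfl fun d₂ _ => ?_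
  rw [← Finset.mul_sum, Finset.card_filter]
  push_cast
  rfl

lemma abs_sum_mul_sub_le {S : Finset ℕ} {l : ℕ → ℝ} {A M : ℕ → ℕ → ℝ} {c : ℝ}
    (h : ∀ d₁ ∈ S, ∀ d₂ ∈ S, |A d₁ d₂ - M d₁ d₂| ≤ c) :
    |∑ d₁ ∈ S, ∑ d₂ ∈ S, l d₁ * l d₂ * A d₁ d₂ - ∑ d₁ ∈ S, ∑ d₂ ∈ S, l d₁ * l d₂ * M d₁ d₂| ≤
      c * (∑ d ∈ S, |l d|) ^ 2 := by
  simp_rw [← Finset.sum_sub_distrib, ← mul_sub]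
  rw [sq, Finset.sum_mul_sum, Finset.mul_sum]
  refine (Finset.abs_sum_le_sum_abs _ _).trans (Finset.sum_le_sum fun d₁ h₁ => ?_)
  rw [Finset.mul_sum]
  refine (Finset.abs_sum_le_sum_abs _ _).trans (Finset.sum_le_sum fun d₂ h₂ => ?_)
  rw [abs_mul, abs_mul, mul_comm]
  exact mul_le_mul_of_nonneg_right (h _ h₁ _ h₂) (by positivity)

lemma sum_sum_mul_sum_filter (S T : Finset ℕ) (w f : ℕ → ℝ) :
    ∑ d₁ ∈ S, ∑ d₂ ∈ S, w d₁ * w d₂ * ∑ e ∈ T.filter (fun e => e ∣ d₁ ∧ e ∣ d₂), f e =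
      ∑ e ∈ T, f e * (∑ d ∈ S.filter (fun d => e ∣ d), w d) ^ 2 := by
  have h1 : ∀ e ∈ T, f e * (∑ d ∈ S.filter (fun d => e ∣ d), w d) ^ 2 =
      ∑ d₁ ∈ S, ∑ d₂ ∈ S, w d₁ * w d₂ * (if e ∣ d₁ ∧ e ∣ d₂ then f e else 0) := by
    intro e _
    rw [sq, Finset.sum_filter, Finset.sum_mul_sum, Finset.mul_sum]
    refine Finset.sum_congr rfl fun d₁ _ => ?_
    rw [Finset.mul_sum]
    refine Finset.sum_congr rfl fun d₂ _ => ?_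
    by_cases ha : e ∣ d₁ <;> by_cases hb : e ∣ d₂ <;> simp [ha, hb]
    ring
  refine Eq.trans ?_ (Finset.sum_congr rfl h1).symm
  symm
  rw [Finset.sum_comm]
  refine Finset.sum_congr rfl fun d₁ _ => ?_
  rw [Finset.sum_comm]
  refine Finset.sum_congr rfl fun d₂ _ => ?_
  rw [← Finset.mul_sum, Finset.sum_filter]

lemma coprime_six_of_prime {p : ℕ} (hp : p.Prime) (hp5 : 5 ≤ p) : p.Coprime 6 := by
  rw [Nat.Prime.coprime_iff_not_dvd hp]
  intro h
  have := Nat.le_of_dvd (by norm_num) h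
  interval_cases p
  · omega
  · exact absurd hp (by decide)

/-- The logarithmic Selberg weights at level `D`. -/
noncomputable def logWeight (D e : ℕ) : ℝ := Real.log (D / e) / Nat.totient e

lemma moebius_sq_of_mem_sieveSet {D e : ℕ} (he : e ∈ sieveSet D) :
    (ArithmeticFunction.moebius e : ℝ) ^ 2 = 1 := by
  have := (ArithmeticFunction.abs_moebius_eq_one_of_squarefree (mem_sieveSet.1 he).2.1)
  have h : (ArithmeticFunction.moebius e) ^ 2 = 1 := by rw [← sq_abs, this]; rfl
  exact_mod_cast h

lemma totient_pos_of_mem_sieveSet {D e : ℕ} (he : e ∈ sieveSet D) : (0 : ℝ) < Nat.totient e := by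
  have : 0 < Nat.totient e := Nat.totient_pos.2 (mem_sieveSet.1 he).1.1
  exact_mod_cast this

lemma log_div_nonneg_of_mem_sieveSet {D e : ℕ} (he : e ∈ sieveSet D) :
    0 ≤ Real.log ((D : ℝ) / e) := by
  have h := (mem_sieveSet.1 he).1
  apply Real.log_nonneg
  rw [le_div_iff₀ (by exact_mod_cast h.1)]
  rw [one_mul]
  exact_mod_cast h.2

lemma sum_sum_inv_lcm (D : ℕ) :
    ∑ d₁ ∈ sieveSet D, ∑ d₂ ∈ sieveSet D,
      ((d₁ : ℝ) * sieveWeight D (logWeight D) d₁) * (d₂ * sieveWeight D (logWeight D) d₂) *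
        (1 / (d₁.lcm d₂ : ℕ)) =
      ∑ e ∈ sieveSet D, (Nat.totient e : ℝ)⁻¹ * Real.log (D / e) ^ 2 := by
  have h1 : ∀ e ∈ sieveSet D, (Nat.totient e : ℝ)⁻¹ * Real.log (D / e) ^ 2 =
      Nat.totient e * (∑ d ∈ (sieveSet D).filter (fun d => e ∣ d),
        sieveWeight D (logWeight D) d) ^ 2 := by
    intro e he
    rw [sum_sieveWeight_filter_dvd D _ (mem_sieveSet.1 he).1.1, if_pos he, mul_pow,
      moebius_sq_of_mem_sieveSet he, logWeight]
    have := totient_pos_of_mem_sieveSet he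
    field_simp
  rw [Finset.sum_congr rfl h1, ← sum_sum_mul_sum_filter]
  refine Finset.sum_congr rfl fun d₁ h₁ => Finset.sum_congr rfl fun d₂ h₂ => ?_
  rw [← inv_lcm_eq h₁ h₂]
  ring

lemma sum_ite_sieveWeight {D e p : ℕ} (he : e ∈ sieveSet D) (hp : p.Prime) (hp5 : 5 ≤ p)
    (hpe : ¬ p ∣ e) :
    ∑ d ∈ (sieveSet D).filter (fun d => e ∣ d),
      (if p ∣ d then (p : ℝ) else 1) * sieveWeight D (logWeight D) d =
      ArithmeticFunction.moebius e * (Real.log (D / e) ⊓ Real.log p) / Nat.totient e := by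
  have hcop : p.Coprime e := (Nat.Prime.coprime_iff_not_dvd hp).2 hpe
  have hes := mem_sieveSet.1 he
  have he0 : 0 < e := hes.1.1
  have h1 : ∑ d ∈ (sieveSet D).filter (fun d => e ∣ d),
      (if p ∣ d then (p : ℝ) else 1) * sieveWeight D (logWeight D) d =
      ∑ d ∈ (sieveSet D).filter (fun d => e ∣ d), sieveWeight D (logWeight D) d +
      (p - 1) * ∑ d ∈ (sieveSet D).filter (fun d => p * e ∣ d), sieveWeight D (logWeight D) d := by
    have : (sieveSet D).filter (fun d => p * e ∣ d) =
        ((sieveSet D).filter (fun d => e ∣ d)).filter (fun d => p ∣ d) := by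
      ext d
      simp only [Finset.mem_filter, and_assoc]
      refine and_congr_right fun _ => ⟨fun h => ⟨(dvd_mul_left _ _).trans h,
        (dvd_mul_right _ _).trans h⟩, fun h => Nat.Coprime.mul_dvd_of_dvd_of_dvd hcop h.2 h.1⟩
    rw [this, Finset.sum_filter (s := (sieveSet D).filter (fun d => e ∣ d)), Finset.mul_sum,
      ← Finset.sum_add_distrib]
    refine Finset.sum_congr rfl fun d _ => ?_
    split_ifs <;> ring
  rw [h1, sum_sieveWeight_filter_dvd D _ he0, if_pos he,
    sum_sieveWeight_filter_dvd D _ (Nat.mul_pos hp.pos he0)]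
  have hφ := totient_pos_of_mem_sieveSet he
  have hp1 : (0 : ℝ) < p - 1 := by
    have : (5 : ℝ) ≤ p := by exact_mod_cast hp5
    linarith
  have he0' : (0 : ℝ) < e := by exact_mod_cast he0
  have hp0' : (0 : ℝ) < p := by linarith
  have hD : (0 : ℝ) < D := by
    have := hes.1.1.trans hes.1.2
    exact_mod_cast this
  split_ifs with hm
  · have hle : ((p * e : ℕ) : ℝ) ≤ D := by exact_mod_cast (mem_sieveSet.1 hm).1.2
    push_cast at hle
    have h2 : Real.log p ≤ Real.log (D / e) := by
      apply Real.log_le_log hp0'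
      rw [le_div_iff₀ he0']
      exact hle
    rw [inf_eq_right.2 h2, ArithmeticFunction.isMultiplicative_moebius.map_mul_of_coprime hcop,
      ArithmeticFunction.moebius_apply_prime hp, logWeight, logWeight, Nat.totient_mul hcop,
      Nat.totient_prime hp]
    have h3 : Real.log ((D : ℝ) / (p * e : ℕ)) = Real.log (D / e) - Real.log p := by
      rw [← Real.log_div (by positivity) (by positivity)]
      congr 1
      push_cast
      field_simp
    rw [h3]
    push_cast [Nat.cast_sub hp.one_lt.le]
    field_simp
    ring
  · have hlt : D < p * e := by
      by_contra hcon
      push Not at hcon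
      apply hm
      rw [mem_sieveSet]
      refine ⟨⟨Nat.mul_pos hp.pos he0, hcon⟩, (Nat.squarefree_mul hcop).2
        ⟨hp.squarefree, hes.2.1⟩, Nat.Coprime.mul_left ?_ hes.2.2⟩
      exact coprime_six_of_prime hp hp5
    have h2 : Real.log (D / e) ≤ Real.log p := by
      apply Real.log_le_log (by positivity)
      rw [div_le_iff₀ he0']
      exact_mod_cast hlt.le
    rw [inf_eq_left.2 h2, logWeight]
    ring

lemma sum_sum_inv_lcm_prime_le {D p : ℕ} (hp : p.Prime) (hp5 : 5 ≤ p) :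
    ∑ d₁ ∈ sieveSet D, ∑ d₂ ∈ sieveSet D,
      ((d₁ : ℝ) * sieveWeight D (logWeight D) d₁) * (d₂ * sieveWeight D (logWeight D) d₂) *
        (1 / (p.lcm (d₁.lcm d₂) : ℕ)) ≤
      ∑ e ∈ sieveSet D, (Nat.totient e : ℝ)⁻¹ * (1 / p * (Real.log p ⊓ Real.log (D / e)) ^ 2) := by
  have h1 : ∀ e ∈ (sieveSet D).filter (fun e => ¬ p ∣ e),
      (Nat.totient e : ℝ)⁻¹ * (1 / p * (Real.log p ⊓ Real.log (D / e)) ^ 2) =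
      (1 / p * Nat.totient e) * (∑ d ∈ (sieveSet D).filter (fun d => e ∣ d),
        (if p ∣ d then (p : ℝ) else 1) * sieveWeight D (logWeight D) d) ^ 2 := by
    intro e he
    rw [Finset.mem_filter] at he
    rw [sum_ite_sieveWeight he.1 hp hp5 he.2, div_pow, mul_pow, moebius_sq_of_mem_sieveSet he.1,
      inf_comm]
    have := totient_pos_of_mem_sieveSet he.1
    field_simp
  refine le_trans (le_of_eq ?_) (Finset.sum_le_sum_of_subset_of_nonneg
    (Finset.filter_subset (fun e => ¬ p ∣ e) (sieveSet D)) fun e _ _ => by positivity)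
  rw [Finset.sum_congr rfl h1, ← sum_sum_mul_sum_filter]
  refine Finset.sum_congr rfl fun d₁ h₁ => Finset.sum_congr rfl fun d₂ h₂ => ?_
  have h2 := inv_lcm_prime_eq h₁ h₂ hp
  rw [Finset.filter_filter, ← Finset.mul_sum]
  calc _ = sieveWeight D (logWeight D) d₁ * sieveWeight D (logWeight D) d₂ *
        ((d₁ : ℝ) * d₂ * (1 / (p.lcm (d₁.lcm d₂) : ℕ))) := by ring
    _ = _ := by rw [h2]; ring

lemma sum_abs_sieveWeight_le (D : ℕ) :
    ∑ d ∈ sieveSet D, |(d : ℝ) * sieveWeight D (logWeight D) d| ≤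
      ∑ e ∈ sieveSet D, Real.log (D / e) / Nat.totient e * ∑ d ∈ e.divisors, (d : ℝ) := by
  have h1 : ∀ d ∈ sieveSet D, |(d : ℝ) * sieveWeight D (logWeight D) d| ≤
      ∑ e ∈ sieveSet D, if d ∣ e then (d : ℝ) * logWeight D e else 0 := by
    intro d hd
    rw [sieveWeight, abs_mul, abs_mul, Nat.abs_cast]
    have h2 : |(ArithmeticFunction.moebius d : ℝ)| = 1 := by
      have := ArithmeticFunction.abs_moebius_eq_one_of_squarefree (mem_sieveSet.1 hd).2.1
      exact_mod_cast this
    have h3 : ∀ e ∈ sieveSet D, 0 ≤ logWeight D e := fun e he =>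
      div_nonneg (log_div_nonneg_of_mem_sieveSet he) (Nat.cast_nonneg _)
    rw [h2, one_mul, abs_of_nonneg (Finset.sum_nonneg fun e he =>
      h3 e (Finset.mem_filter.1 he).1), Finset.mul_sum, Finset.sum_filter]
  refine (Finset.sum_le_sum h1).trans (le_of_eq ?_)
  rw [Finset.sum_comm]
  refine Finset.sum_congr rfl fun e he => ?_
  rw [← Finset.sum_filter, Finset.mul_sum]
  apply Finset.sum_congr
  · ext d
    simp only [Finset.mem_filter, Nat.mem_divisors]
    exact ⟨fun h => ⟨h.2, by have := (mem_sieveSet.1 he).1.1; omega⟩,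
      fun h => ⟨mem_sieveSet_of_dvd he h.1, h.1⟩⟩
  · intro d _
    rw [logWeight]
    ring

theorem sieve_inequality {P : Finset ℕ} (hP : ∀ p ∈ P, p.Prime ∧ 5 ≤ p) (D a N : ℕ)
    (h : ∀ n ∈ Finset.Ioc a (a + N), n.Coprime 6 → ∃ p ∈ P, p ∣ n) :
    N * ∑ e ∈ sieveSet D, (Nat.totient e : ℝ)⁻¹ * (Real.log (D / e) ^ 2 -
        ∑ p ∈ P, (1 : ℝ) / p * (Real.log p ⊓ Real.log (D / e)) ^ 2) ≤
      4 * (P.card + 1) * (∑ e ∈ sieveSet D, Real.log (D / e) / Nat.totient e *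
        ∑ d ∈ e.divisors, (d : ℝ)) ^ 2 := by
  set s := (Finset.Ioc a (a + N)).filter (fun n => n.Coprime 6) with hs
  set l : ℕ → ℝ := fun d => (d : ℝ) * sieveWeight D (logWeight D) d with hl
  set L := ∑ d ∈ sieveSet D, |l d| with hL
  set Λ := ∑ e ∈ sieveSet D, Real.log (D / e) / Nat.totient e * ∑ d ∈ e.divisors, (d : ℝ)
  have hLΛ : L ≤ Λ := sum_abs_sieveWeight_le D
  have hL0 : 0 ≤ L := Finset.sum_nonneg fun _ _ => abs_nonneg _
  have hpos : ∀ d ∈ sieveSet D, 0 < d := fun d hd => (mem_sieveSet.1 hd).1.1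
  have hlpos : ∀ d₁ ∈ sieveSet D, ∀ d₂ ∈ sieveSet D, 0 < d₁.lcm d₂ := fun d₁ h₁ d₂ h₂ =>
    Nat.lcm_pos (hpos _ h₁) (hpos _ h₂)
  have hlcop : ∀ d₁ ∈ sieveSet D, ∀ d₂ ∈ sieveSet D, (d₁.lcm d₂).Coprime 6 := fun d₁ h₁ d₂ h₂ =>
    Nat.Coprime.of_dvd_left (Nat.lcm_dvd_mul _ _)
      (Nat.Coprime.mul_left (mem_sieveSet.1 h₁).2.2 (mem_sieveSet.1 h₂).2.2)
  set F : ℕ → ℝ := fun n => (∑ d ∈ (sieveSet D).filter (fun d => d ∣ n), l d) ^ 2 with hF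
  have key : ∑ n ∈ s, F n ≤ ∑ p ∈ P, ∑ n ∈ s.filter (fun n => p ∣ n), F n := by
    simp_rw [Finset.sum_filter]
    rw [Finset.sum_comm]
    refine Finset.sum_le_sum fun n hn => ?_
    rw [hs, Finset.mem_filter] at hn
    obtain ⟨p, hp, hpn⟩ := h n hn.1 hn.2
    calc F n = if p ∣ n then F n else 0 := by rw [if_pos hpn]
      _ ≤ _ := Finset.single_le_sum (f := fun p => if p ∣ n then F n else 0)
          (fun q _ => by split_ifs <;> positivity) hp
  have h1 : N / 3 * ∑ e ∈ sieveSet D, (Nat.totient e : ℝ)⁻¹ * Real.log (D / e) ^ 2 - 4 / 3 * L ^ 2 ≤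
      ∑ n ∈ s, F n := by
    have e1 := abs_sum_mul_sub_le (S := sieveSet D) (l := l) (c := 4 / 3)
      (A := fun d₁ d₂ => ((s.filter (fun n => d₁.lcm d₂ ∣ n)).card : ℝ))
      (M := fun d₁ d₂ => (N : ℝ) / (3 * (d₁.lcm d₂ : ℕ)))
      (fun d₁ h₁ d₂ h₂ => abs_card_coprime_six_sub_le (hlpos _ h₁ _ h₂) (hlcop _ h₁ _ h₂) a N)
    rw [← sum_sq_sum_filter_dvd] at e1
    have e2 : ∑ d₁ ∈ sieveSet D, ∑ d₂ ∈ sieveSet D, l d₁ * l d₂ *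
        ((N : ℝ) / (3 * (d₁.lcm d₂ : ℕ))) =
        N / 3 * ∑ e ∈ sieveSet D, (Nat.totient e : ℝ)⁻¹ * Real.log (D / e) ^ 2 := by
      rw [← sum_sum_inv_lcm, Finset.mul_sum]
      refine Finset.sum_congr rfl fun d₁ h₁ => ?_
      rw [Finset.mul_sum]
      refine Finset.sum_congr rfl fun d₂ h₂ => ?_
      simp only [hl]
      field_simp
    rw [e2] at e1
    linarith [(abs_le.1 e1).1]
  have h2 : ∀ p ∈ P, ∑ n ∈ s.filter (fun n => p ∣ n), F n ≤
      N / 3 * ∑ e ∈ sieveSet D, (Nat.totient e : ℝ)⁻¹ *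
        (1 / p * (Real.log p ⊓ Real.log (D / e)) ^ 2) + 4 / 3 * L ^ 2 := by
    intro p hp
    obtain ⟨hpp, hp5⟩ := hP p hp
    have hp6 : p.Coprime 6 := coprime_six_of_prime hpp hp5
    have e1 := abs_sum_mul_sub_le (S := sieveSet D) (l := l) (c := 4 / 3)
      (A := fun d₁ d₂ => (((s.filter (fun n => p ∣ n)).filter (fun n => d₁.lcm d₂ ∣ n)).card : ℝ))
      (M := fun d₁ d₂ => (N : ℝ) / (3 * (p.lcm (d₁.lcm d₂) : ℕ)))
      (fun d₁ h₁ d₂ h₂ => by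
        have : (s.filter (fun n => p ∣ n)).filter (fun n => d₁.lcm d₂ ∣ n) =
            s.filter (fun n => p.lcm (d₁.lcm d₂) ∣ n) := by
          rw [Finset.filter_filter]
          simp_rw [Nat.lcm_dvd_iff]
        rw [this]
        exact abs_card_coprime_six_sub_le (Nat.lcm_pos hpp.pos (hlpos _ h₁ _ h₂))
          (Nat.Coprime.of_dvd_left (Nat.lcm_dvd_mul _ _)
            (Nat.Coprime.mul_left hp6 (hlcop _ h₁ _ h₂))) a N)
    rw [← sum_sq_sum_filter_dvd] at e1
    have e2 : ∑ d₁ ∈ sieveSet D, ∑ d₂ ∈ sieveSet D, l d₁ * l d₂ *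
        ((N : ℝ) / (3 * (p.lcm (d₁.lcm d₂) : ℕ))) ≤
        N / 3 * ∑ e ∈ sieveSet D, (Nat.totient e : ℝ)⁻¹ *
          (1 / p * (Real.log p ⊓ Real.log (D / e)) ^ 2) := by
      refine le_trans (le_of_eq ?_) (mul_le_mul_of_nonneg_left (sum_sum_inv_lcm_prime_le hpp hp5)
        (by positivity))
      rw [Finset.mul_sum]
      refine Finset.sum_congr rfl fun d₁ h₁ => ?_
      rw [Finset.mul_sum]
      refine Finset.sum_congr rfl fun d₂ h₂ => ?_
      simp only [hl]
      field_simp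
    linarith [(abs_le.1 e1).2]
  have h3 := h1.trans (key.trans (Finset.sum_le_sum h2))
  rw [Finset.sum_add_distrib, Finset.sum_const, nsmul_eq_mul, ← Finset.mul_sum,
    Finset.sum_comm] at h3
  simp_rw [mul_sub, Finset.sum_sub_distrib, Finset.mul_sum] at h3 ⊢
  have h4 : L ^ 2 ≤ Λ ^ 2 := by gcongr
  have h5 : 4 * ((P.card : ℝ) + 1) * L ^ 2 ≤ 4 * (P.card + 1) * Λ ^ 2 := by gcongr
  refine le_trans ?_ h5
  simp only [← Finset.mul_sum] at h3 ⊢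
  linarith

lemma hasSum_factoredNumbers {F : Finset ℕ} (hF : ∀ p ∈ F, p.Prime) :
    HasSum (fun m : Nat.factoredNumbers F => (1 : ℝ) / (m : ℕ)) (∏ p ∈ F, (p : ℝ) / (p - 1)) ∧
    HasSum (fun m : Nat.factoredNumbers F => Real.log (m : ℕ) / (m : ℕ))
      ((∏ p ∈ F, (p : ℝ) / (p - 1)) * ∑ p ∈ F, Real.log p / (p - 1)) := by
  induction F using Finset.induction_on with
  | empty =>
    have h1 : ∀ m : Nat.factoredNumbers ∅, (m : ℕ) = 1 := fun m => by
      have h : ∀ k ∈ Nat.factoredNumbers ∅, k = 1 := fun k hk => by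
        rwa [Nat.factoredNumbers_empty, Set.mem_singleton_iff] at hk
      exact h m m.2
    have hm : (1 : ℕ) ∈ Nat.factoredNumbers ∅ := by simp [Nat.factoredNumbers_empty]
    constructor
    · convert! hasSum_single (f := fun m : Nat.factoredNumbers ∅ => (1 : ℝ) / (m : ℕ)) ⟨1, hm⟩
        (fun m h => absurd (Subtype.ext (h1 m)) h) using 1
      simp
    · convert! hasSum_single (f := fun m : Nat.factoredNumbers ∅ => Real.log (m : ℕ) / (m : ℕ))
        ⟨1, hm⟩ (fun m h => absurd (Subtype.ext (h1 m)) h) using 1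
      simp
  | insert p s hps ih =>
    obtain ⟨ih1, ih2⟩ := ih fun q hq => hF q (Finset.mem_insert_of_mem hq)
    have hp : p.Prime := hF p (Finset.mem_insert_self _ _)
    have hp1 : (1 : ℝ) < p := by exact_mod_cast hp.one_lt
    have hp0 : (0 : ℝ) < p := by linarith
    have hpp : (p : ℝ) - 1 ≠ 0 := by linarith
    have hlt : (p : ℝ)⁻¹ < 1 := inv_lt_one_of_one_lt₀ hp1
    have hn : ‖(p : ℝ)⁻¹‖ < 1 := by
      rw [Real.norm_of_nonneg (by positivity)]
      exact hlt
    have g1 : HasSum (fun e : ℕ => ((p : ℝ)⁻¹) ^ e) (1 - (p : ℝ)⁻¹)⁻¹ :=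
      hasSum_geometric_of_lt_one (by positivity) hlt
    have g2 : HasSum (fun e : ℕ => (e : ℝ) * ((p : ℝ)⁻¹) ^ e) ((p : ℝ)⁻¹ / (1 - (p : ℝ)⁻¹) ^ 2) :=
      hasSum_coe_mul_geometric_of_norm_lt_one hn
    have nn1 : ∀ m : Nat.factoredNumbers s, 0 ≤ (1 : ℝ) / (m : ℕ) := fun m => by positivity
    have nn2 : ∀ m : Nat.factoredNumbers s, 0 ≤ Real.log (m : ℕ) / (m : ℕ) := fun m =>
      div_nonneg (Real.log_natCast_nonneg _) (by positivity)
    have nn3 : ∀ e : ℕ, 0 ≤ ((p : ℝ)⁻¹) ^ e := fun e => by positivity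
    have nn4 : ∀ e : ℕ, 0 ≤ (e : ℝ) * ((p : ℝ)⁻¹) ^ e := fun e => by positivity
    have s1 := Summable.mul_of_nonneg g1.summable ih1.summable nn3 nn1
    have s2 := Summable.mul_of_nonneg g1.summable ih2.summable nn3 nn2
    have s3 := Summable.mul_of_nonneg g2.summable ih1.summable nn4 nn1
    have a1 := g1.mul ih1 s1
    have a2 := g1.mul ih2 s2
    have a3 := (g2.mul ih1 s3).mul_left (Real.log p)
    have a4 := a3.add a2
    have hinv : (1 - (p : ℝ)⁻¹)⁻¹ = p / (p - 1) := by field_simp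
    constructor
    · rw [← (Nat.equivProdNatFactoredNumbers hp hps).hasSum_iff, Finset.prod_insert hps, ← hinv]
      refine a1.congr_fun ?_
      rintro ⟨e, m⟩
      simp only [Function.comp_apply, Nat.equivProdNatFactoredNumbers_apply']
      push_cast
      rw [inv_pow]
      field_simp
    · rw [← (Nat.equivProdNatFactoredNumbers hp hps).hasSum_iff, Finset.prod_insert hps,
        Finset.sum_insert hps]
      have hval : p / (p - 1) * (∏ p ∈ s, (p : ℝ) / (p - 1)) *
          (Real.log p / (p - 1) + ∑ p ∈ s, Real.log p / (p - 1)) =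
          Real.log p * ((p : ℝ)⁻¹ / (1 - (p : ℝ)⁻¹) ^ 2 * ∏ p ∈ s, (p : ℝ) / (p - 1)) +
          (1 - (p : ℝ)⁻¹)⁻¹ * ((∏ p ∈ s, (p : ℝ) / (p - 1)) * ∑ p ∈ s, Real.log p / (p - 1)) := by
        have : (p : ℝ)⁻¹ / (1 - (p : ℝ)⁻¹) ^ 2 = p / (p - 1) / (p - 1) := by field_simp
        rw [hinv, this]
        ring
      rw [hval]
      refine a4.congr_fun ?_
      rintro ⟨e, m⟩
      have hm : ((m : ℕ) : ℝ) ≠ 0 := by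
        exact_mod_cast Nat.ne_zero_of_mem_factoredNumbers m.2
      simp only [Function.comp_apply, Nat.equivProdNatFactoredNumbers_apply']
      push_cast
      rw [Real.log_mul (by positivity) hm, Real.log_pow, inv_pow]
      field_simp

/-- The largest squarefree divisor of `n`. -/
def squarefreeKernel (n : ℕ) : ℕ := ∏ p ∈ n.primeFactors, p

lemma squarefreeKernel_dvd (n : ℕ) : squarefreeKernel n ∣ n := Nat.prod_primeFactors_dvd n

lemma squarefreeKernel_eq_iff {n d : ℕ} (hd : Squarefree d) :
    squarefreeKernel n = d ↔ n.primeFactors = d.primeFactors := by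
  constructor
  · rintro rfl
    exact (Nat.primeFactors_prod fun p hp => Nat.prime_of_mem_primeFactors hp).symm
  · intro h
    rw [squarefreeKernel, h]
    exact Nat.prod_primeFactors_of_squarefree hd

lemma prod_div_pred_eq {d : ℕ} (hd : Squarefree d) :
    ∏ p ∈ d.primeFactors, (p : ℝ) / (p - 1) = d * (Nat.totient d : ℝ)⁻¹ := by
  have hd0 : d ≠ 0 := hd.ne_zero
  have h1 : (d : ℝ) = ∏ p ∈ d.primeFactors, (p : ℝ) := by
    rw [← Nat.cast_prod, Nat.prod_primeFactors_of_squarefree hd]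
  have h2 : (Nat.totient d : ℝ) = ∏ p ∈ d.primeFactors, ((p : ℝ) - 1) := by
    have h3 := Nat.totient_mul_prod_primeFactors d
    have h4 := Nat.prod_primeFactors_of_squarefree hd
    rw [h4, mul_comm] at h3
    have h5 := Nat.eq_of_mul_eq_mul_left (Nat.pos_of_ne_zero hd0) h3
    rw [h5]
    push_cast
    refine Finset.prod_congr rfl fun p hp => ?_
    rw [Nat.cast_sub (Nat.prime_of_mem_primeFactors hp).one_lt.le, Nat.cast_one]
  rw [h2, Finset.prod_div_distrib, ← h1]
  rfl

open Classical in
lemma sum_filter_squarefreeKernel {d : ℕ} (hd : Squarefree d) (D : ℕ) (f : ℕ → ℝ) :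
    ∑ n ∈ (Finset.Icc 1 D).filter (fun n => squarefreeKernel n = d), f n =
      ∑ m ∈ (Finset.Icc 1 (D / d)).filter (fun m => m ∈ Nat.factoredNumbers d.primeFactors),
        f (d * m) := by
  have hd0 : 0 < d := Nat.pos_of_ne_zero hd.ne_zero
  symm
  apply Finset.sum_bij (fun m _ => d * m)
  · intro m hm
    simp only [Finset.mem_filter, Finset.mem_Icc] at hm ⊢
    obtain ⟨⟨h1, h2⟩, h3⟩ := hm
    refine ⟨⟨Nat.mul_pos hd0 h1, ?_⟩, ?_⟩
    · rw [Nat.le_div_iff_mul_le hd0] at h2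
      rwa [mul_comm]
    · rw [squarefreeKernel_eq_iff hd, Nat.primeFactors_mul hd.ne_zero (by omega)]
      exact Finset.union_eq_left.2 (Nat.primeFactors_subset_of_mem_factoredNumbers h3)
  · intro x _ y _ h
    exact Nat.eq_of_mul_eq_mul_left hd0 h
  · intro n hn
    simp only [Finset.mem_filter, Finset.mem_Icc] at hn
    obtain ⟨⟨h1, h2⟩, h3⟩ := hn
    obtain ⟨m, hm⟩ : d ∣ n := h3 ▸ squarefreeKernel_dvd n
    subst hm
    have hm0 : 0 < m := Nat.pos_of_mul_pos_left h1
    refine ⟨m, ?_, rfl⟩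
    simp only [Finset.mem_filter, Finset.mem_Icc]
    refine ⟨⟨hm0, ?_⟩, ?_⟩
    · rw [Nat.le_div_iff_mul_le hd0]
      rwa [mul_comm]
    · apply Nat.mem_factoredNumbers_of_primeFactors_subset hm0.ne'
      rw [squarefreeKernel_eq_iff hd, Nat.primeFactors_mul hd.ne_zero hm0.ne'] at h3
      exact Finset.union_eq_left.1 h3
  · intro m _
    rfl

open Classical in
lemma sum_inv_squarefreeKernel_le {d : ℕ} (hd : Squarefree d) (D : ℕ) :
    ∑ n ∈ (Finset.Icc 1 D).filter (fun n => squarefreeKernel n = d), (1 : ℝ) / n ≤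
      (Nat.totient d : ℝ)⁻¹ := by
  have hd0 : (0 : ℝ) < d := by exact_mod_cast Nat.pos_of_ne_zero hd.ne_zero
  have h1 := (hasSum_factoredNumbers
    fun p (hp : p ∈ d.primeFactors) => Nat.prime_of_mem_primeFactors hp).1.mul_left ((1 : ℝ) / d)
  have h2 := sum_le_hasSum ((Finset.Icc 1 (D / d)).subtype
    (fun m => m ∈ Nat.factoredNumbers d.primeFactors)) (fun m _ => by positivity) h1
  rw [sum_filter_squarefreeKernel hd]
  have h3 := Finset.sum_subtype_eq_sum_filter (s := Finset.Icc 1 (D / d))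
    (p := fun m => m ∈ Nat.factoredNumbers d.primeFactors) (fun m => (1 : ℝ) / d * (1 / (m : ℕ)))
  rw [prod_div_pred_eq hd] at h2
  calc _ = ∑ m ∈ (Finset.Icc 1 (D / d)).filter (fun m => m ∈ Nat.factoredNumbers d.primeFactors),
        (1 : ℝ) / d * (1 / (m : ℕ)) := by
        refine Finset.sum_congr rfl fun m _ => ?_
        push_cast
        rw [one_div_mul_one_div]
    _ ≤ _ := by
        rw [← h3]
        refine h2.trans (le_of_eq ?_)
        field_simp

open Classical in
lemma le_sum_log_squarefreeKernel {d : ℕ} (hd : Squarefree d) (D : ℕ) (hD : 0 < D) :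
    (Nat.totient d : ℝ)⁻¹ * (Real.log (D / d) - ∑ p ∈ d.primeFactors, Real.log p / (p - 1)) ≤
    ∑ n ∈ (Finset.Icc 1 D).filter (fun n => squarefreeKernel n = d),
      (1 : ℝ) / n * Real.log (D / n) := by
  have hd0 : (0 : ℝ) < d := by exact_mod_cast Nat.pos_of_ne_zero hd.ne_zero
  have hD0 : (0 : ℝ) < D := by exact_mod_cast hD
  obtain ⟨h1, h1'⟩ := (hasSum_factoredNumbers
    fun p (hp : p ∈ d.primeFactors) => Nat.prime_of_mem_primeFactors hp)
  have h4 := ((h1.mul_left (Real.log (D / d))).sub h1').mul_left ((1 : ℝ) / d)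
  have h5 := h4.neg
  have h2 := sum_le_hasSum ((Finset.Icc 1 (D / d)).subtype
    (fun m => m ∈ Nat.factoredNumbers d.primeFactors)) (fun m hm => by
      rw [Finset.mem_subtype, Finset.mem_Icc, not_and_or] at hm
      have hm0 : 0 < (m : ℕ) := Nat.pos_of_ne_zero (Nat.ne_zero_of_mem_factoredNumbers m.2)
      have hm0' : (0 : ℝ) < (m : ℕ) := by exact_mod_cast hm0
      have hm1 : D / d < m := by
        rcases hm with h | h <;> omega
      rw [Nat.div_lt_iff_lt_mul (Nat.pos_of_ne_zero hd.ne_zero)] at hm1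
      have hlog : Real.log (D / d) ≤ Real.log (m : ℕ) := by
        apply Real.log_le_log (by positivity)
        rw [div_le_iff₀ hd0]
        exact_mod_cast hm1.le
      have : (1 : ℝ) / d * (Real.log (D / d) * (1 / (m : ℕ)) - Real.log (m : ℕ) / (m : ℕ)) =
        1 / d * (1 / (m : ℕ)) * (Real.log (D / d) - Real.log (m : ℕ)) := by ring
      rw [this]
      have h6 : 0 ≤ (1 : ℝ) / d * (1 / (m : ℕ)) := by positivity
      nlinarith) h5
  rw [sum_filter_squarefreeKernel hd]
  rw [prod_div_pred_eq hd, Finset.sum_neg_distrib, neg_le_neg_iff] at h2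
  have h3 := Finset.sum_subtype_eq_sum_filter (s := Finset.Icc 1 (D / d))
    (p := fun m => m ∈ Nat.factoredNumbers d.primeFactors) (fun m =>
      (1 : ℝ) / d * (Real.log (D / d) * (1 / (m : ℕ)) - Real.log (m : ℕ) / (m : ℕ)))
  rw [h3] at h2
  refine le_trans (le_of_eq ?_) (h2.trans (le_of_eq ?_))
  · field_simp
  · refine Finset.sum_congr rfl fun m hm => ?_
    rw [Finset.mem_filter, Finset.mem_Icc] at hm
    have hm0 : (0 : ℝ) < m := by exact_mod_cast hm.1.1
    push_cast
    rw [← div_div (D : ℝ), Real.log_div (by positivity) hm0.ne']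
    field_simp

lemma squarefreeKernel_mem_sieveSet {D n : ℕ} (hn : n ∈ (Finset.Icc 1 D).filter (fun n => n.Coprime 6)) :
    squarefreeKernel n ∈ sieveSet D := by
  rw [Finset.mem_filter, Finset.mem_Icc] at hn
  have hdvd := squarefreeKernel_dvd n
  rw [mem_sieveSet]
  refine ⟨⟨Nat.pos_of_dvd_of_pos hdvd hn.1.1, (Nat.le_of_dvd hn.1.1 hdvd).trans hn.1.2⟩, ?_,
    Nat.Coprime.of_dvd_left hdvd hn.2⟩
  have := Nat.primeFactors_prod (s := n.primeFactors) fun p hp => Nat.prime_of_mem_primeFactors hp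
  rw [squarefreeKernel]
  exact Finset.squarefree_prod_of_pairwise_isCoprime (fun p hp q hq hpq => by
    rw [Function.onFun, Nat.coprime_iff_isRelPrime.symm]
    exact (Nat.coprime_primes (Nat.prime_of_mem_primeFactors hp)
      (Nat.prime_of_mem_primeFactors hq)).2 hpq)
    fun p hp => (Nat.prime_of_mem_primeFactors hp).squarefree

lemma sum_coprime_six_eq_sum_sieveSet (D : ℕ) (f : ℕ → ℝ) :
    ∑ n ∈ (Finset.Icc 1 D).filter (fun n => n.Coprime 6), f n =
      ∑ d ∈ sieveSet D, ∑ n ∈ (Finset.Icc 1 D).filter (fun n => squarefreeKernel n = d), f n := by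
  rw [← Finset.sum_fiberwise_of_maps_to (g := squarefreeKernel)
    (fun n hn => squarefreeKernel_mem_sieveSet hn)]
  refine Finset.sum_congr rfl fun d hd => Finset.sum_congr ?_ fun _ _ => rfl
  ext n
  simp only [Finset.mem_filter, and_assoc]
  refine and_congr_right fun hn => ⟨fun h => h.2, fun h => ⟨?_, h⟩⟩
  rw [Finset.mem_Icc] at hn
  have hd' := mem_sieveSet.1 hd
  have h1 := (squarefreeKernel_eq_iff hd'.2.1).1 h
  rw [← Nat.disjoint_primeFactors (by omega) (by norm_num)]
  rw [h1, Nat.disjoint_primeFactors hd'.2.1.ne_zero (by norm_num)]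
  exact hd'.2.2

theorem sum_inv_mul_log_pow_le (D k : ℕ) :
    ∑ n ∈ (Finset.Icc 1 D).filter (fun n => n.Coprime 6), (1 : ℝ) / n * Real.log (D / n) ^ k ≤
      ∑ e ∈ sieveSet D, (Nat.totient e : ℝ)⁻¹ * Real.log (D / e) ^ k := by
  rw [sum_coprime_six_eq_sum_sieveSet]
  refine Finset.sum_le_sum fun d hd => ?_
  have hd' := mem_sieveSet.1 hd
  refine le_trans ?_ (mul_le_mul_of_nonneg_right (sum_inv_squarefreeKernel_le hd'.2.1 D)
    (pow_nonneg (log_div_nonneg_of_mem_sieveSet hd) k))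
  rw [Finset.sum_mul]
  refine Finset.sum_le_sum fun n hn => ?_
  rw [Finset.mem_filter, Finset.mem_Icc] at hn
  have hn0 : (0 : ℝ) < n := by exact_mod_cast hn.1.1
  have hnD : (n : ℝ) ≤ D := by exact_mod_cast hn.1.2
  have hdn : (d : ℝ) ≤ n := by
    have := Nat.le_of_dvd hn.1.1 (squarefreeKernel_dvd n)
    rw [hn.2] at this
    exact_mod_cast this
  have hd0 : (0 : ℝ) < d := by exact_mod_cast hd'.1.1
  refine mul_le_mul_of_nonneg_left (pow_le_pow_left₀ ?_ ?_ k) (by positivity)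
  · apply Real.log_nonneg
    rwa [le_div_iff₀ hn0, one_mul]
  · apply Real.log_le_log (div_pos (by linarith) hn0)
    gcongr

theorem sum_inv_totient_mul_log_le (D : ℕ) :
    ∑ e ∈ sieveSet D, (Nat.totient e : ℝ)⁻¹ * Real.log (D / e) ≤
      ∑ n ∈ (Finset.Icc 1 D).filter (fun n => n.Coprime 6), (1 : ℝ) / n * Real.log (D / n) +
      ∑ e ∈ sieveSet D, (Nat.totient e : ℝ)⁻¹ * ∑ p ∈ e.primeFactors, Real.log p / (p - 1) := by
  rw [sum_coprime_six_eq_sum_sieveSet, ← Finset.sum_add_distrib]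
  refine Finset.sum_le_sum fun d hd => ?_
  have hd' := mem_sieveSet.1 hd
  have := le_sum_log_squarefreeKernel hd'.2.1 D (by omega)
  rw [mul_sub] at this
  linarith

lemma ConvexOn.apply_add_le {G : ℝ → ℝ} {s : Set ℝ} (hG : ConvexOn ℝ s G) {x y : ℝ} (hx : x ∈ s)
    (hy : y ∈ s) {α β : ℝ} (hα : 0 ≤ α) (hβ : 0 ≤ β) (h : α + β = 1) :
    G (α * x + β * y) ≤ α * G x + β * G y := by
  simpa using hG.2 hx hy hα hβ h

lemma ConvexOn.sub_le_trapezoid {G Φ : ℝ → ℝ} {a b : ℝ} (hab : a < b)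
    (hG : ConvexOn ℝ (Set.Icc a b) G) (hΦ : ∀ t ∈ Set.Icc a b, HasDerivAt Φ (G t) t) :
    Φ b - Φ a ≤ (b - a) / 2 * (G a + G b) := by
  have hba : 0 < b - a := by linarith
  set F : ℝ → ℝ := fun t => Φ t - (G a * (t - a) + (t - a) ^ 2 / (2 * (b - a)) * (G b - G a))
  have hF : ∀ t ∈ Set.Icc a b, HasDerivAt F (G t - (G a + (t - a) / (b - a) * (G b - G a))) t := by
    intro t ht
    have h1 : HasDerivAt (fun t : ℝ => t - a) 1 t := (hasDerivAt_id t).sub_const a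
    have h2 := (h1.const_mul (G a)).add (((h1.pow 2).div_const (2 * (b - a))).mul_const (G b - G a))
    refine HasDerivAt.congr_deriv ((hΦ t ht).sub h2) ?_
    field_simp
    ring
  have hanti : AntitoneOn F (Set.Icc a b) := by
    apply antitoneOn_of_deriv_nonpos (convex_Icc a b)
    · exact fun t ht => (hF t ht).continuousAt.continuousWithinAt
    · intro t ht
      rw [interior_Icc] at ht
      exact (hF t ⟨ht.1.le, ht.2.le⟩).differentiableAt.differentiableWithinAt
    · intro t ht
      rw [interior_Icc] at ht
      rw [(hF t ⟨ht.1.le, ht.2.le⟩).deriv]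
      have h3 := hG.apply_add_le (Set.left_mem_Icc.2 hab.le) (Set.right_mem_Icc.2 hab.le)
        (α := (b - t) / (b - a)) (β := (t - a) / (b - a))
        (div_nonneg (by linarith [ht.2]) hba.le) (div_nonneg (by linarith [ht.1]) hba.le)
        (by field_simp; ring)
      have h4 : (b - t) / (b - a) * a + (t - a) / (b - a) * b = t := by field_simp; ring
      have h5 : (b - t) / (b - a) = 1 - (t - a) / (b - a) := by field_simp; ring
      rw [h4, h5] at h3
      linarith
  have h6 := hanti (Set.left_mem_Icc.2 hab.le) (Set.right_mem_Icc.2 hab.le) hab.le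
  simp only [F] at h6
  have h7 : (b - a) ^ 2 / (2 * (b - a)) = (b - a) / 2 := by field_simp
  rw [h7] at h6
  simp only [sub_self, mul_zero, ne_eq, OfNat.ofNat_ne_zero, not_false_eq_true, zero_pow,
    zero_div, zero_mul, add_zero, sub_zero] at h6
  linarith

lemma ConvexOn.midpoint_le_sub {G Φ : ℝ → ℝ} {c s : ℝ} (hs : 0 < s)
    (hG : ConvexOn ℝ (Set.Icc (c - s) (c + s)) G)
    (hΦ : ∀ t ∈ Set.Icc (c - s) (c + s), HasDerivAt Φ (G t) t) :
    2 * s * G c ≤ Φ (c + s) - Φ (c - s) := by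
  set F : ℝ → ℝ := fun t => Φ (c + t) - Φ (c - t) - 2 * t * G c
  have hF : ∀ t ∈ Set.Icc 0 s, HasDerivAt F (G (c + t) + G (c - t) - 2 * G c) t := by
    intro t ht
    have h1 : HasDerivAt (fun t : ℝ => c + t) 1 t := (hasDerivAt_id t).const_add c
    have h2 : HasDerivAt (fun t : ℝ => c - t) (-1) t := (hasDerivAt_id t).const_sub c
    have h3 := HasDerivAt.comp t (hΦ (c + t) ⟨by linarith [ht.1], by linarith [ht.2]⟩) h1
    have h4 := HasDerivAt.comp t (hΦ (c - t) ⟨by linarith [ht.2], by linarith [ht.1]⟩) h2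
    have h5 : HasDerivAt (fun t : ℝ => 2 * t * G c) (2 * 1 * G c) t :=
      ((hasDerivAt_id t).const_mul 2).mul_const _
    refine HasDerivAt.congr_deriv ((h3.sub h4).sub h5) ?_
    ring
  have hmono : MonotoneOn F (Set.Icc 0 s) := by
    apply monotoneOn_of_deriv_nonneg (convex_Icc 0 s)
    · exact fun t ht => (hF t ht).continuousAt.continuousWithinAt
    · intro t ht
      rw [interior_Icc] at ht
      exact (hF t ⟨ht.1.le, ht.2.le⟩).differentiableAt.differentiableWithinAt
    · intro t ht
      rw [interior_Icc] at ht
      rw [(hF t ⟨ht.1.le, ht.2.le⟩).deriv]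
      have h3 := hG.apply_add_le (x := c - t) (y := c + t) ⟨by linarith [ht.2], by linarith [ht.1]⟩
        ⟨by linarith [ht.1], by linarith [ht.2]⟩
        (α := 1 / 2) (β := 1 / 2) (by norm_num) (by norm_num) (by norm_num)
      have h4 : 1 / 2 * (c - t) + 1 / 2 * (c + t) = c := by ring
      rw [h4] at h3
      linarith
  have h6 := hmono (Set.left_mem_Icc.2 hs.le) (Set.right_mem_Icc.2 hs.le) hs.le
  simp only [F] at h6
  simp only [sub_zero, add_zero, mul_zero, zero_mul, sub_self] at h6
  linarith

lemma convexOn_inv_mul_log_pow {D : ℝ} (k : ℕ) :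
    ConvexOn ℝ (Set.Ioc 0 D) (fun t => 1 / t * Real.log (D / t) ^ k) := by
  have hconv : Convex ℝ (Set.Ioc 0 D) := convex_Ioc 0 D
  have hsub : Set.Ioc 0 D ⊆ Set.Ioi 0 := fun t ht => ht.1
  have hnn : ∀ ⦃t⦄, t ∈ Set.Ioc 0 D → 0 ≤ Real.log (D / t) := fun t ht => by
    apply Real.log_nonneg
    rw [le_div_iff₀ ht.1, one_mul]
    exact ht.2
  have h1 : ConvexOn ℝ (Set.Ioc 0 D) (fun t => Real.log (D / t)) := by
    have h := (strictConcaveOn_log_Ioi.concaveOn.subset hsub hconv).neg.add_const (Real.log D)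
    refine h.congr fun t ht => ?_
    simp only [Pi.neg_apply, Pi.add_apply]
    rw [Real.log_div (by linarith [ht.1, ht.2]) ht.1.ne']
    ring
  have h2 : ConvexOn ℝ (Set.Ioc 0 D) (fun t : ℝ => 1 / t) := by
    have h := (convexOn_zpow (𝕜 := ℝ) (-1)).subset hsub hconv
    refine h.congr fun t _ => ?_
    simp
  have hanti : ∀ ⦃x⦄, x ∈ Set.Ioc 0 D → ∀ ⦃y⦄, y ∈ Set.Ioc 0 D → x ≤ y →
      Real.log (D / y) ^ k ≤ Real.log (D / x) ^ k := by
    intro x hx y hy hxy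
    have hx0 := hx.1
    have hy0 := hy.1
    have hD : 0 < D := hx0.trans_le hx.2
    refine pow_le_pow_left₀ (hnn hy) (Real.log_le_log (by positivity) ?_) k
    gcongr
  refine h2.mul (h1.pow hnn k) (fun t ht => (one_div_pos.2 ht.1).le)
    (fun t ht => pow_nonneg (hnn ht) k) ?_
  intro x hx y hy hxy
  have hlt : y ≤ x := by
    by_contra hcon
    exact absurd hxy (not_lt.2 (hanti hx hy (not_le.1 hcon).le))
  exact one_div_le_one_div_of_le hy.1 hlt

lemma hasDerivAt_log_pow {D t : ℝ} (hD : 0 < D) (ht : 0 < t) (k : ℕ) :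
    HasDerivAt (fun t => -(Real.log (D / t) ^ (k + 1) / (k + 1))) (1 / t * Real.log (D / t) ^ k) t := by
  have h1 : HasDerivAt (fun t : ℝ => D / t) (-D / t ^ 2) t := by
    refine HasDerivAt.congr_deriv ((hasDerivAt_const t D).div (hasDerivAt_id t) ht.ne') ?_
    simp
  have h2 := (((h1.log (by positivity)).pow (k + 1)).div_const ((k : ℝ) + 1)).neg
  refine HasDerivAt.congr_deriv (f := fun t => -(Real.log (D / t) ^ (k + 1) / (k + 1)))
    (by simpa [Pi.neg_def] using h2) ?_
  have : (k : ℝ) + 1 ≠ 0 := by positivity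
  field_simp

lemma sum_coprime_six_eq (J : ℕ) (f : ℕ → ℝ) :
    ∑ n ∈ (Finset.Icc 1 (6 * J)).filter (fun n => n.Coprime 6), f n =
      ∑ j ∈ Finset.range J, (f (6 * j + 1) + f (6 * j + 5)) := by
  induction J with
  | zero => simp
  | succ J ih =>
    have h : (Finset.Icc 1 (6 * (J + 1))).filter (fun n => n.Coprime 6) =
        insert (6 * J + 1) (insert (6 * J + 5)
          ((Finset.Icc 1 (6 * J)).filter (fun n => n.Coprime 6))) := by
      ext n
      simp only [Finset.mem_filter, Finset.mem_Icc, Finset.mem_insert, coprime_six_iff]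
      omega
    rw [h, Finset.sum_insert, Finset.sum_insert, ih, Finset.sum_range_succ]
    · ring
    · simp
    · simp

lemma sum_coprime_six_succ_eq (J : ℕ) (f : ℕ → ℝ) :
    ∑ n ∈ (Finset.Icc 1 (6 * (J + 1))).filter (fun n => n.Coprime 6), f n =
      f 1 + ∑ j ∈ Finset.range J, (f (6 * j + 5) + f (6 * j + 7)) + f (6 * J + 5) := by
  rw [sum_coprime_six_eq]
  induction J with
  | zero => simp
  | succ J ih =>
    rw [Finset.sum_range_succ, ih, Finset.sum_range_succ _ J]
    ring_nf

theorem sum_coprime_six_inv_mul_log_pow_le {D J : ℕ} (hD : D = 6 * (J + 1)) (k : ℕ) :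
    ∑ n ∈ (Finset.Icc 1 D).filter (fun n => n.Coprime 6), (1 : ℝ) / n * Real.log (D / n) ^ k ≤
      Real.log D ^ k + Real.log (D / 3) ^ (k + 1) / (3 * (k + 1)) +
        (1 : ℝ) / (D - 1) * Real.log (D / (D - 1)) ^ k := by
  set G : ℝ → ℝ := fun t => 1 / t * Real.log (D / t) ^ k with hG
  set Φ : ℝ → ℝ := fun t => -(Real.log (D / t) ^ (k + 1) / (k + 1)) with hΦ
  have hDr : (D : ℝ) = 6 * (J + 1) := by rw [hD]; push_cast; ring
  have hD0 : (0 : ℝ) < D := by rw [hDr]; positivity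
  have hconv : ConvexOn ℝ (Set.Ioc 0 (D : ℝ)) G := convexOn_inv_mul_log_pow k
  have hder : ∀ t : ℝ, 0 < t → HasDerivAt Φ (G t) t := fun t ht => hasDerivAt_log_pow hD0 ht k
  have hpair : ∀ j ∈ Finset.range J, G (6 * j + 5 : ℕ) + G (6 * j + 7 : ℕ) ≤
      (Φ (6 * (j + 1 : ℕ) + 3) - Φ (6 * j + 3)) / 3 := by
    intro j hj
    have hjJ : (j : ℝ) + 1 ≤ J := by exact_mod_cast Finset.mem_range.1 hj
    have hj0 : (0 : ℝ) ≤ j := Nat.cast_nonneg j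
    have e1 := ConvexOn.midpoint_le_sub (c := 6 * (j : ℝ) + 5) (s := 2) (by norm_num)
      (hconv.subset (fun t ht => ⟨by linarith [ht.1], by linarith [ht.2]⟩) (convex_Icc _ _))
      (fun t ht => hder t (by linarith [ht.1]))
    have e2 := ConvexOn.midpoint_le_sub (c := 6 * (j : ℝ) + 8) (s := 1) (by norm_num)
      (hconv.subset (fun t ht => ⟨by linarith [ht.1], by linarith [ht.2]⟩) (convex_Icc _ _))
      (fun t ht => hder t (by linarith [ht.1]))
    have e3 := hconv.apply_add_le (x := 6 * (j : ℝ) + 5) (y := 6 * (j : ℝ) + 8)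
      ⟨by linarith, by linarith⟩ ⟨by linarith, by linarith⟩
      (α := 1 / 3) (β := 2 / 3) (by norm_num) (by norm_num) (by norm_num)
    have e4 : 1 / 3 * (6 * (j : ℝ) + 5) + 2 / 3 * (6 * j + 8) = 6 * j + 7 := by ring
    have e5 : 6 * (j : ℝ) + 5 + 2 = 6 * j + 7 := by ring
    have e6 : 6 * (j : ℝ) + 5 - 2 = 6 * j + 3 := by ring
    have e7 : 6 * (j : ℝ) + 8 + 1 = 6 * (j + 1) + 3 := by ring
    have e8 : 6 * (j : ℝ) + 8 - 1 = 6 * j + 7 := by ring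
    rw [e4] at e3
    rw [e5, e6] at e1
    rw [e7, e8] at e2
    push_cast
    linarith
  have h1 := Finset.sum_le_sum hpair
  have htel := Finset.sum_range_sub (fun j : ℕ => Φ (6 * (j : ℝ) + 3)) J
  rw [← Finset.sum_div, htel] at h1
  have h2 : Φ (6 * (J : ℝ) + 3) ≤ 0 := by
    rw [hΦ, neg_nonpos]
    have : 0 ≤ Real.log (D / (6 * J + 3)) := by
      apply Real.log_nonneg
      rw [le_div_iff₀ (by positivity), hDr]
      linarith
    positivity
  have h3 : Φ (6 * ((0 : ℕ) : ℝ) + 3) = -(Real.log (D / 3) ^ (k + 1) / (k + 1)) := by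
    simp [hΦ]
  rw [h3] at h1
  have h4 := sum_coprime_six_succ_eq J (fun n : ℕ => G n)
  rw [← hD] at h4
  change ∑ n ∈ (Finset.Icc 1 D).filter (fun n => n.Coprime 6), G n ≤ _
  rw [h4]
  have h5 : ((6 * J + 5 : ℕ) : ℝ) = D - 1 := by rw [hDr]; push_cast; ring
  have h6 : G ((1 : ℕ) : ℝ) = Real.log D ^ k := by simp [hG]
  rw [h5, h6]
  have h7 : Real.log ((D : ℝ) / 3) ^ (k + 1) / (3 * (k + 1)) =
    Real.log (D / 3) ^ (k + 1) / (k + 1) / 3 := by rw [div_div, mul_comm]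
  rw [h7]
  have h8 : G (D - 1) = 1 / ((D : ℝ) - 1) * Real.log (D / (D - 1)) ^ k := rfl
  rw [h8]
  linarith

theorem le_sum_coprime_six_inv_mul_log_pow {D J : ℕ} (hD : D = 6 * (J + 1)) {k : ℕ} (hk : k ≠ 0) :
    Real.log D ^ k + Real.log (D / 6) ^ k / 6 + Real.log (D / 6) ^ (k + 1) / (3 * (k + 1)) ≤
    ∑ n ∈ (Finset.Icc 1 D).filter (fun n => n.Coprime 6), (1 : ℝ) / n * Real.log (D / n) ^ k := by
  set G : ℝ → ℝ := fun t => 1 / t * Real.log (D / t) ^ k with hG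
  set Φ : ℝ → ℝ := fun t => -(Real.log (D / t) ^ (k + 1) / (k + 1)) with hΦ
  have hDr : (D : ℝ) = 6 * (J + 1) := by rw [hD]; push_cast; ring
  have hD0 : (0 : ℝ) < D := by rw [hDr]; positivity
  have hconv : ConvexOn ℝ (Set.Ioc 0 (D : ℝ)) G := convexOn_inv_mul_log_pow k
  have hder : ∀ t : ℝ, 0 < t → HasDerivAt Φ (G t) t := fun t ht => hasDerivAt_log_pow hD0 ht k
  have hpair : ∀ j ∈ Finset.range J, 2 * G (6 * (j + 1 : ℕ)) ≤ G (6 * j + 5 : ℕ) + G (6 * j + 7 : ℕ) := by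
    intro j hj
    have hjJ : (j : ℝ) + 1 ≤ J := by exact_mod_cast Finset.mem_range.1 hj
    have hj0 : (0 : ℝ) ≤ j := Nat.cast_nonneg j
    have e3 := hconv.apply_add_le (x := 6 * (j : ℝ) + 5) (y := 6 * (j : ℝ) + 7)
      ⟨by linarith, by linarith⟩ ⟨by linarith, by linarith⟩
      (α := 1 / 2) (β := 1 / 2) (by norm_num) (by norm_num) (by norm_num)
    have e4 : 1 / 2 * (6 * (j : ℝ) + 5) + 1 / 2 * (6 * j + 7) = 6 * (j + 1) := by ring
    rw [e4] at e3
    push_cast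
    linarith
  have htrap : ∀ j ∈ Finset.range J, Φ (6 * ((j + 1 : ℕ) + 1)) - Φ (6 * ((j : ℝ) + 1)) ≤
      3 * (G (6 * (j + 1 : ℕ)) + G (6 * ((j + 1 : ℕ) + 1 : ℕ))) := by
    intro j hj
    have hjJ : (j : ℝ) + 1 ≤ J := by exact_mod_cast Finset.mem_range.1 hj
    have hj0 : (0 : ℝ) ≤ j := Nat.cast_nonneg j
    have e1 := ConvexOn.sub_le_trapezoid (a := 6 * ((j : ℝ) + 1)) (b := 6 * ((j + 1 : ℕ) + 1))
      (by push_cast; linarith)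
      (hconv.subset (fun t ht => by
        have h1 := ht.1
        have h2 := ht.2
        push_cast at h2
        exact ⟨by linarith, by linarith⟩) (convex_Icc _ _))
      (fun t ht => hder t (by linarith [ht.1]))
    have e2 : (6 * (((j + 1 : ℕ) : ℝ) + 1) - 6 * ((j : ℝ) + 1)) / 2 = 3 := by push_cast; ring
    rw [e2] at e1
    push_cast at e1 ⊢
    exact e1
  have h1 := Finset.sum_le_sum hpair
  have h2 := Finset.sum_le_sum htrap
  rw [Finset.sum_range_sub (fun j : ℕ => Φ (6 * ((j : ℝ) + 1))) J, ← Finset.mul_sum,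
    Finset.sum_add_distrib] at h2
  have h3 := Finset.sum_range_sub (fun j : ℕ => G (6 * ((j + 1 : ℕ) : ℝ))) J
  rw [Finset.sum_sub_distrib] at h3
  rw [← Finset.mul_sum] at h1
  have hGD : G (6 * ((J + 1 : ℕ) : ℝ)) = 0 := by
    have : (6 * ((J + 1 : ℕ) : ℝ)) = D := by rw [hDr]; push_cast; ring
    rw [this, hG]
    simp [div_self hD0.ne', hk]
  have hΦD : Φ (6 * ((J : ℝ) + 1)) = 0 := by
    rw [← hDr, hΦ]
    simp [div_self hD0.ne']
  have hG6 : G (6 * ((0 + 1 : ℕ) : ℝ)) = Real.log (D / 6) ^ k / 6 := by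
    simp only [hG]
    push_cast
    norm_num
    ring
  have hΦ6 : Φ (6 * (((0 : ℕ) : ℝ) + 1)) = -(Real.log (D / 6) ^ (k + 1) / (k + 1)) := by
    simp [hΦ]
  rw [hΦD, hΦ6] at h2
  rw [hGD, hG6] at h3
  have h4 := sum_coprime_six_succ_eq J (fun n : ℕ => G n)
  rw [← hD] at h4
  change _ ≤ ∑ n ∈ (Finset.Icc 1 D).filter (fun n => n.Coprime 6), G n
  rw [h4]
  have h6 : G ((1 : ℕ) : ℝ) = Real.log D ^ k := by simp [hG]
  have h7 : Real.log ((D : ℝ) / 6) ^ (k + 1) / (3 * (k + 1)) =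
    Real.log (D / 6) ^ (k + 1) / (k + 1) / 3 := by rw [div_div, mul_comm]
  have h8 : 0 ≤ G ((6 * J + 5 : ℕ) : ℝ) := by
    have : 0 ≤ Real.log ((D : ℝ) / (6 * J + 5 : ℕ)) := by
      apply Real.log_nonneg
      rw [le_div_iff₀ (by positivity), hDr]
      push_cast
      linarith
    simp only [hG]
    positivity
  rw [h6, h7]
  linarith

lemma prod_one_add_primeFactors {e : ℕ} (he : Squarefree e) (f : ℕ → ℝ) :
    ∏ p ∈ e.primeFactors, (1 + f p) = ∑ t ∈ e.divisors, ∏ p ∈ t.primeFactors, f p := by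
  have h := (ArithmeticFunction.IsMultiplicative.prodPrimeFactors
    f).prodPrimeFactors_one_add_of_squarefree he
  have h2 : ∀ t ∈ e.divisors, ArithmeticFunction.prodPrimeFactors f t = ∏ p ∈ t.primeFactors, f p :=
    fun t ht => ArithmeticFunction.prodPrimeFactors_apply (Nat.pos_of_mem_divisors ht).ne'
  rw [Finset.sum_congr rfl h2] at h
  rw [← h]
  refine Finset.prod_congr rfl fun p hp => ?_
  have hp' := Nat.prime_of_mem_primeFactors hp
  rw [ArithmeticFunction.prodPrimeFactors_apply hp'.ne_zero, hp'.primeFactors,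
    Finset.prod_singleton]

lemma primeFactors_subset_of_mem_sieveSet {D t : ℕ} (ht : t ∈ sieveSet D) :
    t.primeFactors ⊆ primesFromFive D := by
  intro p hp
  obtain ⟨⟨h1, h2⟩, -, h4⟩ := mem_sieveSet.1 ht
  have hp' := Nat.prime_of_mem_primeFactors hp
  have hd := Nat.dvd_of_mem_primeFactors hp
  have hc : p.Coprime 6 := Nat.Coprime.coprime_dvd_left hd h4
  refine mem_primesFromFive.2 ⟨?_, (Nat.le_of_dvd h1 hd).trans h2, hp'⟩
  by_contra h
  have h0 := hp'.two_le
  have : p < 5 := by omega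
  interval_cases p <;> revert hc hp' <;> decide

lemma sum_prod_primeFactors_le (D : ℕ) {f : ℕ → ℝ} (hf : ∀ p, 5 ≤ p → 0 ≤ f p) :
    ∑ t ∈ sieveSet D, ∏ p ∈ t.primeFactors, f p ≤ Real.exp (∑ p ∈ primesFromFive D, f p) := by
  have h1 : ∏ p ∈ primesFromFive D, (1 + f p) ≤ Real.exp (∑ p ∈ primesFromFive D, f p) := by
    rw [Real.exp_sum]
    refine Finset.prod_le_prod (fun p hp => ?_) fun p hp => ?_
    · have := hf p (mem_primesFromFive.1 hp).1
      positivity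
    · have := Real.add_one_le_exp (f p)
      linarith
  refine le_trans ?_ h1
  rw [Finset.prod_one_add]
  have hinj : Set.InjOn Nat.primeFactors (sieveSet D : Set ℕ) := by
    intro a ha b hb hab
    have h1 := Nat.prod_primeFactors_of_squarefree (mem_sieveSet.1 ha).2.1
    have h2 := Nat.prod_primeFactors_of_squarefree (mem_sieveSet.1 hb).2.1
    rw [← h1, ← h2, hab]
  rw [← Finset.sum_image (f := fun s => ∏ p ∈ s, f p) hinj]
  refine Finset.sum_le_sum_of_subset_of_nonneg ?_ ?_
  · intro s hs
    obtain ⟨t, ht, rfl⟩ := Finset.mem_image.1 hs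
    exact Finset.mem_powerset.2 (primeFactors_subset_of_mem_sieveSet ht)
  · intro s hs _
    exact Finset.prod_nonneg fun p hp =>
      hf p (mem_primesFromFive.1 (Finset.mem_powerset.1 hs hp)).1

lemma sum_mul_sum_divisors_le (D : ℕ) {w g : ℕ → ℝ} (hw : ∀ n, 1 ≤ n → n ≤ D → 0 ≤ w n)
    (hg : ∀ t ∈ sieveSet D, 0 ≤ g t) :
    ∑ e ∈ sieveSet D, w e * ∑ t ∈ e.divisors, g t ≤
      ∑ t ∈ sieveSet D, g t * ∑ m ∈ (Finset.Icc 1 (D / t)).filter (fun m => m.Coprime 6),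
        w (t * m) := by
  have h1 : ∑ e ∈ sieveSet D, w e * ∑ t ∈ e.divisors, g t =
      ∑ t ∈ sieveSet D, g t * ∑ e ∈ (sieveSet D).filter (t ∣ ·), w e := by
    simp only [Finset.mul_sum]
    rw [Finset.sum_comm' (t' := sieveSet D) (s' := fun t => (sieveSet D).filter (t ∣ ·))]
    · exact Finset.sum_congr rfl fun t _ => Finset.sum_congr rfl fun e _ => mul_comm _ _
    · intro e t
      simp only [Nat.mem_divisors, Finset.mem_filter]
      constructor
      · rintro ⟨h1, h2, h3⟩
        exact ⟨⟨h1, h2⟩, mem_sieveSet_of_dvd h1 h2⟩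
      · rintro ⟨⟨h1, h2⟩, h3⟩
        exact ⟨h1, h2, by have := (mem_sieveSet.1 h1).1; omega⟩
  rw [h1]
  refine Finset.sum_le_sum fun t ht => mul_le_mul_of_nonneg_left ?_ (hg t ht)
  have ht0 : 0 < t := (mem_sieveSet.1 ht).1.1
  rw [← Finset.sum_image (f := w) (g := fun m => t * m)
    (fun a _ b _ hab => Nat.eq_of_mul_eq_mul_left ht0 hab)]
  refine Finset.sum_le_sum_of_subset_of_nonneg ?_ ?_
  · intro e he
    obtain ⟨he, m, rfl⟩ := Finset.mem_filter.1 he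
    obtain ⟨⟨h1, h2⟩, -, h4⟩ := mem_sieveSet.1 he
    refine Finset.mem_image.2 ⟨m, Finset.mem_filter.2 ⟨Finset.mem_Icc.2 ⟨?_, ?_⟩, ?_⟩, rfl⟩
    · exact Nat.pos_of_mul_pos_left h1
    · exact (Nat.le_div_iff_mul_le ht0).2 (by rw [mul_comm]; exact h2)
    · exact Nat.Coprime.coprime_dvd_left (Dvd.intro_left t rfl) h4
  · intro e he _
    obtain ⟨m, hm, rfl⟩ := Finset.mem_image.1 he
    obtain ⟨h1, h2⟩ := Finset.mem_Icc.1 (Finset.mem_filter.1 hm).1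
    refine hw _ (Nat.mul_pos ht0 h1) ?_
    have := (Nat.le_div_iff_mul_le ht0).1 h2
    rwa [mul_comm]

lemma sum_inv_mul_pred_le (N : ℕ) :
    ∑ p ∈ primesFromFive N, (1 : ℝ) / ((p : ℝ) * (p - 1)) ≤ 0.11 := by
  have hf : ∀ n : ℕ, 5 ≤ n → 0 ≤ (1 : ℝ) / ((n : ℝ) * (n - 1)) := by
    intro n hn
    have : (5 : ℝ) ≤ n := by exact_mod_cast hn
    apply div_nonneg zero_le_one
    nlinarith
  refine (sum_primesFromFive_split hf N).trans ?_
  have hT := sum_Ico_telescope_le (a := 49)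
    (f := fun j => (1 : ℝ) / (((2 * j + 1 : ℕ) : ℝ) * ((2 * j + 1 : ℕ) - 1)))
    (V := fun j => 1 / (2 * (2 * j - 1)))
    (fun j hj => by
      have : (49 : ℝ) ≤ j := by exact_mod_cast hj
      have h1 : (0 : ℝ) < 2 * j - 1 := by linarith
      have h2 : (1 : ℝ) / (2 * (2 * j - 1)) - 1 / (2 * (2 * (j + 1 : ℕ) - 1)) =
          1 / ((2 * j - 1) * (2 * j + 1)) := by
        push_cast
        have h3 : (2 * ((j : ℝ) + 1) - 1) = 2 * j + 1 := by ring
        rw [h3]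
        field_simp
        ring
      rw [h2]
      push_cast
      apply one_div_le_one_div_of_le (by positivity)
      nlinarith) (fun j hj => by
      have : (49 : ℝ) ≤ j := by exact_mod_cast hj
      apply div_nonneg <;> linarith) N
  refine (add_le_add le_rfl hT).trans ?_
  rw [primesFromFive_ninety_seven]
  repeat rw [Finset.sum_insert (by decide)]
  rw [Finset.sum_singleton]
  norm_num

lemma sum_log_div_pred_sq_le (N : ℕ) :
    ∑ p ∈ primesFromFive N, Real.log p / ((p : ℝ) - 1) ^ 2 ≤ 0.29 := by
  have hf : ∀ n : ℕ, 5 ≤ n → 0 ≤ Real.log n / ((n : ℝ) - 1) ^ 2 := by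
    intro n hn
    have : (5 : ℝ) ≤ n := by exact_mod_cast hn
    have := Real.log_nonneg (show (1 : ℝ) ≤ n by linarith)
    positivity
  refine (sum_primesFromFive_split hf N).trans ?_
  have hT := sum_Ico_telescope_le (a := 49)
    (f := fun j => Real.log (2 * j + 1 : ℕ) / (((2 * j + 1 : ℕ) : ℝ) - 1) ^ 2)
    (V := fun j => (99 / 98 : ℝ) * ((Real.log (2 * j - 1) + 1) / (2 * (2 * j - 1))))
    (fun j hj => by
      have h := log_div_telescope hj
      have h49 : (49 : ℝ) ≤ j := by exact_mod_cast hj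
      refine le_trans ?_ ((mul_le_mul_of_nonneg_left h (show (0 : ℝ) ≤ 99 / 98 by norm_num)).trans
        (le_of_eq (by ring)))
      have h1 := Real.log_nonneg (show (1 : ℝ) ≤ (2 * j + 1 : ℕ) by push_cast; linarith)
      push_cast at h1 ⊢
      rw [mul_div_assoc', div_le_div_iff₀ (by nlinarith) (by nlinarith)]
      have h2 : (2 * (j : ℝ) + 1) * (2 * j + 1 - 1) ≤ 99 / 98 * (2 * j + 1 - 1) ^ 2 := by nlinarith
      calc _ ≤ Real.log (2 * j + 1) * (99 / 98 * (2 * (j : ℝ) + 1 - 1) ^ 2) :=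
            mul_le_mul_of_nonneg_left h2 h1
        _ = _ := by ring)
    (fun j hj => by
      have : (49 : ℝ) ≤ j := by exact_mod_cast hj
      have := Real.log_nonneg (show (1 : ℝ) ≤ 2 * j - 1 by linarith)
      apply mul_nonneg (by norm_num)
      apply div_nonneg <;> linarith) N
  have hV : (99 / 98 : ℝ) * ((Real.log (2 * (49 : ℕ) - 1) + 1) / (2 * (2 * (49 : ℕ) - 1))) ≤
      0.0293 := by
    have := log_ninety_seven_le
    norm_num
    linarith
  have := hT.trans hV
  rw [primesFromFive_ninety_seven]
  have l5 := log_le_of_pow_le_two_pow (p := 5) (a := 70) (k := 30) (by norm_num) (by norm_num) (by norm_num)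
  have l7 := log_le_of_pow_le_two_pow (p := 7) (a := 85) (k := 30) (by norm_num) (by norm_num) (by norm_num)
  have l11 := log_le_of_pow_le_two_pow (p := 11) (a := 104) (k := 30) (by norm_num) (by norm_num) (by norm_num)
  have l13 := log_le_of_pow_le_two_pow (p := 13) (a := 112) (k := 30) (by norm_num) (by norm_num) (by norm_num)
  have l64 : ∀ p : ℕ, 0 < p → p ≤ 64 → Real.log p ≤ 4.16 := fun p h0 h => by
    have h1 : p ^ 1 ≤ 2 ^ 6 := by simpa using h
    have := log_le_of_pow_le_two_pow (a := 6) (by norm_num) h0 h1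
    norm_num at this
    linarith
  have l32 : ∀ p : ℕ, 0 < p → p ≤ 32 → Real.log p ≤ 3.466 := fun p h0 h => by
    have h1 : p ^ 1 ≤ 2 ^ 5 := by simpa using h
    have := log_le_of_pow_le_two_pow (a := 5) (by norm_num) h0 h1
    norm_num at this
    linarith
  have l97 : ∀ p : ℕ, 0 < p → p ≤ 97 → Real.log p ≤ 4.598 := fun p h0 h => by
    refine le_trans (Real.log_le_log (by exact_mod_cast h0) ?_) log_ninety_seven_le
    exact_mod_cast h
  have l17 := l32 17 (by norm_num) (by norm_num)
  have l19 := l32 19 (by norm_num) (by norm_num)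
  have l23 := l32 23 (by norm_num) (by norm_num)
  have l29 := l32 29 (by norm_num) (by norm_num)
  have l31 := l32 31 (by norm_num) (by norm_num)
  have l37 := l64 37 (by norm_num) (by norm_num)
  have l41 := l64 41 (by norm_num) (by norm_num)
  have l43 := l64 43 (by norm_num) (by norm_num)
  have l47 := l64 47 (by norm_num) (by norm_num)
  have l53 := l64 53 (by norm_num) (by norm_num)
  have l59 := l64 59 (by norm_num) (by norm_num)
  have l61 := l64 61 (by norm_num) (by norm_num)
  have l67 := l97 67 (by norm_num) (by norm_num)
  have l71 := l97 71 (by norm_num) (by norm_num)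
  have l73 := l97 73 (by norm_num) (by norm_num)
  have l79 := l97 79 (by norm_num) (by norm_num)
  have l83 := l97 83 (by norm_num) (by norm_num)
  have l89 := l97 89 (by norm_num) (by norm_num)
  have l97 := log_ninety_seven_le
  repeat rw [Finset.sum_insert (by decide)]
  rw [Finset.sum_singleton]
  norm_num at *
  linarith

lemma sum_two_div_pred_mul_sqrt_le (N : ℕ) :
    ∑ p ∈ primesFromFive N, (2 : ℝ) / ((p : ℝ) - 1) / √p ≤ 1.181 := by
  have hf : ∀ n : ℕ, 5 ≤ n → 0 ≤ (2 : ℝ) / ((n : ℝ) - 1) / √n := by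
    intro n hn
    have : (5 : ℝ) ≤ n := by exact_mod_cast hn
    exact div_nonneg (div_nonneg zero_le_two (by linarith)) (Real.sqrt_nonneg _)
  refine (sum_primesFromFive_split hf N).trans ?_
  have hT := sum_Ico_telescope_le (a := 49)
    (f := fun j => (2 : ℝ) / (((2 * j + 1 : ℕ) : ℝ) - 1) / √(2 * j + 1 : ℕ))
    (V := fun j => 2 / √(2 * j - 1))
    (fun j hj => by
      have h49 : (49 : ℝ) ≤ j := by exact_mod_cast hj
      have h1 : (2 * ((j : ℝ) + 1) - 1) = 2 * j + 1 := by ring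
      push_cast
      rw [h1]
      have ha := Real.sq_sqrt (show (0 : ℝ) ≤ 2 * j + 1 by linarith)
      have hb := Real.sq_sqrt (show (0 : ℝ) ≤ 2 * j - 1 by linarith)
      have ha0 := Real.sqrt_pos.2 (show (0 : ℝ) < 2 * j + 1 by linarith)
      have hb0 := Real.sqrt_pos.2 (show (0 : ℝ) < 2 * j - 1 by linarith)
      have hab := Real.sqrt_le_sqrt (show (2 : ℝ) * j - 1 ≤ 2 * j + 1 by linarith)
      set a := √(2 * (j : ℝ) + 1)
      set b := √(2 * (j : ℝ) - 1)
      have hj : 2 * (j : ℝ) + 1 - 1 = (a ^ 2 + b ^ 2) / 2 := by rw [ha, hb]; ring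
      rw [hj]
      have hd : (a - b) * (a + b) = 2 := by nlinarith
      have h3 : 2 / b - 2 / a = 2 * (a - b) / (a * b) := by field_simp
      have h2 : 2 / ((a ^ 2 + b ^ 2) / 2) / a = 2 * ((a - b) * (a + b)) / ((a ^ 2 + b ^ 2) * a) := by
        rw [hd]
        field_simp
      rw [h2, h3, div_le_div_iff₀ (by positivity) (by positivity)]
      have h4 : 0 ≤ a - b := by linarith
      have h5 : (a + b) * b ≤ a ^ 2 + b ^ 2 := by nlinarith
      have h6 := mul_le_mul_of_nonneg_left h5 (show 0 ≤ 2 * (a - b) * a by positivity)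
      linarith)
    (fun j hj => by positivity) N
  have hV : 2 / √(2 * (49 : ℕ) - 1) ≤ 0.2041 := by
    have h : (9.8 : ℝ) ≤ √97 := Real.le_sqrt_of_sq_le (by norm_num)
    have h2 : (2 * (49 : ℕ) - 1 : ℝ) = 97 := by norm_num
    rw [h2, div_le_iff₀ (by positivity)]
    linarith
  refine (add_le_add le_rfl (hT.trans hV)).trans ?_
  have h : ∑ p ∈ primesFromFive 97, (2 : ℝ) / ((p : ℝ) - 1) / √p ≤
      ∑ p ∈ primesFromFive 97, (2 : ℝ) / ((p : ℝ) - 1) / 2.2 := by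
    refine Finset.sum_le_sum fun p hp => ?_
    have hp5 : (5 : ℝ) ≤ p := by exact_mod_cast (mem_primesFromFive.1 hp).1
    refine div_le_div_of_nonneg_left (div_nonneg zero_le_two (by linarith)) (by norm_num) ?_
    exact Real.le_sqrt_of_sq_le (by norm_num; linarith)
  refine (add_le_add h le_rfl).trans ?_
  rw [primesFromFive_ninety_seven]
  repeat rw [Finset.sum_insert (by decide)]
  rw [Finset.sum_singleton]
  norm_num

lemma sum_coprime_six_log_div_le (n : ℕ) (hn : 1 ≤ n) : ∀ x : ℝ, n ≤ x →
    ∑ m ∈ (Finset.Icc 1 n).filter (fun m => m.Coprime 6), Real.log (x / m) ≤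
      x / 3 - 1 / 3 + 2 / 3 * Real.log x := by
  induction n, hn using Nat.le_induction with
  | base =>
    intro x hx
    have h : (Finset.Icc 1 1).filter (fun m => Nat.Coprime m 6) = {1} := by decide
    rw [h, Finset.sum_singleton]
    have hx' : (1 : ℝ) ≤ x := by simpa using hx
    have := Real.log_le_sub_one_of_pos (show 0 < x by linarith)
    norm_num
    linarith
  | succ n hn ih =>
    intro x hx
    have hn0 : (0 : ℝ) < (n + 1 : ℕ) := by positivity
    have hx0 : 0 < x := by linarith
    have h1 : ∑ m ∈ (Finset.Icc 1 (n + 1)).filter (fun m => Nat.Coprime m 6), Real.log (x / m) =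
        ∑ m ∈ (Finset.Icc 1 (n + 1)).filter (fun m => Nat.Coprime m 6),
          Real.log ((n + 1 : ℕ) / m) +
        ((Finset.Icc 1 (n + 1)).filter (fun m => Nat.Coprime m 6)).card *
          Real.log (x / (n + 1 : ℕ)) := by
      rw [← nsmul_eq_mul, ← Finset.sum_const, ← Finset.sum_add_distrib]
      refine Finset.sum_congr rfl fun m hm => ?_
      have hm0 : (0 : ℝ) < m := by
        exact_mod_cast (Finset.mem_Icc.1 (Finset.mem_filter.1 hm).1).1
      rw [Real.log_div hx0.ne' hm0.ne', Real.log_div hn0.ne' hm0.ne', Real.log_div hx0.ne' hn0.ne']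
      ring
    have h2 : ∑ m ∈ (Finset.Icc 1 (n + 1)).filter (fun m => Nat.Coprime m 6),
          Real.log ((n + 1 : ℕ) / m) =
        ∑ m ∈ (Finset.Icc 1 n).filter (fun m => Nat.Coprime m 6), Real.log ((n + 1 : ℕ) / m) := by
      rw [Finset.sum_filter, Finset.sum_filter, Finset.sum_Icc_succ_top (by omega)]
      rw [div_self hn0.ne', Real.log_one]
      simp
    have h3 := ih ((n + 1 : ℕ) : ℝ) (by push_cast; linarith)
    have h4 : (((Finset.Icc 1 (n + 1)).filter (fun m => Nat.Coprime m 6)).card : ℝ) ≤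
        ((n + 1 : ℕ) + 2) / 3 := by
      have h5 := card_coprime_six_Ioc_zero (n + 1)
      have h6 : Finset.Icc 1 (n + 1) = Finset.Ioc 0 (n + 1) := rfl
      rw [h6, h5, le_div_iff₀ (by norm_num)]
      have : ((n + 1 + 5) / 6 + (n + 1 + 1) / 6) * 3 ≤ n + 1 + 2 := by omega
      exact_mod_cast this
    have h7 : 0 ≤ Real.log (x / (n + 1 : ℕ)) :=
      Real.log_nonneg (by rw [le_div_iff₀ hn0]; linarith)
    have h8 := mul_le_mul_of_nonneg_right h4 h7
    have h9 : Real.log x = Real.log (n + 1 : ℕ) + Real.log (x / (n + 1 : ℕ)) := by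
      rw [Real.log_div hx0.ne' hn0.ne']
      ring
    have h10 := Real.log_le_sub_one_of_pos (show 0 < x / (n + 1 : ℕ) by positivity)
    have h11 := mul_le_mul_of_nonneg_left h10 hn0.le
    have h12 : ((n + 1 : ℕ) : ℝ) * (x / (n + 1 : ℕ) - 1) = x - (n + 1 : ℕ) := by
      field_simp
    rw [h1, h2]
    nlinarith

lemma exp_le_of_le_taylor {x : ℝ} (h0 : 0 ≤ x) (h1 : x ≤ 1) :
    Real.exp x ≤ 1 + x + x ^ 2 / 2 + x ^ 3 / 6 + x ^ 4 * (5 / 96) := by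
  have := Real.exp_bound' h0 h1 (n := 4) (by norm_num)
  norm_num [Finset.sum_range_succ, Nat.factorial] at this
  linarith

lemma sum_inv_totient_le (D : ℕ) :
    ∑ e ∈ sieveSet D, (Nat.totient e : ℝ)⁻¹ ≤
      1.117 * ∑ n ∈ (Finset.Icc 1 D).filter (fun n => n.Coprime 6), (1 : ℝ) / n := by
  set M := ∑ n ∈ (Finset.Icc 1 D).filter (fun n => n.Coprime 6), (1 : ℝ) / n with hM
  have hM0 : 0 ≤ M := Finset.sum_nonneg fun n _ => by positivity
  have hg : ∀ t ∈ sieveSet D, 0 ≤ ∏ p ∈ t.primeFactors, (1 : ℝ) / ((p : ℝ) - 1) := by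
    intro t _
    refine Finset.prod_nonneg fun p hp => ?_
    have : (2 : ℝ) ≤ p := by exact_mod_cast (Nat.prime_of_mem_primeFactors hp).two_le
    exact div_nonneg zero_le_one (by linarith)
  have h1 : ∀ e ∈ sieveSet D, (Nat.totient e : ℝ)⁻¹ =
      1 / e * ∑ t ∈ e.divisors, ∏ p ∈ t.primeFactors, (1 : ℝ) / ((p : ℝ) - 1) := by
    intro e he
    have hsq := (mem_sieveSet.1 he).2.1
    have he0 : (e : ℝ) ≠ 0 := by exact_mod_cast hsq.ne_zero
    rw [← prod_one_add_primeFactors hsq fun p => (1 : ℝ) / ((p : ℝ) - 1)]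
    have h2 : ∏ p ∈ e.primeFactors, (1 + (1 : ℝ) / ((p : ℝ) - 1)) =
        ∏ p ∈ e.primeFactors, (p : ℝ) / (p - 1) := by
      refine Finset.prod_congr rfl fun p hp => ?_
      have : (2 : ℝ) ≤ p := by exact_mod_cast (Nat.prime_of_mem_primeFactors hp).two_le
      have : (p : ℝ) - 1 ≠ 0 := by linarith
      field_simp
      ring
    rw [h2, prod_div_pred_eq hsq]
    field_simp
  rw [Finset.sum_congr rfl h1]
  refine (sum_mul_sum_divisors_le D (w := fun n => 1 / (n : ℝ)) (fun n _ _ => by positivity) hg).trans ?_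
  have h3 : ∀ t ∈ sieveSet D, (∏ p ∈ t.primeFactors, (1 : ℝ) / ((p : ℝ) - 1)) *
      ∑ m ∈ (Finset.Icc 1 (D / t)).filter (fun m => m.Coprime 6), 1 / ((t * m : ℕ) : ℝ) ≤
      (∏ p ∈ t.primeFactors, (1 : ℝ) / ((p : ℝ) * (p - 1))) * M := by
    intro t ht
    have hsq := (mem_sieveSet.1 ht).2.1
    have ht0 : (0 : ℝ) < t := by exact_mod_cast (mem_sieveSet.1 ht).1.1
    have h4 : ∏ p ∈ t.primeFactors, (1 : ℝ) / ((p : ℝ) * (p - 1)) =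
        (∏ p ∈ t.primeFactors, (1 : ℝ) / ((p : ℝ) - 1)) * (1 / t) := by
      have h5 : (1 : ℝ) / t = ∏ p ∈ t.primeFactors, 1 / (p : ℝ) := by
        rw [Finset.prod_div_distrib, ← Nat.cast_prod, Nat.prod_primeFactors_of_squarefree hsq,
          Finset.prod_const_one]
      rw [h5, ← Finset.prod_mul_distrib]
      refine Finset.prod_congr rfl fun p _ => ?_
      rw [div_mul_div_comm, mul_comm (p : ℝ), one_mul]
    rw [h4, mul_assoc]
    refine mul_le_mul_of_nonneg_left ?_ (hg t ht)
    rw [hM, Finset.mul_sum]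
    have h6 : (Finset.Icc 1 (D / t)).filter (fun m => m.Coprime 6) ⊆
        (Finset.Icc 1 D).filter (fun n => n.Coprime 6) :=
      Finset.filter_subset_filter _ (Finset.Icc_subset_Icc_right (Nat.div_le_self D t))
    refine (Finset.sum_le_sum fun m _ => le_of_eq ?_).trans
      (Finset.sum_le_sum_of_subset_of_nonneg h6 fun m _ _ => by positivity)
    push_cast
    rw [div_mul_div_comm, one_mul]
  refine (Finset.sum_le_sum h3).trans ?_
  rw [← Finset.sum_mul]
  refine mul_le_mul_of_nonneg_right ?_ hM0
  refine (sum_prod_primeFactors_le D (f := fun p => 1 / ((p : ℝ) * (p - 1))) fun p hp => ?_).trans ?_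
  · have : (5 : ℝ) ≤ p := by exact_mod_cast hp
    exact div_nonneg zero_le_one (by nlinarith)
  · refine (Real.exp_le_exp.2 (sum_inv_mul_pred_le D)).trans ?_
    refine (exp_le_of_le_taylor (by norm_num) (by norm_num)).trans (by norm_num)

lemma sum_inv_totient_filter_dvd_le {D p : ℕ} (hp : p.Prime) :
    ∑ e ∈ (sieveSet D).filter (p ∣ ·), (Nat.totient e : ℝ)⁻¹ ≤
      1 / ((p : ℝ) - 1) * ∑ e ∈ sieveSet D, (Nat.totient e : ℝ)⁻¹ := by
  have h1 : ∀ e ∈ (sieveSet D).filter (p ∣ ·), (Nat.totient e : ℝ)⁻¹ =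
      1 / ((p : ℝ) - 1) * (Nat.totient (e / p) : ℝ)⁻¹ := by
    intro e he
    obtain ⟨he, m, rfl⟩ := Finset.mem_filter.1 he
    have hsq := (mem_sieveSet.1 he).2.1
    have hc : p.Coprime m := Nat.coprime_of_squarefree_mul hsq
    rw [Nat.mul_div_cancel_left _ hp.pos, Nat.totient_mul hc, Nat.totient_prime hp]
    push_cast
    rw [Nat.cast_sub hp.one_lt.le, mul_inv, Nat.cast_one, one_div]
  rw [Finset.sum_congr rfl h1, ← Finset.mul_sum]
  have hp2 : (2 : ℝ) ≤ p := by exact_mod_cast hp.two_le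
  refine mul_le_mul_of_nonneg_left ?_ (div_nonneg zero_le_one (by linarith))
  have hinj : Set.InjOn (fun e => e / p) ((sieveSet D).filter (p ∣ ·) : Finset ℕ) := by
    intro a ha b hb hab
    have h2 := (Finset.mem_filter.1 (Finset.mem_coe.1 ha)).2
    have h3 := (Finset.mem_filter.1 (Finset.mem_coe.1 hb)).2
    have h4 : a / p = b / p := hab
    rw [← Nat.div_mul_cancel h2, ← Nat.div_mul_cancel h3, h4]
  rw [← Finset.sum_image (f := fun e => (Nat.totient e : ℝ)⁻¹) hinj]
  refine Finset.sum_le_sum_of_subset_of_nonneg ?_ fun _ _ _ => by positivity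
  intro m hm
  obtain ⟨e, he, rfl⟩ := Finset.mem_image.1 hm
  obtain ⟨he, hd⟩ := Finset.mem_filter.1 he
  exact mem_sieveSet_of_dvd he (Nat.div_dvd_of_dvd hd)

lemma sum_inv_totient_mul_sum_log_le (D : ℕ) :
    ∑ e ∈ sieveSet D, (Nat.totient e : ℝ)⁻¹ * ∑ p ∈ e.primeFactors, Real.log p / ((p : ℝ) - 1) ≤
      0.29 * ∑ e ∈ sieveSet D, (Nat.totient e : ℝ)⁻¹ := by
  have h0 : 0 ≤ ∑ e ∈ sieveSet D, (Nat.totient e : ℝ)⁻¹ :=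
    Finset.sum_nonneg fun _ _ => by positivity
  have h1 : ∑ e ∈ sieveSet D, (Nat.totient e : ℝ)⁻¹ *
      ∑ p ∈ e.primeFactors, Real.log p / ((p : ℝ) - 1) =
      ∑ p ∈ primesFromFive D, Real.log p / ((p : ℝ) - 1) *
        ∑ e ∈ (sieveSet D).filter (p ∣ ·), (Nat.totient e : ℝ)⁻¹ := by
    simp only [Finset.mul_sum]
    rw [Finset.sum_comm' (t' := primesFromFive D) (s' := fun p => (sieveSet D).filter (p ∣ ·))]
    · exact Finset.sum_congr rfl fun t _ => Finset.sum_congr rfl fun e _ => mul_comm _ _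
    · intro e p
      simp only [Finset.mem_filter]
      constructor
      · rintro ⟨h1, h2⟩
        exact ⟨⟨h1, Nat.dvd_of_mem_primeFactors h2⟩, primeFactors_subset_of_mem_sieveSet h1 h2⟩
      · rintro ⟨⟨h1, h2⟩, h3⟩
        exact ⟨h1, Nat.mem_primeFactors.2 ⟨(mem_primesFromFive.1 h3).2.2, h2, by
          have := (mem_sieveSet.1 h1).1; omega⟩⟩
  rw [h1]
  have h2 := mul_le_mul_of_nonneg_right (sum_log_div_pred_sq_le D) h0
  refine le_trans ?_ h2
  rw [Finset.sum_mul]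
  refine Finset.sum_le_sum fun p hp => ?_
  obtain ⟨h5, -, hp'⟩ := mem_primesFromFive.1 hp
  have h5' : (5 : ℝ) ≤ p := by exact_mod_cast h5
  have h3 := mul_le_mul_of_nonneg_left (sum_inv_totient_filter_dvd_le (D := D) hp')
    (show 0 ≤ Real.log p / ((p : ℝ) - 1) from
      div_nonneg (Real.log_nonneg (by linarith)) (by linarith))
  refine h3.trans (le_of_eq ?_)
  rw [← mul_assoc, div_mul_div_comm, mul_one, pow_two]

lemma sum_log_div_totient_mul_sigma_le {D : ℕ} (hD : 100000000 ≤ D) :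
    ∑ e ∈ sieveSet D, Real.log (D / e) / Nat.totient e * ∑ d ∈ e.divisors, (d : ℝ) ≤ 0.416 * D := by
  have hD0 : (100000000 : ℝ) ≤ D := by exact_mod_cast hD
  have hg : ∀ t ∈ sieveSet D, 0 ≤ ∏ p ∈ t.primeFactors, (2 : ℝ) / ((p : ℝ) - 1) := by
    intro t _
    refine Finset.prod_nonneg fun p hp => ?_
    have : (2 : ℝ) ≤ p := by exact_mod_cast (Nat.prime_of_mem_primeFactors hp).two_le
    exact div_nonneg zero_le_two (by linarith)
  have h1 : ∀ e ∈ sieveSet D, Real.log (D / e) / Nat.totient e * ∑ d ∈ e.divisors, (d : ℝ) =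
      Real.log (D / e) * ∑ t ∈ e.divisors, ∏ p ∈ t.primeFactors, (2 : ℝ) / ((p : ℝ) - 1) := by
    intro e he
    have hsq := (mem_sieveSet.1 he).2.1
    have he0 : (e : ℝ) ≠ 0 := by exact_mod_cast hsq.ne_zero
    have h2 : ∑ d ∈ e.divisors, (d : ℝ) = ∏ p ∈ e.primeFactors, (1 + (p : ℝ)) := by
      rw [prod_one_add_primeFactors hsq fun p => (p : ℝ)]
      refine Finset.sum_congr rfl fun d hd => ?_
      rw [← Nat.cast_prod, Nat.prod_primeFactors_of_squarefree
        (hsq.squarefree_of_dvd (Nat.dvd_of_mem_divisors hd))]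
    have h3 : ∏ p ∈ e.primeFactors, (1 + (2 : ℝ) / ((p : ℝ) - 1)) =
        (∏ p ∈ e.primeFactors, (1 + (p : ℝ))) * (∏ p ∈ e.primeFactors, (p : ℝ) / (p - 1)) *
          ∏ p ∈ e.primeFactors, 1 / (p : ℝ) := by
      rw [← Finset.prod_mul_distrib, ← Finset.prod_mul_distrib]
      refine Finset.prod_congr rfl fun p hp => ?_
      have : (2 : ℝ) ≤ p := by exact_mod_cast (Nat.prime_of_mem_primeFactors hp).two_le
      have : (p : ℝ) - 1 ≠ 0 := by linarith
      have : (p : ℝ) ≠ 0 := by linarith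
      field_simp
      ring
    have h5 : ∏ p ∈ e.primeFactors, 1 / (p : ℝ) = 1 / e := by
      rw [Finset.prod_div_distrib, ← Nat.cast_prod, Nat.prod_primeFactors_of_squarefree hsq,
        Finset.prod_const_one]
    rw [← prod_one_add_primeFactors hsq fun p => (2 : ℝ) / ((p : ℝ) - 1), h3, h2, h5,
      prod_div_pred_eq hsq]
    field_simp
  rw [Finset.sum_congr rfl h1]
  refine (sum_mul_sum_divisors_le D (w := fun n => Real.log (D / n)) (fun n h1 h2 => ?_) hg).trans ?_
  · have : (0 : ℝ) < n := by exact_mod_cast h1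
    apply Real.log_nonneg
    rw [le_div_iff₀ this, one_mul]
    exact_mod_cast h2
  have h3 : ∀ t ∈ sieveSet D, (∏ p ∈ t.primeFactors, (2 : ℝ) / ((p : ℝ) - 1)) *
      ∑ m ∈ (Finset.Icc 1 (D / t)).filter (fun m => m.Coprime 6), Real.log (D / (t * m : ℕ)) ≤
      D / 3 * (∏ p ∈ t.primeFactors, (2 : ℝ) / ((p : ℝ) * (p - 1))) +
      4 / 3 * √D * (∏ p ∈ t.primeFactors, (2 : ℝ) / ((p : ℝ) - 1) / √p) := by
    intro t ht
    obtain ⟨⟨ht1, htD⟩, hsq, -⟩ := mem_sieveSet.1 ht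
    have ht0 : (0 : ℝ) < t := by exact_mod_cast ht1
    have h4 : ∏ p ∈ t.primeFactors, (2 : ℝ) / ((p : ℝ) * (p - 1)) =
        (∏ p ∈ t.primeFactors, (2 : ℝ) / ((p : ℝ) - 1)) * (1 / t) := by
      have h5 : (1 : ℝ) / t = ∏ p ∈ t.primeFactors, 1 / (p : ℝ) := by
        rw [Finset.prod_div_distrib, ← Nat.cast_prod, Nat.prod_primeFactors_of_squarefree hsq,
          Finset.prod_const_one]
      rw [h5, ← Finset.prod_mul_distrib]
      refine Finset.prod_congr rfl fun p _ => ?_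
      rw [div_mul_div_comm, mul_comm (p : ℝ), mul_one]
    have h5 : ∏ p ∈ t.primeFactors, (2 : ℝ) / ((p : ℝ) - 1) / √p =
        (∏ p ∈ t.primeFactors, (2 : ℝ) / ((p : ℝ) - 1)) * (1 / √t) := by
      have h6 : ∏ p ∈ t.primeFactors, √(p : ℝ) = √t := by
        have h7 : (t : ℝ) = ∏ p ∈ t.primeFactors, (p : ℝ) := by
          rw [← Nat.cast_prod, Nat.prod_primeFactors_of_squarefree hsq]
        conv_rhs => rw [h7]
        rw [Real.sqrt_prod _ fun _ _ => Nat.cast_nonneg _]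
      rw [Finset.prod_div_distrib, h6, mul_one_div]
    have h6 : D / 3 * (∏ p ∈ t.primeFactors, (2 : ℝ) / ((p : ℝ) * (p - 1))) +
        4 / 3 * √D * (∏ p ∈ t.primeFactors, (2 : ℝ) / ((p : ℝ) - 1) / √p) =
        (∏ p ∈ t.primeFactors, (2 : ℝ) / ((p : ℝ) - 1)) * (D / t / 3 + 4 / 3 * √(D / t)) := by
      rw [h4, h5, Real.sqrt_div (by linarith)]
      ring
    rw [h6]
    refine mul_le_mul_of_nonneg_left ?_ (hg t ht)
    have hx : ((D / t : ℕ) : ℝ) ≤ (D : ℝ) / t := Nat.cast_div_le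
    have h7 := sum_coprime_six_log_div_le (D / t) (Nat.div_pos htD ht1) (D / t) hx
    have h8 : ∀ m ∈ (Finset.Icc 1 (D / t)).filter (fun m => m.Coprime 6),
        Real.log (D / (t * m : ℕ)) = Real.log ((D : ℝ) / t / m) := by
      intro m _
      push_cast
      rw [div_div]
    rw [Finset.sum_congr rfl h8]
    have hpos : 0 < (D : ℝ) / t := by positivity
    have h9 := Real.log_le_sub_one_of_pos (Real.sqrt_pos.2 hpos)
    rw [Real.log_sqrt hpos.le] at h9
    linarith
  refine (Finset.sum_le_sum h3).trans ?_
  rw [Finset.sum_add_distrib, ← Finset.mul_sum, ← Finset.mul_sum]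
  have hA : ∑ t ∈ sieveSet D, ∏ p ∈ t.primeFactors, (2 : ℝ) / ((p : ℝ) * (p - 1)) ≤ 1.2462 := by
    refine (sum_prod_primeFactors_le D (f := fun p => 2 / ((p : ℝ) * (p - 1)))
      fun p hp => ?_).trans ?_
    · have : (5 : ℝ) ≤ p := by exact_mod_cast hp
      exact div_nonneg zero_le_two (by nlinarith)
    · have h2 : ∑ p ∈ primesFromFive D, (2 : ℝ) / ((p : ℝ) * (p - 1)) ≤ 0.22 := by
        have := sum_inv_mul_pred_le D
        calc _ = 2 * ∑ p ∈ primesFromFive D, (1 : ℝ) / ((p : ℝ) * (p - 1)) := by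
              rw [Finset.mul_sum]
              exact Finset.sum_congr rfl fun p _ => by ring
          _ ≤ _ := by linarith
      refine (Real.exp_le_exp.2 h2).trans ?_
      exact (exp_le_of_le_taylor (by norm_num) (by norm_num)).trans (by norm_num)
  have hB : ∑ t ∈ sieveSet D, ∏ p ∈ t.primeFactors, (2 : ℝ) / ((p : ℝ) - 1) / √p ≤ 3.27 := by
    refine (sum_prod_primeFactors_le D (f := fun p => (2 : ℝ) / ((p : ℝ) - 1) / √p)
      fun p hp => ?_).trans ?_
    · have : (5 : ℝ) ≤ p := by exact_mod_cast hp
      exact div_nonneg (div_nonneg zero_le_two (by linarith)) (Real.sqrt_nonneg _)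
    · refine (Real.exp_le_exp.2 (sum_two_div_pred_mul_sqrt_le D)).trans ?_
      have h1 : (1.181 : ℝ) = 1 + 0.181 := by norm_num
      rw [h1, Real.exp_add]
      have h2 := Real.exp_one_lt_d9
      have h3 : Real.exp 0.181 ≤ 1.2 :=
        (exp_le_of_le_taylor (by norm_num) (by norm_num)).trans (by norm_num)
      calc _ ≤ 2.7182818286 * 1.2 :=
            mul_le_mul h2.le h3 (Real.exp_pos _).le (by norm_num)
        _ ≤ _ := by norm_num
  have hs : 10000 ≤ √(D : ℝ) := Real.le_sqrt_of_sq_le (by norm_num; linarith)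
  have hs2 := Real.sq_sqrt (show (0 : ℝ) ≤ D by linarith)
  have h4 := mul_le_mul_of_nonneg_left hA (show (0 : ℝ) ≤ D / 3 by linarith)
  have h5 := mul_le_mul_of_nonneg_left hB (show (0 : ℝ) ≤ 4 / 3 * √D by positivity)
  nlinarith

lemma large_range_polynomial_pos {Z X Y N₁ N₂ N₃ : ℝ} (hZ : 20.79 ≤ Z) (hX : Z - 1.61 ≤ X)
    (hX' : X ≤ Z - 1.609) (hY : Z - 3.402 ≤ Y)
    (h₁ : N₁ ≤ X + (Z - 2.707) ^ 2 / 6 + 0.324 * (1 + (Z - 2.707) / 3) + 0.001)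
    (h₂ : X ^ 2 + Y ^ 2 / 6 + Y ^ 3 / 9 ≤ N₂) (h₃ : X ^ 3 + Y ^ 3 / 6 + Y ^ 4 / 12 ≤ N₃) :
    0.0577 * Z ^ 2 < 0.772 / Z * N₃ + 0.0348 * N₂ - (0.307 * Z + 1.24) * N₁ := by
  have hZ0 : 0 < Z := by linarith
  have a1 : (Z - 1.61) ^ 3 + (Z - 3.402) ^ 3 / 6 + (Z - 3.402) ^ 4 / 12 ≤ N₃ := by
    have h1 := pow_le_pow_left₀ (by linarith) hX 3
    have h2 := pow_le_pow_left₀ (by linarith) hY 3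
    have h3 := pow_le_pow_left₀ (by linarith) hY 4
    linarith
  have a2 : (Z - 1.61) ^ 2 + (Z - 3.402) ^ 2 / 6 + (Z - 3.402) ^ 3 / 9 ≤ N₂ := by
    have h1 := pow_le_pow_left₀ (by linarith) hX 2
    have h2 := pow_le_pow_left₀ (by linarith) hY 2
    have h3 := pow_le_pow_left₀ (by linarith) hY 3
    linarith
  have a3 : N₁ ≤ Z - 1.609 + (Z - 2.707) ^ 2 / 6 + 0.324 * (1 + (Z - 2.707) / 3) + 0.001 := by
    linarith
  have b3 := mul_le_mul_of_nonneg_left a3 (show 0 ≤ Z * (0.307 * Z + 1.24) by positivity)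
  have b2 := mul_le_mul_of_nonneg_left a2 (show 0 ≤ 0.0348 * Z by positivity)
  have key : 0 < 0.772 * N₃ + 0.0348 * Z * N₂ - Z * (0.307 * Z + 1.24) * N₁ - 0.0577 * Z ^ 3 := by
    obtain ⟨t, ht, rfl⟩ : ∃ t : ℝ, 0 ≤ t ∧ Z = 20.79 + t := ⟨Z - 20.79, by linarith, by ring⟩
    have h2 := pow_nonneg ht 2
    have h3 := pow_nonneg ht 3
    have h4 := pow_nonneg ht 4
    norm_num at a1 b2 b3 ⊢
    ring_nf at a1 b2 b3 ⊢
    linarith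
  have h5 : 0.772 / Z * N₃ + 0.0348 * N₂ - (0.307 * Z + 1.24) * N₁ - 0.0577 * Z ^ 2 =
      (0.772 * N₃ + 0.0348 * Z * N₂ - Z * (0.307 * Z + 1.24) * N₁ - 0.0577 * Z ^ 3) / Z := by
    field_simp
  have := div_pos key hZ0
  linarith

lemma card_primesFromFive_add_two {n : ℕ} (hn : 5 ≤ n) :
    (primesFromFive n).card + 2 = Nat.primeCounting n := by
  have h : (Finset.range (n + 1)).filter Nat.Prime = insert 2 (insert 3 (primesFromFive n)) := by
    ext p
    simp only [Finset.mem_filter, Finset.mem_range, Finset.mem_insert, mem_primesFromFive]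
    constructor
    · rintro ⟨h1, hp⟩
      rcases lt_or_ge p 5 with h | h
      · interval_cases p <;> simp_all (decide := true)
      · exact Or.inr (Or.inr ⟨h, by omega, hp⟩)
    · rintro (rfl | rfl | ⟨h1, h2, h3⟩)
      · exact ⟨by omega, by norm_num⟩
      · exact ⟨by omega, by norm_num⟩
      · exact ⟨by omega, h3⟩
  rw [Nat.primeCounting, Nat.primeCounting', Nat.count_eq_card_filter_range, h,
    Finset.card_insert_of_notMem, Finset.card_insert_of_notMem]
  · simp [mem_primesFromFive]
  · simp [mem_primesFromFive]

lemma mul_log_primeCounting_ge {n : ℕ} (hn : 2 ≤ n) :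
    n * Real.log 2 - Real.log (n + 1) ≤ Nat.primeCounting n * Real.log n := by
  have h : (1 : ℝ) < n := by exact_mod_cast hn
  have := Chebyshev.pi_ge n
  rwa [div_le_iff₀ (Real.log_pos h)] at this

lemma sum_inv_totient_mul_log_le_of_large {D J : ℕ} (hDbig : 100000000 ≤ D) (hD : D = 6 * (J + 1)) :
    ∑ e ∈ sieveSet D, (Nat.totient e : ℝ)⁻¹ * Real.log (D / e) ≤
      Real.log D + Real.log (D / 3) ^ 2 / 6 + 0.324 * (1 + Real.log (D / 3) / 3) + 0.001 := by
  have hDR : (100000000 : ℝ) ≤ D := by exact_mod_cast hDbig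
  have hD0 : (0 : ℝ) < D := by linarith
  have hi : (1 : ℝ) / (D - 1) ≤ 0.0001 := by
    rw [div_le_iff₀ (by linarith)]
    linarith
  have hW0 : 0 ≤ Real.log (D / 3) := Real.log_nonneg (by linarith)
  have e1 := sum_inv_totient_mul_log_le D
  have e2 := sum_inv_totient_mul_sum_log_le D
  have e3 := sum_inv_totient_le D
  have e4 := sum_coprime_six_inv_mul_log_pow_le hD 0
  have e5 := sum_coprime_six_inv_mul_log_pow_le hD 1
  simp only [pow_zero, mul_one, pow_one, zero_add, Nat.cast_zero, Nat.cast_one, one_add_one_eq_two]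
    at e4 e5
  have e6 : Real.log (D / (D - 1)) ≤ 1 := by
    have h1 := Real.log_le_sub_one_of_pos (show (0 : ℝ) < D / (D - 1) from
      div_pos hD0 (by linarith))
    have h2 : (D : ℝ) / (D - 1) - 1 = 1 / (D - 1) := by
      rw [div_sub_one (by linarith)]
      ring
    linarith
  have e7 := mul_le_mul hi e6 (Real.log_nonneg (by rw [le_div_iff₀] <;> linarith)) (by norm_num)
  linarith

lemma mul_log_primeCounting_ge_of_large {r : ℕ} (hr : 2 ^ 30 ≤ r) :
    0.693 * (r : ℝ) ≤ Nat.primeCounting r * Real.log r := by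
  have hrR : (2 : ℝ) ^ 30 ≤ r := by exact_mod_cast hr
  have h1 := mul_log_primeCounting_ge (n := r) (by omega)
  have h2 : Real.log ((r : ℝ) + 1) ≤ 0.0001 * r := by
    have h3 := log_le_div_add (x := (r : ℝ) + 1) (c := 2 ^ 20) (by positivity) (by norm_num)
    rw [Real.log_pow] at h3
    have := Real.log_two_lt_d9
    norm_num at h3 ⊢
    have h4 : (1073741824 : ℝ) ≤ r := le_trans (by norm_num) hrR
    linarith
  have := Real.log_two_gt_d9
  nlinarith

lemma large_range_contradiction {T Z r Q Λ c : ℝ} (hT0 : 0 < T) (hr0 : 0 < r) (hΛ0 : 0 ≤ Λ)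
    (hΛ : Λ ≤ 0.0832 * r) (hcT : c ≤ T) (hTZ : 0.693 * r ≤ T * Z)
    (hQ : 0.0577 * Z ^ 2 < Q) (h : T ^ 3 * Q ≤ 4 * c * Λ ^ 2) : False := by
  have hΛ2 : Λ ^ 2 ≤ (0.0832 * r) ^ 2 := pow_le_pow_left₀ hΛ0 hΛ 2
  have hTZ2 : (0.693 * r) ^ 2 ≤ (T * Z) ^ 2 := pow_le_pow_left₀ (by positivity) hTZ 2
  have g1 : 4 * c * Λ ^ 2 ≤ 4 * T * (0.0832 * r) ^ 2 :=
    mul_le_mul (by linarith) hΛ2 (by positivity) (by positivity)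
  have g2 : T ^ 3 * (0.0577 * Z ^ 2) < T ^ 3 * Q := mul_lt_mul_of_pos_left hQ (by positivity)
  have g3 : T ^ 3 * (0.0577 * Z ^ 2) = T * (0.0577 * (T * Z) ^ 2) := by ring
  have g4 : T * (0.0577 * (0.693 * r) ^ 2) ≤ T * (0.0577 * (T * Z) ^ 2) :=
    mul_le_mul_of_nonneg_left (by linarith) hT0.le
  have g5 := mul_pos hT0 (pow_pos hr0 2)
  have g6 : T * (0.0577 * (0.693 * r) ^ 2) = 0.0577 * 0.693 ^ 2 * (T * r ^ 2) := by ring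
  have g7 : 4 * T * (0.0832 * r) ^ 2 = 4 * 0.0832 ^ 2 * (T * r ^ 2) := by ring
  have g8 : 4 * 0.0832 ^ 2 * (T * r ^ 2) < 0.0577 * 0.693 ^ 2 * (T * r ^ 2) :=
    mul_lt_mul_of_pos_right (by norm_num) g5
  linarith

lemma exists_rough_of_large {r : ℕ} (hr : 2 ^ 30 ≤ r) (a : ℕ) :
    ∃ n, a < n ∧ n ≤ a + Nat.primeCounting r ^ 3 ∧ ∀ p, p.Prime → p < r → ¬ p ∣ n := by
  by_contra hcon
  push Not at hcon
  set T := Nat.primeCounting r with hT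
  set P := primesFromFive r with hP
  have hcard : P.card + 2 = T := card_primesFromFive_add_two (by omega)
  obtain ⟨J, hJ⟩ : ∃ J, r / 30 = J + 1 := ⟨r / 30 - 1, by omega⟩
  obtain ⟨D, hD⟩ : ∃ D, D = 6 * (J + 1) := ⟨_, rfl⟩
  have hD1 : 5 * D ≤ r := by omega
  have hD2 : r < 5 * D + 30 := by omega
  have hDbig : 100000000 ≤ D := by omega
  have hmain := sieve_inequality (P := P)
    (fun p hp => ⟨(mem_primesFromFive.1 hp).2.2, (mem_primesFromFive.1 hp).1⟩) D a (T ^ 3) (by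
    intro n hn h6
    obtain ⟨h1, h2⟩ := Finset.mem_Ioc.1 hn
    obtain ⟨p, hp, hpr, hd⟩ := hcon n h1 h2
    refine ⟨p, mem_primesFromFive.2 ⟨?_, hpr.le, hp⟩, hd⟩
    have hc : p.Coprime 6 := Nat.Coprime.coprime_dvd_left hd h6
    by_contra h
    have h0 := hp.two_le
    have : p < 5 := by omega
    interval_cases p <;> revert hc hp <;> decide)
  have hrR : (2 : ℝ) ^ 30 ≤ r := by exact_mod_cast hr
  have hr0 : (0 : ℝ) < r := by linarith [show (0 : ℝ) < 2 ^ 30 by norm_num]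
  have hDR : (100000000 : ℝ) ≤ D := by exact_mod_cast hDbig
  have hD0 : (0 : ℝ) < D := by linarith
  have hD1R : 5 * (D : ℝ) ≤ r := by exact_mod_cast hD1
  have hD2R : (r : ℝ) ≤ 5 * D + 30 := by exact_mod_cast hD2.le
  set Z := Real.log r with hZ
  set X := Real.log D with hX
  have hZ0 : 20.79 ≤ Z := by
    have h1 := Real.log_le_log (by norm_num) hrR
    rw [Real.log_pow] at h1
    have := Real.log_two_gt_d9
    norm_num at h1
    linarith
  have hl5 : Real.log 5 ≤ 1.6096 := by
    have := log_le_of_pow_le_two_pow (p := 5) (a := 137) (k := 59) (by norm_num) (by norm_num)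
      (by norm_num)
    norm_num at this
    linarith
  have hl5' : 1.609 ≤ Real.log 5 := by
    have := log_ge_of_two_pow_le_pow (p := 5) (a := 65) (k := 28) (by norm_num) (by norm_num)
    norm_num at this
    linarith
  have hXu : X ≤ Z - 1.609 := by
    have h1 := Real.log_le_log (by linarith) hD1R
    rw [Real.log_mul (by norm_num) hD0.ne'] at h1
    linarith
  have hXl : Z - 1.61 ≤ X := by
    have h1 : (r : ℝ) ≤ 5 * D * (1 + 0.0001) := by linarith
    have h2 := Real.log_le_log hr0 h1
    rw [Real.log_mul (by positivity) (by norm_num), Real.log_mul (by norm_num) hD0.ne'] at h2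
    have h3 := Real.log_le_sub_one_of_pos (show (0 : ℝ) < 1 + 0.0001 by norm_num)
    linarith
  have hl3 := log_three_le
  have hl3' := log_three_ge_of_pow
  have hl6 : Real.log 6 ≤ 1.792 := by
    have h1 : (6 : ℝ) = 2 * 3 := by norm_num
    rw [h1, Real.log_mul (by norm_num) (by norm_num)]
    have := Real.log_two_lt_d9
    linarith
  have hY : Z - 3.402 ≤ Real.log (D / 6) := by
    rw [Real.log_div hD0.ne' (by norm_num)]
    linarith
  have hW : Real.log (D / 3) ≤ Z - 2.707 := by
    rw [Real.log_div hD0.ne' (by norm_num)]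
    linarith
  have hW0 : 0 ≤ Real.log (D / 3) := Real.log_nonneg (by linarith)
  set N₁ := ∑ e ∈ sieveSet D, (Nat.totient e : ℝ)⁻¹ * Real.log (D / e) with hN1
  set N₂ := ∑ e ∈ sieveSet D, (Nat.totient e : ℝ)⁻¹ * Real.log (D / e) ^ 2 with hN2
  set N₃ := ∑ e ∈ sieveSet D, (Nat.totient e : ℝ)⁻¹ * Real.log (D / e) ^ 3 with hN3
  have h₂ : X ^ 2 + Real.log (D / 6) ^ 2 / 6 + Real.log (D / 6) ^ 3 / 9 ≤ N₂ := by
    refine le_trans (le_of_eq ?_) ((le_sum_coprime_six_inv_mul_log_pow hD two_ne_zero).trans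
      (sum_inv_mul_log_pow_le D 2))
    norm_num [hX]
  have h₃ : X ^ 3 + Real.log (D / 6) ^ 3 / 6 + Real.log (D / 6) ^ 4 / 12 ≤ N₃ := by
    refine le_trans (le_of_eq ?_) ((le_sum_coprime_six_inv_mul_log_pow hD three_ne_zero).trans
      (sum_inv_mul_log_pow_le D 3))
    norm_num [hX]
  have h₁ : N₁ ≤ X + (Z - 2.707) ^ 2 / 6 + 0.324 * (1 + (Z - 2.707) / 3) + 0.001 := by
    have h := sum_inv_totient_mul_log_le_of_large hDbig hD
    have h2 := pow_le_pow_left₀ hW0 hW 2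
    linarith
  have hpoly := large_range_polynomial_pos hZ0 hXl hXu hY h₁ h₂ h₃
  have hQ : 0.772 / Z * N₃ + 0.0348 * N₂ - (0.307 * Z + 1.24) * N₁ ≤
      ∑ e ∈ sieveSet D, (Nat.totient e : ℝ)⁻¹ * (Real.log (D / e) ^ 2 -
        ∑ p ∈ P, (1 : ℝ) / p * (Real.log p ⊓ Real.log (D / e)) ^ 2) := by
    rw [hN1, hN2, hN3, Finset.mul_sum, Finset.mul_sum, Finset.mul_sum, ← Finset.sum_add_distrib,
      ← Finset.sum_sub_distrib]
    refine Finset.sum_le_sum fun e he => ?_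
    have he1 : (1 : ℝ) ≤ e := by exact_mod_cast (mem_sieveSet.1 he).1.1
    have hv0 := log_div_nonneg_of_mem_sieveSet he
    have hvr : Real.log (D / e) ≤ Real.log r := by
      apply Real.log_le_log (by positivity)
      rw [div_le_iff₀ (by linarith)]
      nlinarith
    have h1 := mul_le_mul_of_nonneg_left (primeMin_le_psi hr hv0 hvr)
      (show (0 : ℝ) ≤ (Nat.totient e : ℝ)⁻¹ by positivity)
    refine le_trans (le_of_eq ?_) h1
    ring
  have hΛ := sum_log_div_totient_mul_sigma_le hDbig
  set Q := ∑ e ∈ sieveSet D, (Nat.totient e : ℝ)⁻¹ * (Real.log (D / e) ^ 2 -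
        ∑ p ∈ P, (1 : ℝ) / p * (Real.log p ⊓ Real.log (D / e)) ^ 2)
  set Λ := ∑ e ∈ sieveSet D, Real.log (D / e) / Nat.totient e * ∑ d ∈ e.divisors, (d : ℝ)
  have hΛ0 : 0 ≤ Λ := Finset.sum_nonneg fun e he => by
    have := log_div_nonneg_of_mem_sieveSet he
    positivity
  have hTR : (P.card : ℝ) + 1 ≤ T := by
    have : P.card + 1 ≤ T := by omega
    exact_mod_cast this
  have hT0 : (0 : ℝ) < T := by
    have : 0 < T := by omega
    exact_mod_cast this
  push_cast at hmain
  exact large_range_contradiction hT0 hr0 hΛ0 (by linarith) hTR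
    (mul_log_primeCounting_ge_of_large hr) (lt_of_lt_of_le hpoly hQ) hmain

lemma abs_card_filter_dvd_sub_le (W : Finset ℕ) (hW : ∀ p ∈ W, p.Prime) (a N : ℕ) :
    ∀ m : ℕ, 0 < m → (∀ p ∈ W, ¬ p ∣ m) →
    |((((Finset.Ioc a (a + N)).filter (fun n => ∀ p ∈ W, ¬ p ∣ n)).filter (m ∣ ·)).card : ℝ) -
      N * (∏ p ∈ W, (1 - 1 / (p : ℝ))) / m| ≤ 2 ^ W.card := by
  induction W using Finset.induction_on with
  | empty =>
    intro m hm _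
    simp only [Finset.notMem_empty, false_imp_iff, implies_true, Finset.filter_true,
      Finset.prod_empty, Finset.card_empty, pow_zero, mul_one]
    have h := Nat.Ioc_filter_dvd_card_eq_div
    have h1 : ((Finset.Ioc a (a + N)).filter (m ∣ ·)).card = (a + N) / m - a / m := by
      have h2 := h (a + N) m
      have h3 := h a m
      have h4 : (Finset.Ioc 0 (a + N)).filter (m ∣ ·) =
          (Finset.Ioc 0 a).filter (m ∣ ·) ∪ (Finset.Ioc a (a + N)).filter (m ∣ ·) := by
        rw [← Finset.filter_union, Finset.Ioc_union_Ioc_eq_Ioc (by omega) (by omega)]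
      have h5 : Disjoint ((Finset.Ioc 0 a).filter (m ∣ ·)) ((Finset.Ioc a (a + N)).filter (m ∣ ·)) :=
        Finset.disjoint_filter_filter (Finset.disjoint_left.2 fun x hx hy => by
          simp only [Finset.mem_Ioc] at hx hy; omega)
      rw [h4, Finset.card_union_of_disjoint h5, h3] at h2
      omega
    rw [h1, Nat.cast_sub (Nat.div_le_div_right (by omega))]
    have hm0 : (0 : ℝ) < m := by exact_mod_cast hm
    have e1 := Nat.div_add_mod (a + N) m
    have e2 := Nat.div_add_mod a m
    have e3 := Nat.mod_lt (a + N) hm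
    have e4 := Nat.mod_lt a hm
    have e1' : (m : ℝ) * ((a + N) / m : ℕ) + ((a + N) % m : ℕ) = a + N := by exact_mod_cast e1
    have e2' : (m : ℝ) * (a / m : ℕ) + (a % m : ℕ) = a := by exact_mod_cast e2
    have e3' : (((a + N) % m : ℕ) : ℝ) < m := by exact_mod_cast e3
    have e4' : ((a % m : ℕ) : ℝ) < m := by exact_mod_cast e4
    have e5 : (0 : ℝ) ≤ ((a + N) % m : ℕ) := Nat.cast_nonneg _
    have e6 : (0 : ℝ) ≤ (a % m : ℕ) := Nat.cast_nonneg _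
    have e7 : (((a + N) / m : ℕ) : ℝ) - (a / m : ℕ) - N / m =
        ((a % m : ℕ) - ((a + N) % m : ℕ)) / m := by
      field_simp
      linarith
    rw [e7, abs_div, abs_of_pos hm0, div_le_one hm0, abs_le]
    constructor <;> linarith
  | insert q W hq ih =>
    intro m hm hm2
    have hW' : ∀ p ∈ W, p.Prime := fun p hp => hW p (Finset.mem_insert_of_mem hp)
    have hqp := hW q (Finset.mem_insert_self _ _)
    have hqm : ¬ q ∣ m := hm2 q (Finset.mem_insert_self _ _)
    have hc : Nat.Coprime q m := (Nat.Prime.coprime_iff_not_dvd hqp).2 hqm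
    have h1 := ih hW' m hm (fun p hp => hm2 p (Finset.mem_insert_of_mem hp))
    have h2 := ih hW' (q * m) (Nat.mul_pos hqp.pos hm) (fun p hp hd => by
      rcases (hW' p hp).dvd_mul.1 hd with h | h
      · rw [Nat.prime_dvd_prime_iff_eq (hW' p hp) hqp] at h
        exact hq (h ▸ hp)
      · exact hm2 p (Finset.mem_insert_of_mem hp) h)
    set s := (Finset.Ioc a (a + N)).filter (fun n => ∀ p ∈ W, ¬ p ∣ n) with hs
    have h3 : s.filter (m ∣ ·) =
        ((Finset.Ioc a (a + N)).filter (fun n => ∀ p ∈ insert q W, ¬ p ∣ n)).filter (m ∣ ·) ∪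
        s.filter (q * m ∣ ·) := by
      ext n
      simp only [hs, Finset.mem_filter, Finset.mem_union, Finset.forall_mem_insert]
      constructor
      · rintro ⟨⟨h4, h5⟩, h6⟩
        by_cases h7 : q ∣ n
        · exact Or.inr ⟨⟨h4, h5⟩, hc.mul_dvd_of_dvd_of_dvd h7 h6⟩
        · exact Or.inl ⟨⟨h4, h7, h5⟩, h6⟩
      · rintro (⟨⟨h4, h7, h5⟩, h6⟩ | ⟨⟨h4, h5⟩, h6⟩)
        · exact ⟨⟨h4, h5⟩, h6⟩
        · exact ⟨⟨h4, h5⟩, (Dvd.intro_left q rfl).trans h6⟩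
    have h4 : Disjoint
        (((Finset.Ioc a (a + N)).filter (fun n => ∀ p ∈ insert q W, ¬ p ∣ n)).filter (m ∣ ·))
        (s.filter (q * m ∣ ·)) := by
      refine Finset.disjoint_left.2 fun n hn hn2 => ?_
      simp only [Finset.mem_filter, Finset.forall_mem_insert] at hn hn2
      exact hn.1.2.1 ((Dvd.intro m rfl).trans hn2.2)
    have h5 := congrArg (fun t : Finset ℕ => (t.card : ℝ)) h3
    simp only [Finset.card_union_of_disjoint h4, Nat.cast_add] at h5
    rw [Finset.prod_insert hq, Finset.card_insert_of_notMem hq, pow_succ]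
    have hq0 : (q : ℝ) ≠ 0 := by exact_mod_cast hqp.ne_zero
    have hm0 : (m : ℝ) ≠ 0 := by exact_mod_cast hm.ne'
    push_cast at h2
    have h6 : (N : ℝ) * ((1 - 1 / (q : ℝ)) * ∏ p ∈ W, (1 - 1 / (p : ℝ))) / m =
        N * (∏ p ∈ W, (1 - 1 / (p : ℝ))) / m - N * (∏ p ∈ W, (1 - 1 / (p : ℝ))) / (q * m) := by
      field_simp
    rw [h6]
    rw [abs_le] at h1 h2 ⊢
    constructor <;> linarith

/-- `f` behaves on the multiples in `s` of any number coprime to `X` like a function of mean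
`μ`, with total mass `c` and error `E * K`. -/
def DivApprox (s : Finset ℕ) (c E : ℝ) (X : Finset ℕ) (f : ℕ → ℝ) (μ K : ℝ) : Prop :=
  ∀ m : ℕ, 0 < m → (∀ p ∈ X, ¬ p ∣ m) → |∑ n ∈ s.filter (m ∣ ·), f n - c * μ / m| ≤ E * K

lemma DivApprox.mono {s : Finset ℕ} {c E : ℝ} {X X' : Finset ℕ} {f : ℕ → ℝ} {μ K : ℝ}
    (h : DivApprox s c E X f μ K) (hX : X ⊆ X') : DivApprox s c E X' f μ K :=
  fun m hm hm2 => h m hm fun p hp => hm2 p (hX hp)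

lemma DivApprox.add {s : Finset ℕ} {c E : ℝ} {X : Finset ℕ} {f g : ℕ → ℝ} {μ ν K L : ℝ}
    (hf : DivApprox s c E X f μ K) (hg : DivApprox s c E X g ν L) :
    DivApprox s c E X (fun n => f n + g n) (μ + ν) (K + L) := by
  intro m hm hm2
  have h1 := hf m hm hm2
  have h2 := hg m hm hm2
  have h3 : c * (μ + ν) / m = c * μ / m + c * ν / m := by ring
  rw [Finset.sum_add_distrib, h3]
  rw [abs_le] at h1 h2 ⊢
  constructor <;> linarith

lemma DivApprox.sub {s : Finset ℕ} {c E : ℝ} {X : Finset ℕ} {f g : ℕ → ℝ} {μ ν K L : ℝ}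
    (hf : DivApprox s c E X f μ K) (hg : DivApprox s c E X g ν L) :
    DivApprox s c E X (fun n => f n - g n) (μ - ν) (K + L) := by
  intro m hm hm2
  have h1 := hf m hm hm2
  have h2 := hg m hm hm2
  have h3 : c * (μ - ν) / m = c * μ / m - c * ν / m := by ring
  rw [Finset.sum_sub_distrib, h3]
  rw [abs_le] at h1 h2 ⊢
  constructor <;> linarith

lemma divApprox_one {W : Finset ℕ} (hW : ∀ p ∈ W, p.Prime) (a N : ℕ) :
    DivApprox ((Finset.Ioc a (a + N)).filter (fun n => ∀ p ∈ W, ¬ p ∣ n))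
      (N * ∏ p ∈ W, (1 - 1 / (p : ℝ))) (2 ^ W.card) W (fun _ => 1) 1 1 := by
  intro m hm hm2
  have h := abs_card_filter_dvd_sub_le W hW a N m hm hm2
  simpa using h

/-- The elementary symmetric function of degree `k` of the reciprocals of `Y`. -/
noncomputable def esymmInv (k : ℕ) (Y : Finset ℕ) : ℝ :=
  ∑ S ∈ Y.powersetCard k, ∏ p ∈ S, (1 : ℝ) / p

lemma DivApprox.mul_choose {s : Finset ℕ} {c E : ℝ} {X Y : Finset ℕ} {f : ℕ → ℝ} {μ K : ℝ}
    (h : DivApprox s c E X f μ K) (hX : ∀ p ∈ X, p.Prime) (hY : ∀ p ∈ Y, p.Prime)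
    (hXY : Disjoint X Y) (k : ℕ) :
    DivApprox s c E (X ∪ Y) (fun n => f n * ((Y.filter (· ∣ n)).card.choose k : ℕ))
      (μ * esymmInv k Y) (K * (Y.card.choose k : ℕ)) := by
  intro m hm hm2
  have h1 : ∀ n, (((Y.filter (· ∣ n)).card.choose k : ℕ) : ℝ) =
      ∑ S ∈ Y.powersetCard k, if ∏ p ∈ S, p ∣ n then (1 : ℝ) else 0 := by
    intro n
    rw [← Finset.card_powersetCard, Finset.card_eq_sum_ones, Nat.cast_sum, ← Finset.sum_filter]
    refine Finset.sum_congr ?_ fun _ _ => by simp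
    ext S
    simp only [Finset.mem_powersetCard, Finset.mem_filter, Finset.subset_iff]
    constructor
    · rintro ⟨h2, h3⟩
      exact ⟨⟨fun p hp => (h2 hp).1, h3⟩, Finset.prod_primes_dvd n
        (fun p hp => (hY p (h2 hp).1).prime) fun p hp => (h2 hp).2⟩
    · rintro ⟨⟨h2, h3⟩, h4⟩
      exact ⟨fun p hp => ⟨h2 hp, (Finset.dvd_prod_of_mem _ hp).trans h4⟩, h3⟩
  have h2 : ∑ n ∈ s.filter (m ∣ ·), f n * ((Y.filter (· ∣ n)).card.choose k : ℕ) =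
      ∑ S ∈ Y.powersetCard k, ∑ n ∈ s.filter ((∏ p ∈ S, p) * m ∣ ·), f n := by
    simp only [h1, Finset.mul_sum]
    rw [Finset.sum_comm]
    refine Finset.sum_congr rfl fun S hS => ?_
    have hSY := (Finset.mem_powersetCard.1 hS).1
    simp only [mul_ite, mul_one, mul_zero]
    rw [← Finset.sum_filter, Finset.filter_filter]
    refine Finset.sum_congr (Finset.filter_congr fun n _ => ?_) fun _ _ => rfl
    have hc : Nat.Coprime (∏ p ∈ S, p) m := Nat.Coprime.prod_left fun p hp =>
      (Nat.Prime.coprime_iff_not_dvd (hY p (hSY hp))).2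
        (hm2 p (Finset.mem_union_right _ (hSY hp)))
    exact ⟨fun ⟨h3, h4⟩ => hc.mul_dvd_of_dvd_of_dvd h4 h3, fun h3 =>
      ⟨(Dvd.intro_left _ rfl).trans h3, (Dvd.intro _ rfl).trans h3⟩⟩
  have h3 : c * (μ * esymmInv k Y) / m =
      ∑ S ∈ Y.powersetCard k, c * μ / ((∏ p ∈ S, p) * m : ℕ) := by
    rw [esymmInv, Finset.mul_sum, Finset.mul_sum, Finset.sum_div]
    refine Finset.sum_congr rfl fun S _ => ?_
    rw [Finset.prod_div_distrib, Finset.prod_const_one]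
    push_cast
    rw [mul_one_div, mul_div_assoc', div_div]
  rw [h2, h3, ← Finset.sum_sub_distrib]
  refine (Finset.abs_sum_le_sum_abs _ _).trans ?_
  have h4 : ∀ S ∈ Y.powersetCard k,
      |∑ n ∈ s.filter ((∏ p ∈ S, p) * m ∣ ·), f n - c * μ / ((∏ p ∈ S, p) * m : ℕ)| ≤ E * K := by
    intro S hS
    have hSY := (Finset.mem_powersetCard.1 hS).1
    refine h _ (Nat.mul_pos (Finset.prod_pos fun p hp => (hY p (hSY hp)).pos) hm) fun p hp hd => ?_
    rcases (hX p hp).dvd_mul.1 hd with h5 | h5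
    · obtain ⟨q, hq, hpq⟩ := (Prime.dvd_finsetProd_iff (hX p hp).prime _).1 h5
      rw [Nat.prime_dvd_prime_iff_eq (hX p hp) (hY q (hSY hq))] at hpq
      exact Finset.disjoint_left.1 hXY hp (hpq ▸ hSY hq)
    · exact hm2 p (Finset.mem_union_left _ hp) h5
  refine (Finset.sum_le_card_nsmul _ _ _ h4).trans (le_of_eq ?_)
  rw [Finset.card_powersetCard, nsmul_eq_mul]
  ring

lemma esymmInv_zero (Y : Finset ℕ) : esymmInv 0 Y = 1 := by simp [esymmInv]

lemma esymmInv_insert {q : ℕ} {Y : Finset ℕ} (hq : q ∉ Y) (k : ℕ) :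
    esymmInv (k + 1) (insert q Y) = esymmInv (k + 1) Y + 1 / q * esymmInv k Y := by
  rw [esymmInv, esymmInv, esymmInv, Finset.powersetCard_succ_insert hq, Finset.sum_union,
    Finset.sum_image, Finset.mul_sum]
  · congr 1
    refine Finset.sum_congr rfl fun S hS => ?_
    rw [Finset.prod_insert fun h => hq ((Finset.mem_powersetCard.1 hS).1 h)]
  · intro S hS T hT hST
    have h1 : q ∉ S := fun h => hq ((Finset.mem_powersetCard.1 hS).1 h)
    have h2 : q ∉ T := fun h => hq ((Finset.mem_powersetCard.1 hT).1 h)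
    rw [← Finset.erase_insert h1, ← Finset.erase_insert h2, hST]
  · refine Finset.disjoint_left.2 fun S hS hS2 => ?_
    obtain ⟨T, _, rfl⟩ := Finset.mem_image.1 hS2
    exact hq ((Finset.mem_powersetCard.1 hS).1 (Finset.mem_insert_self _ _))

lemma esymmInv_one (Y : Finset ℕ) : esymmInv 1 Y = ∑ p ∈ Y, (1 : ℝ) / p := by
  induction Y using Finset.induction_on with
  | empty => rw [esymmInv, Finset.powersetCard_eq_empty.2 (by simp)]; simp
  | insert q Y hq ih => rw [esymmInv_insert hq, ih, esymmInv_zero, Finset.sum_insert hq]; ring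

lemma esymmInv_two (Y : Finset ℕ) :
    esymmInv 2 Y = ((∑ p ∈ Y, (1 : ℝ) / p) ^ 2 - ∑ p ∈ Y, (1 : ℝ) / p ^ 2) / 2 := by
  induction Y using Finset.induction_on with
  | empty => rw [esymmInv, Finset.powersetCard_eq_empty.2 (by simp)]; simp
  | insert q Y hq ih =>
    rw [esymmInv_insert hq, ih, esymmInv_one, Finset.sum_insert hq, Finset.sum_insert hq]
    ring

lemma esymmInv_three_le (Y : Finset ℕ) : esymmInv 3 Y ≤ (∑ p ∈ Y, (1 : ℝ) / p) ^ 3 / 6 := by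
  induction Y using Finset.induction_on with
  | empty => rw [esymmInv, Finset.powersetCard_eq_empty.2 (by simp)]; simp
  | insert q Y hq ih =>
    rw [esymmInv_insert hq, esymmInv_two, Finset.sum_insert hq]
    have h1 : 0 ≤ ∑ p ∈ Y, (1 : ℝ) / p ^ 2 := Finset.sum_nonneg fun _ _ => by positivity
    have h2 : 0 ≤ ∑ p ∈ Y, (1 : ℝ) / p := Finset.sum_nonneg fun _ _ => by positivity
    have h3 : 0 ≤ (1 : ℝ) / q := by positivity
    have h4 := mul_nonneg h3 h1
    have h5 := mul_nonneg (pow_nonneg h3 2) h2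
    have h6 := pow_nonneg h3 3
    nlinarith

/-- The number of members of `Y` dividing `n`. -/
def dvdCount (Y : Finset ℕ) (n : ℕ) : ℕ := (Y.filter (· ∣ n)).card

/-- The truncated inclusion-exclusion weight `1 - ω + ω(ω-1)/2`. -/
noncomputable def bonferroni (Y : Finset ℕ) (n : ℕ) : ℝ :=
  1 - dvdCount Y n + ((dvdCount Y n).choose 2 : ℕ)

lemma DivApprox.mul_bonferroni {s : Finset ℕ} {c E : ℝ} {X Y : Finset ℕ} {f : ℕ → ℝ} {μ K : ℝ}
    (h : DivApprox s c E X f μ K) (hX : ∀ p ∈ X, p.Prime) (hY : ∀ p ∈ Y, p.Prime)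
    (hXY : Disjoint X Y) :
    DivApprox s c E (X ∪ Y) (fun n => f n * bonferroni Y n)
      (μ * (1 - esymmInv 1 Y + esymmInv 2 Y)) (K * (1 + Y.card + (Y.card.choose 2 : ℕ))) := by
  have h0 := (h.mono (Finset.subset_union_left (s₂ := Y))).sub (h.mul_choose hX hY hXY 1)
  have h1 := h0.add (h.mul_choose hX hY hXY 2)
  have e1 : (fun n => f n * bonferroni Y n) = fun n => f n -
      f n * ((Y.filter (· ∣ n)).card.choose 1 : ℕ) +
      f n * ((Y.filter (· ∣ n)).card.choose 2 : ℕ) := by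
    funext n
    rw [bonferroni, dvdCount, Nat.choose_one_right]
    ring
  have e2 : μ * (1 - esymmInv 1 Y + esymmInv 2 Y) =
      μ - μ * esymmInv 1 Y + μ * esymmInv 2 Y := by ring
  have e3 : K * (1 + Y.card + (Y.card.choose 2 : ℕ)) =
      K + K * (Y.card.choose 1 : ℕ) + K * (Y.card.choose 2 : ℕ) := by
    rw [Nat.choose_one_right]
    ring
  rw [e1, e2, e3]
  exact h1

lemma one_sub_add_choose_two_nonneg (a : ℕ) : (0 : ℝ) ≤ 1 - a + (a.choose 2 : ℕ) := by
  rw [Nat.cast_choose_two]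
  rcases Nat.lt_or_ge a 3 with h | h
  · interval_cases a <;> norm_num
  · have : (3 : ℝ) ≤ a := by exact_mod_cast h
    nlinarith

lemma one_sub_add_choose_two_le {a : ℕ} (ha : 1 ≤ a) :
    (1 : ℝ) - a + (a.choose 2 : ℕ) ≤ (a.choose 3 : ℕ) := by
  induction a, ha using Nat.le_induction with
  | base => norm_num
  | succ n hn ih =>
    rw [Nat.choose_succ_succ' n 2, Nat.choose_succ_succ' n 1, Nat.choose_one_right]
    push_cast
    have h : (1 : ℝ) ≤ n := by exact_mod_cast hn
    have h2 := one_sub_add_choose_two_nonneg n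
    linarith

lemma bonferroni_nonneg (Y : Finset ℕ) (n : ℕ) : 0 ≤ bonferroni Y n :=
  one_sub_add_choose_two_nonneg _

lemma dvdCount_eq_zero {Y : Finset ℕ} {n : ℕ} (h : dvdCount Y n = 0) : ∀ p ∈ Y, ¬ p ∣ n := by
  intro p hp hd
  rw [dvdCount, Finset.card_eq_zero] at h
  exact Finset.notMem_empty p (h ▸ Finset.mem_filter.2 ⟨hp, hd⟩)

lemma lt_of_block_weight_pos {u v b c p : ℝ} (hu : 0 ≤ u) (hv : 0 ≤ v) (hb : 0 ≤ b) (hc : 0 ≤ c)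
    (hp : 0 ≤ p) (h : 0 < 1 * u * v - 1 * u * v * p - 1 * u * c - 1 * b * v) :
    b < u ∧ c < v ∧ p < 1 := by
  have h1 := mul_nonneg (mul_nonneg hu hv) hp
  have h2 := mul_nonneg hu hc
  have h3 := mul_nonneg hb hv
  refine ⟨?_, ?_, ?_⟩
  · by_contra! hcon
    linarith [mul_nonneg (sub_nonneg.2 hcon) hv]
  · by_contra! hcon
    linarith [mul_nonneg hu (sub_nonneg.2 hcon)]
  · by_contra! hcon
    linarith [mul_nonneg (mul_nonneg hu hv) (sub_nonneg.2 hcon)]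

/-- A lower bound sieve of Hooley type with four blocks of primes. -/
lemma exists_forall_not_dvd_of_blocks {W R Q P : Finset ℕ} (hW : ∀ p ∈ W, p.Prime)
    (hR : ∀ p ∈ R, p.Prime) (hQ : ∀ p ∈ Q, p.Prime) (hP : ∀ p ∈ P, p.Prime)
    (hWR : Disjoint W R) (hWQ : Disjoint W Q) (hRQ : Disjoint R Q)
    (hRP : Disjoint (W ∪ R ∪ Q) P) (a N : ℕ)
    (h : (2 : ℝ) ^ W.card *
        ((1 + P.card) * (1 + R.card + (R.card.choose 2 : ℕ)) * (1 + Q.card + (Q.card.choose 2 : ℕ)) +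
          (1 + R.card + (R.card.choose 2 : ℕ)) * (Q.card.choose 3 : ℕ) +
          (R.card.choose 3 : ℕ) * (1 + Q.card + (Q.card.choose 2 : ℕ))) <
      N * (∏ p ∈ W, (1 - 1 / (p : ℝ))) *
        ((1 - esymmInv 1 P) * (1 - esymmInv 1 R + esymmInv 2 R) * (1 - esymmInv 1 Q + esymmInv 2 Q) -
          (1 - esymmInv 1 R + esymmInv 2 R) * esymmInv 3 Q -
          esymmInv 3 R * (1 - esymmInv 1 Q + esymmInv 2 Q))) :
    ∃ n, a < n ∧ n ≤ a + N ∧ ∀ p ∈ W ∪ R ∪ Q ∪ P, ¬ p ∣ n := by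
  have u1 : ∀ p ∈ W ∪ R, p.Prime := fun p hp => (Finset.mem_union.1 hp).elim (hW p) (hR p)
  have u2 : ∀ p ∈ W ∪ R ∪ Q, p.Prime := fun p hp => (Finset.mem_union.1 hp).elim (u1 p) (hQ p)
  have d1 : Disjoint (W ∪ R) Q := Finset.disjoint_union_left.2 ⟨hWQ, hRQ⟩
  have h0 := divApprox_one hW a N
  have h1 := h0.mul_bonferroni hW hR hWR
  have h2 := h1.mul_bonferroni u1 hQ d1
  have h3 := h2.mul_choose u2 hP hRP 1
  have h4 := h1.mul_choose u1 hQ d1 3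
  have h5 := (h0.mul_choose hW hR hWR 3).mul_bonferroni u1 hQ d1
  have s1 : W ∪ R ∪ Q ⊆ W ∪ R ∪ Q ∪ P := Finset.subset_union_left
  have h6 := (((h2.mono s1).sub h3).sub (h4.mono s1)).sub (h5.mono s1)
  have h7 := h6 1 one_pos fun p hp hd => by
    rcases Finset.mem_union.1 hp with hp' | hp'
    · exact (u2 p hp').one_lt.ne' (Nat.dvd_one.1 hd)
    · exact (hP p hp').one_lt.ne' (Nat.dvd_one.1 hd)
  have h8 := (abs_le.1 h7).1
  obtain ⟨n, hn, hpos⟩ : ∃ n ∈ ((Finset.Ioc a (a + N)).filter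
      (fun n => ∀ p ∈ W, ¬ p ∣ n)).filter (1 ∣ ·), 0 <
      1 * bonferroni R n * bonferroni Q n -
        1 * bonferroni R n * bonferroni Q n * ((P.filter (· ∣ n)).card.choose 1 : ℕ) -
        1 * bonferroni R n * ((Q.filter (· ∣ n)).card.choose 3 : ℕ) -
        1 * ((R.filter (· ∣ n)).card.choose 3 : ℕ) * bonferroni Q n := by
    by_contra hcon
    push Not at hcon
    have h9 := Finset.sum_nonpos hcon
    simp only [Nat.choose_one_right] at h8 h9
    simp only [Nat.cast_one, div_one] at h8
    nlinarith
  refine ⟨n, ?_⟩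
  simp only [Finset.mem_filter, Finset.mem_Ioc] at hn
  obtain ⟨⟨⟨hn1, hn2⟩, hn3⟩, -⟩ := hn
  have bR := bonferroni_nonneg R n
  have bQ := bonferroni_nonneg Q n
  have cR : (0 : ℝ) ≤ ((R.filter (· ∣ n)).card.choose 3 : ℕ) := Nat.cast_nonneg _
  have cQ : (0 : ℝ) ≤ ((Q.filter (· ∣ n)).card.choose 3 : ℕ) := Nat.cast_nonneg _
  have cP : (0 : ℝ) ≤ ((P.filter (· ∣ n)).card : ℕ) := Nat.cast_nonneg _
  rw [Nat.choose_one_right] at hpos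
  obtain ⟨g1, g2, g3⟩ := lt_of_block_weight_pos bR bQ cR cQ cP hpos
  have zR : dvdCount R n = 0 := by
    by_contra hc
    exact g1.not_ge (one_sub_add_choose_two_le (Nat.one_le_iff_ne_zero.2 hc))
  have zQ : dvdCount Q n = 0 := by
    by_contra hc
    exact g2.not_ge (one_sub_add_choose_two_le (Nat.one_le_iff_ne_zero.2 hc))
  have zP : dvdCount P n = 0 := by
    rw [dvdCount]
    have h9 : (P.filter (· ∣ n)).card < 1 := by exact_mod_cast g3
    omega
  refine ⟨hn1, hn2, fun p hp => ?_⟩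
  simp only [Finset.mem_union] at hp
  rcases hp with ((hp | hp) | hp) | hp
  · exact hn3 p hp
  · exact dvdCount_eq_zero zR p hp
  · exact dvdCount_eq_zero zQ p hp
  · exact dvdCount_eq_zero zP p hp

/-- The primes in the interval `(a, b]`. -/
def primesIoc (a b : ℕ) : Finset ℕ := (Finset.Ioc a b).filter Nat.Prime

lemma mem_primesIoc {a b p : ℕ} : p ∈ primesIoc a b ↔ a < p ∧ p ≤ b ∧ p.Prime := by
  simp [primesIoc, and_assoc]

/-- Upper bounds for the number of primes in `(a, b]`, the sum of their reciprocals and the sum of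
the squares of their reciprocals. -/
structure BlockBound (a b n : ℕ) (x s : ℝ) : Prop where
  card_le : (primesIoc a b).card ≤ n
  sum_le : ∑ p ∈ primesIoc a b, (1 : ℝ) / p ≤ x
  sum_sq_le : ∑ p ∈ primesIoc a b, (1 : ℝ) / p ^ 2 ≤ s

lemma disjoint_primesIoc {a b c d : ℕ} (h : b ≤ c) :
    Disjoint (primesIoc a b) (primesIoc c d) := by
  rw [Finset.disjoint_left]
  intro p hp hq
  rw [mem_primesIoc] at hp hq
  omega

lemma primesIoc_union {a b c : ℕ} (h1 : a ≤ b) (h2 : b ≤ c) :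
    primesIoc a b ∪ primesIoc b c = primesIoc a c := by
  rw [primesIoc, primesIoc, ← Finset.filter_union, Finset.Ioc_union_Ioc_eq_Ioc h1 h2, primesIoc]

lemma BlockBound.refl (a : ℕ) : BlockBound a a 0 0 0 := by
  constructor <;> simp [primesIoc]

lemma BlockBound.trans {a b c n m : ℕ} {x s y t : ℝ} (h : BlockBound a b n x s)
    (h' : BlockBound b c m y t) (h1 : a ≤ b := by norm_num) (h2 : b ≤ c := by norm_num) :
    BlockBound a c (n + m) (x + y) (s + t) := by
  have hd := disjoint_primesIoc (a := a) (d := c) (le_refl b)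
  constructor <;> rw [← primesIoc_union h1 h2]
  · rw [Finset.card_union_of_disjoint hd]
    exact add_le_add h.card_le h'.card_le
  · rw [Finset.sum_union hd]
    exact add_le_add h.sum_le h'.sum_le
  · rw [Finset.sum_union hd]
    exact add_le_add h.sum_sq_le h'.sum_sq_le

lemma sieve_main_term_mono {l L u v u' v' c d c' d' : ℝ} (hl : l ≤ L) (hL : L ≤ 1)
    (hu : 0 < u) (hv : 0 < v) (huu : u ≤ u') (hvv : v ≤ v') (hc : c' ≤ c) (hd : d' ≤ d)
    (hc0 : 0 ≤ c') (hd0 : 0 ≤ d') (h : 0 < (1 - L) * u * v - u * d - c * v) :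
    (1 - L) * u * v - u * d - c * v ≤ (1 - l) * u' * v' - u' * d' - c' * v' := by
  have k1 : 0 ≤ (1 - L) * v - d := by
    by_contra! hcon
    nlinarith [mul_pos hu (neg_pos.2 hcon), mul_nonneg (hc0.trans hc) hv.le]
  have k2 : 0 ≤ (1 - L) * u - c := by
    by_contra! hcon
    nlinarith [mul_pos hv (neg_pos.2 hcon), mul_nonneg (hd0.trans hd) hu.le]
  have k3 : 0 ≤ (1 - L) * u' - c := by
    nlinarith [mul_nonneg (sub_nonneg.2 hL) (sub_nonneg.2 huu)]
  have e1 := mul_nonneg k1 (sub_nonneg.2 huu)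
  have e2 := mul_nonneg k3 (sub_nonneg.2 hvv)
  have e3 := mul_nonneg (sub_nonneg.2 hl) (mul_pos (hu.trans_le huu) (hv.trans_le hvv)).le
  have e4 := mul_nonneg (hu.trans_le huu).le (sub_nonneg.2 hd)
  have e5 := mul_nonneg (sub_nonneg.2 hc) (hv.trans_le hvv).le
  linarith

lemma mul_add_lt_pow_three_mul {T₀ T y a b : ℝ} (hT : 0 < T₀) (hTT : T₀ ≤ T) (ha : 0 ≤ a)
    (hb : 0 ≤ b) (h : T₀ * a + b < T₀ ^ 3 * y) : T * a + b < T ^ 3 * y := by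
  have hy : 0 < y := by
    by_contra! hcon
    have := mul_nonneg (pow_pos hT 3).le (neg_nonneg.2 hcon)
    nlinarith [mul_nonneg hT.le ha]
  have h1 : T * (T₀ * a + b) < T * (T₀ ^ 3 * y) := mul_lt_mul_of_pos_left h (hT.trans_le hTT)
  have h2 : T₀ * (T * a + b) ≤ T * (T₀ * a + b) := by
    nlinarith [mul_nonneg (sub_nonneg.2 hTT) hb]
  have h3 : T * (T₀ ^ 3 * y) ≤ T₀ * (T ^ 3 * y) := by
    have h4 : T₀ ^ 2 ≤ T ^ 2 := pow_le_pow_left₀ hT.le hTT 2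
    have h5 := mul_le_mul_of_nonneg_left h4 (mul_pos (mul_pos hT (hT.trans_le hTT)) hy).le
    nlinarith
  exact lt_of_mul_lt_mul_left (h2.trans_lt (h1.trans_le h3)) hT.le

lemma cast_choose_three (n : ℕ) : ((n.choose 3 : ℕ) : ℝ) = n * (n - 1) * (n - 2) / 6 := by
  induction n with
  | zero => norm_num
  | succ n ih =>
    rw [Nat.choose_succ_succ' n 2, Nat.cast_add, ih, Nat.cast_choose_two]
    push_cast
    ring

lemma esymmInv_nonneg (k : ℕ) (Y : Finset ℕ) : 0 ≤ esymmInv k Y :=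
  Finset.sum_nonneg fun _ _ => Finset.prod_nonneg fun _ _ => by positivity

lemma BlockBound.main_le {a b n : ℕ} {x s : ℝ} (h : BlockBound a b n x s) (hx : x ≤ 1) :
    1 - x + (x ^ 2 - s) / 2 ≤ 1 - esymmInv 1 (primesIoc a b) + esymmInv 2 (primesIoc a b) := by
  rw [esymmInv_one, esymmInv_two]
  have h1 := h.sum_le
  have h2 := h.sum_sq_le
  nlinarith [mul_nonneg (sub_nonneg.2 h1) (sub_nonneg.2 (h1.trans hx)),
    mul_nonneg (sub_nonneg.2 h1) (sub_nonneg.2 hx)]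

lemma BlockBound.three_le {a b n : ℕ} {x s : ℝ} (h : BlockBound a b n x s) :
    esymmInv 3 (primesIoc a b) ≤ x ^ 3 / 6 := by
  refine (esymmInv_three_le _).trans ?_
  have h0 : 0 ≤ ∑ p ∈ primesIoc a b, (1 : ℝ) / p := Finset.sum_nonneg fun _ _ => by positivity
  have := pow_le_pow_left₀ h0 h.sum_le 3
  linarith

lemma BlockBound.level_le {a b n : ℕ} {x s : ℝ} (h : BlockBound a b n x s) :
    (1 : ℝ) + (primesIoc a b).card + ((primesIoc a b).card.choose 2 : ℕ) ≤
      1 + n + n * (n - 1) / 2 := by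
  rw [← Nat.cast_choose_two]
  have h1 := h.card_le
  have h2 := Nat.choose_le_choose 2 h1
  have h1' : ((primesIoc a b).card : ℝ) ≤ n := by exact_mod_cast h1
  have h2' : (((primesIoc a b).card.choose 2 : ℕ) : ℝ) ≤ (n.choose 2 : ℕ) := by exact_mod_cast h2
  linarith

lemma BlockBound.choose_three_le {a b n : ℕ} {x s : ℝ} (h : BlockBound a b n x s) :
    (((primesIoc a b).card.choose 3 : ℕ) : ℝ) ≤ n * (n - 1) * (n - 2) / 6 := by
  rw [← cast_choose_three]
  exact_mod_cast Nat.choose_le_choose 3 h.card_le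

lemma exists_rough_of_blockBound {A B z r T₀ w n m : ℕ} {x s y t L V : ℝ} (hAB : A ≤ B) (hBz : B ≤ z)
    (hzr : z < r) (hr : r.Prime) (hw : (primesIoc 0 A).card = w)
    (hV : ∏ p ∈ primesIoc 0 A, (1 - 1 / (p : ℝ)) = V) (hR : BlockBound A B n x s)
    (hQ : BlockBound B z m y t) (hL : ∑ p ∈ primesIoc z (r - 1), (1 : ℝ) / p ≤ L) (hL1 : L ≤ 1)
    (hx : x ≤ 1) (hy : y ≤ 1) (hT₀ : 0 < T₀) (hT : T₀ ≤ Nat.primeCounting r) (hV0 : 0 < V)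
    (hu : 0 < 1 - x + (x ^ 2 - s) / 2) (hv : 0 < 1 - y + (y ^ 2 - t) / 2)
    (hM : 0 < (1 - L) * (1 - x + (x ^ 2 - s) / 2) * (1 - y + (y ^ 2 - t) / 2) -
      (1 - x + (x ^ 2 - s) / 2) * (y ^ 3 / 6) - x ^ 3 / 6 * (1 - y + (y ^ 2 - t) / 2))
    (h : (T₀ : ℝ) * (2 ^ w * ((1 + n + n * (n - 1) / 2) * (1 + m + m * (m - 1) / 2))) +
        2 ^ w * ((1 + n + n * (n - 1) / 2) * (m * (m - 1) * (m - 2) / 6) +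
          n * (n - 1) * (n - 2) / 6 * (1 + m + m * (m - 1) / 2)) <
      (T₀ : ℝ) ^ 3 * (V * ((1 - L) * (1 - x + (x ^ 2 - s) / 2) * (1 - y + (y ^ 2 - t) / 2) -
        (1 - x + (x ^ 2 - s) / 2) * (y ^ 3 / 6) - x ^ 3 / 6 * (1 - y + (y ^ 2 - t) / 2))))
    (a : ℕ) :
    ∃ k, a < k ∧ k ≤ a + Nat.primeCounting r ^ 3 ∧ ∀ p, p.Prime → p < r → ¬ p ∣ k := by
  have hpr : ∀ {b c p : ℕ}, p ∈ primesIoc b c → p.Prime := fun hp => (mem_primesIoc.1 hp).2.2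
  have hun : primesIoc 0 A ∪ primesIoc A B ∪ primesIoc B z ∪ primesIoc z (r - 1) =
      primesIoc 0 (r - 1) := by
    rw [primesIoc_union (by omega) hAB, primesIoc_union (by omega) hBz,
      primesIoc_union (by omega) (by omega)]
  have hun2 : primesIoc 0 A ∪ primesIoc A B ∪ primesIoc B z = primesIoc 0 z := by
    rw [primesIoc_union (by omega) hAB, primesIoc_union (by omega) hBz]
  have hP : (1 : ℝ) + (primesIoc z (r - 1)).card ≤ Nat.primeCounting r := by
    have h1 : insert r (primesIoc z (r - 1)) ⊆ (Finset.range (r + 1)).filter Nat.Prime := by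
      intro p hp
      rw [Finset.mem_insert, mem_primesIoc] at hp
      rw [Finset.mem_filter, Finset.mem_range]
      rcases hp with rfl | hp
      · exact ⟨by omega, hr⟩
      · exact ⟨by omega, hp.2.2⟩
    have h2 := Finset.card_le_card h1
    rw [Finset.card_insert_of_notMem (by rw [mem_primesIoc]; have := hr.pos; omega)] at h2
    rw [Nat.primeCounting, Nat.primeCounting', Nat.count_eq_card_filter_range]
    have h3 : 1 + (primesIoc z (r - 1)).card ≤ ((Finset.range (r + 1)).filter Nat.Prime).card := by
      omega
    exact_mod_cast h3
  obtain ⟨k, k1, k2, k3⟩ := exists_forall_not_dvd_of_blocks (W := primesIoc 0 A)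
    (R := primesIoc A B) (Q := primesIoc B z) (P := primesIoc z (r - 1)) (fun _ => hpr)
    (fun _ => hpr) (fun _ => hpr) (fun _ => hpr) (disjoint_primesIoc le_rfl)
    (disjoint_primesIoc hAB) (disjoint_primesIoc le_rfl)
    (by rw [hun2]; exact disjoint_primesIoc le_rfl) a (Nat.primeCounting r ^ 3) (by
      rw [hw, hV]
      have mono := sieve_main_term_mono (l := esymmInv 1 (primesIoc z (r - 1)))
        (by rw [esymmInv_one]; exact hL) hL1 hu hv (hR.main_le hx) (hQ.main_le hy) hR.three_le
        hQ.three_le (esymmInv_nonneg _ _) (esymmInv_nonneg _ _) hM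
      have lR := hR.level_le
      have lQ := hQ.level_le
      have tR := hR.choose_three_le
      have tQ := hQ.choose_three_le
      have lR0 : (0 : ℝ) ≤ 1 + (primesIoc A B).card + ((primesIoc A B).card.choose 2 : ℕ) := by
        positivity
      have lQ0 : (0 : ℝ) ≤ 1 + (primesIoc B z).card + ((primesIoc B z).card.choose 2 : ℕ) := by
        positivity
      have tR0 : (0 : ℝ) ≤ ((primesIoc A B).card.choose 3 : ℕ) := Nat.cast_nonneg _
      have tQ0 : (0 : ℝ) ≤ ((primesIoc B z).card.choose 3 : ℕ) := Nat.cast_nonneg _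
      have hT' : (T₀ : ℝ) ≤ Nat.primeCounting r := by exact_mod_cast hT
      have hT0 : (0 : ℝ) < T₀ := by exact_mod_cast hT₀
      have w0 : (0 : ℝ) < 2 ^ w := by positivity
      have key := mul_add_lt_pow_three_mul hT0 hT'
        (mul_nonneg w0.le (mul_nonneg (lR0.trans lR) (lQ0.trans lQ)))
        (mul_nonneg w0.le (add_nonneg (mul_nonneg (lR0.trans lR) (tQ0.trans tQ))
          (mul_nonneg (tR0.trans tR) (lQ0.trans lQ)))) h
      refine lt_of_le_of_lt ?_ (key.trans_le ?_)
      · rw [mul_left_comm, ← mul_add]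
        refine mul_le_mul_of_nonneg_left ?_ w0.le
        rw [← add_assoc, ← mul_assoc]
        gcongr
        · exact mul_nonneg (Nat.cast_nonneg _) (lR0.trans lR)
        · exact lR0.trans lR
        · exact tR0.trans tR
      · rw [Nat.cast_pow, mul_assoc ((Nat.primeCounting r : ℝ) ^ 3)]
        exact mul_le_mul_of_nonneg_left (mul_le_mul_of_nonneg_left mono hV0.le) (by positivity))
  refine ⟨k, k1, k2, fun p hp hpr' => k3 p ?_⟩
  rw [hun, mem_primesIoc]
  exact ⟨hp.pos, by omega, hp⟩

/-- The sum of `g` over the `2 ^ k` integers from `n` on that are coprime to `M`, computed by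
repeated halving. -/
def coprimeSum (M : ℕ) (g : ℕ → ℕ) (k : ℕ) : ℕ → ℕ :=
  Nat.rec (fun n => bif Nat.beq (Nat.gcd n M) 1 then g n else 0)
    (fun k f n => f n + f (n + 2 ^ k)) k

lemma sum_primes_le_coprimeSum {M n₀ : ℕ} (hM : ∀ p, p.Prime → p ∣ M → p ≤ n₀) (g : ℕ → ℕ)
    (k : ℕ) : ∀ n, n₀ < n →
    ∑ p ∈ (Finset.Ico n (n + 2 ^ k)).filter Nat.Prime, g p ≤ coprimeSum M g k n := by
  induction k with
  | zero =>
    intro n hn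
    rw [pow_zero, Nat.Ico_succ_singleton, Finset.sum_filter, Finset.sum_singleton]
    by_cases hp : n.Prime
    · have h : Nat.gcd n M = 1 :=
        (Nat.Prime.coprime_iff_not_dvd hp).2 fun h => by
          have := hM n hp h
          omega
      simp [coprimeSum, h, hp]
    · simp [hp]
  | succ k ih =>
    intro n hn
    have h0 : 0 < 2 ^ k := Nat.two_pow_pos k
    have h1 : Finset.Ico n (n + 2 ^ (k + 1)) =
        Finset.Ico n (n + 2 ^ k) ∪ Finset.Ico (n + 2 ^ k) (n + 2 ^ k + 2 ^ k) := by
      rw [Finset.Ico_union_Ico_eq_Ico (by omega) (by omega), pow_succ]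
      congr 1
      omega
    have h2 : Disjoint ((Finset.Ico n (n + 2 ^ k)).filter Nat.Prime)
        ((Finset.Ico (n + 2 ^ k) (n + 2 ^ k + 2 ^ k)).filter Nat.Prime) :=
      Finset.disjoint_filter_filter (Finset.Ico_disjoint_Ico_consecutive _ _ _)
    rw [h1, Finset.filter_union, Finset.sum_union h2]
    exact add_le_add (ih n hn) (ih (n + 2 ^ k) (by omega))

lemma one_div_le_of_floor {d : ℕ} (hd : 0 < d) :
    (1 : ℝ) / d ≤ ((10 ^ 9 / d + 1 : ℕ) : ℝ) / 10 ^ 9 := by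
  have h := Nat.lt_div_mul_add (a := 10 ^ 9) hd
  have h2 : ((10 ^ 9 : ℕ) : ℝ) < (10 ^ 9 / d * d + d : ℕ) := by exact_mod_cast h
  rw [div_le_div_iff₀ (by exact_mod_cast hd) (by norm_num)]
  push_cast at h2 ⊢
  linarith

/-- Bounds for the primes in `(2 ^ k, 2 ^ (k + 1)]` from a computation with integers. -/
lemma BlockBound.of_coprimeSum {M k n x s : ℕ} (hM : ∀ p, p.Prime → p ∣ M → p ≤ 2 ^ k)
    (hn : coprimeSum M (fun _ => 1) k (2 ^ k + 1) ≤ n)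
    (hx : coprimeSum M (fun p => 10 ^ 9 / p + 1) k (2 ^ k + 1) ≤ x)
    (hs : coprimeSum M (fun p => 10 ^ 9 / (p ^ 2) + 1) k (2 ^ k + 1) ≤ s) :
    BlockBound (2 ^ k) (2 ^ (k + 1)) n (x / 10 ^ 9) (s / 10 ^ 9) := by
  have h0 : primesIoc (2 ^ k) (2 ^ (k + 1)) =
      (Finset.Ico (2 ^ k + 1) (2 ^ k + 1 + 2 ^ k)).filter Nat.Prime := by
    rw [primesIoc]
    congr 1
    ext p
    rw [Finset.mem_Ioc, Finset.mem_Ico, pow_succ]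
    omega
  have h1 := fun g => sum_primes_le_coprimeSum hM g k (2 ^ k + 1) (by omega)
  have hpos : ∀ p ∈ primesIoc (2 ^ k) (2 ^ (k + 1)), 0 < p := fun p hp =>
    (mem_primesIoc.1 hp).2.2.pos
  rw [← h0] at h1
  constructor
  · rw [Finset.card_eq_sum_ones]
    exact (h1 _).trans hn
  · rw [le_div_iff₀ (by norm_num), Finset.sum_mul]
    refine le_trans (Finset.sum_le_sum (g := fun p => ((10 ^ 9 / p + 1 : ℕ) : ℝ)) fun p hp => ?_) ?_
    · rw [← le_div_iff₀ (by norm_num)]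
      exact one_div_le_of_floor (hpos p hp)
    · rw [← Nat.cast_sum]
      exact_mod_cast (h1 _).trans hx
  · rw [le_div_iff₀ (by norm_num), Finset.sum_mul]
    refine le_trans
      (Finset.sum_le_sum (g := fun p => ((10 ^ 9 / (p ^ 2) + 1 : ℕ) : ℝ)) fun p hp => ?_) ?_
    · rw [← le_div_iff₀ (by norm_num), ← Nat.cast_pow]
      exact one_div_le_of_floor (pow_pos (hpos p hp) 2)
    · rw [← Nat.cast_sum]
      exact_mod_cast (h1 _).trans hs

lemma le_of_prime_dvd_list_prod {l : List ℕ} {b : ℕ} (hl : ∀ q ∈ l, 0 < q ∧ q ≤ b) {p : ℕ}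
    (hp : p.Prime) (h : p ∣ l.prod) : p ≤ b := by
  obtain ⟨q, hq, hpq⟩ := (Prime.dvd_prod_iff hp.prime).1 h
  exact (Nat.le_of_dvd (hl q hq).1 hpq).trans (hl q hq).2

lemma le_of_prime_dvd_30030 (p : ℕ) (hp : p.Prime) (h : p ∣ 30030) : p ≤ 13 :=
  le_of_prime_dvd_list_prod (l := [2, 3, 5, 7, 11, 13]) (by decide) hp (by simpa using h)

/-- The product of the primes up to `193`. -/
def primorial193 : ℕ := 198962376391690981640415251545285153602734402721821058212203976095413910572270

lemma le_of_prime_dvd_primorial193 (p : ℕ) (hp : p.Prime) (h : p ∣ primorial193) : p ≤ 193 :=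
  le_of_prime_dvd_list_prod
    (l := [2, 3, 5, 7, 11, 13, 17, 19, 23, 29, 31, 37, 41, 43, 47, 53, 59, 61, 67, 71, 73,
      79, 83, 89, 97, 101, 103, 107, 109, 113, 127, 131, 137, 139, 149, 151, 157,
      163, 167, 173, 179, 181, 191, 193])
    (by decide) hp (by
      rw [show List.prod _ = primorial193 by decide +kernel]
      exact h)

lemma blockBound_16 : BlockBound 16 32 5 (221674194 / 10 ^ 9) (10350296 / 10 ^ 9) := by
  exact_mod_cast BlockBound.of_coprimeSum (k := 4) (n := 5) (x := 221674194) (s := 10350296)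
    (fun p hp h => (le_of_prime_dvd_30030 p hp h).trans (by norm_num))
    (by decide +kernel) (by decide +kernel) (by decide +kernel)

lemma blockBound_32 : BlockBound 32 64 7 (148160203 / 10 ^ 9) (3230890 / 10 ^ 9) := by
  exact_mod_cast BlockBound.of_coprimeSum (k := 5) (n := 7) (x := 148160203) (s := 3230890)
    (fun p hp h => (le_of_prime_dvd_30030 p hp h).trans (by norm_num))
    (by decide +kernel) (by decide +kernel) (by decide +kernel)

lemma blockBound_64 : BlockBound 64 128 13 (143813579 / 10 ^ 9) (1650831 / 10 ^ 9) := by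
  exact_mod_cast BlockBound.of_coprimeSum (k := 6) (n := 13) (x := 143813579) (s := 1650831)
    (fun p hp h => (le_of_prime_dvd_30030 p hp h).trans (by norm_num))
    (by decide +kernel) (by decide +kernel) (by decide +kernel)

lemma blockBound_128 : BlockBound 128 256 23 (125968605 / 10 ^ 9) (716771 / 10 ^ 9) := by
  exact_mod_cast BlockBound.of_coprimeSum (k := 7) (n := 23) (x := 125968605) (s := 716771)
    (fun p hp h => (le_of_prime_dvd_30030 p hp h).trans (by norm_num))
    (by decide +kernel) (by decide +kernel) (by decide +kernel)

lemma blockBound_256 : BlockBound 256 512 43 (117023082 / 10 ^ 9) (332366 / 10 ^ 9) := by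
  exact_mod_cast BlockBound.of_coprimeSum (k := 8) (n := 43) (x := 117023082) (s := 332366)
    (fun p hp h => (le_of_prime_dvd_primorial193 p hp h).trans (by norm_num))
    (by decide +kernel) (by decide +kernel) (by decide +kernel)

lemma blockBound_512 : BlockBound 512 1024 75 (101356935 / 10 ^ 9) (142347 / 10 ^ 9) := by
  exact_mod_cast BlockBound.of_coprimeSum (k := 9) (n := 75) (x := 101356935) (s := 142347)
    (fun p hp h => (le_of_prime_dvd_primorial193 p hp h).trans (by norm_num))
    (by decide +kernel) (by decide +kernel) (by decide +kernel)

lemma blockBound_1024 : BlockBound 1024 2048 137 (93398336 / 10 ^ 9) (66332 / 10 ^ 9) := by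
  exact_mod_cast BlockBound.of_coprimeSum (k := 10) (n := 137) (x := 93398336) (s := 66332)
    (fun p hp h => (le_of_prime_dvd_primorial193 p hp h).trans (by norm_num))
    (by decide +kernel) (by decide +kernel) (by decide +kernel)

lemma blockBound_2048 : BlockBound 2048 4096 255 (86629818 / 10 ^ 9) (30770 / 10 ^ 9) := by
  exact_mod_cast BlockBound.of_coprimeSum (k := 11) (n := 255) (x := 86629818) (s := 30770)
    (fun p hp h => (le_of_prime_dvd_primorial193 p hp h).trans (by norm_num))
    (by decide +kernel) (by decide +kernel) (by decide +kernel)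

lemma blockBound_4096 : BlockBound 4096 8192 464 (78837951 / 10 ^ 9) (14170 / 10 ^ 9) := by
  exact_mod_cast BlockBound.of_coprimeSum (k := 12) (n := 464) (x := 78837951) (s := 14170)
    (fun p hp h => (le_of_prime_dvd_primorial193 p hp h).trans (by norm_num))
    (by decide +kernel) (by decide +kernel) (by decide +kernel)

lemma blockBound_8192 : BlockBound 8192 16384 872 (74088181 / 10 ^ 9) (6989 / 10 ^ 9) := by
  exact_mod_cast BlockBound.of_coprimeSum (k := 13) (n := 872) (x := 74088181) (s := 6989)
    (fun p hp h => (le_of_prime_dvd_primorial193 p hp h).trans (by norm_num))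
    (by decide +kernel) (by decide +kernel) (by decide +kernel)

lemma blockBound_16384 : BlockBound 16384 32768 1612 (68444856 / 10 ^ 9) (3908 / 10 ^ 9) := by
  exact_mod_cast BlockBound.of_coprimeSum (k := 14) (n := 1612) (x := 68444856) (s := 3908)
    (fun p hp h => (le_of_prime_dvd_primorial193 p hp h).trans (by norm_num))
    (by decide +kernel) (by decide +kernel) (by decide +kernel)

lemma BlockBound.mono {a b n m : ℕ} {x s y t : ℝ} (h : BlockBound a b n x s) (h1 : n ≤ m)
    (h2 : x ≤ y) (h3 : s ≤ t) : BlockBound a b m y t :=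
  ⟨h.card_le.trans h1, h.sum_le.trans h2, h.sum_sq_le.trans h3⟩

lemma primesIoc_3_card : (primesIoc 0 3).card = 2 := by decide

lemma primesIoc_3_prod : ∏ p ∈ primesIoc 0 3, (1 - 1 / (p : ℝ)) =
    1 / 3 := by
  rw [show primesIoc 0 3 = {2, 3} by decide]
  repeat rw [Finset.prod_insert (by decide)]
  norm_num

lemma primesIoc_5_card : (primesIoc 0 5).card = 3 := by decide

lemma primesIoc_5_prod : ∏ p ∈ primesIoc 0 5, (1 - 1 / (p : ℝ)) =
    4 / 15 := by
  rw [show primesIoc 0 5 = {2, 3, 5} by decide]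
  repeat rw [Finset.prod_insert (by decide)]
  norm_num

lemma primesIoc_7_card : (primesIoc 0 7).card = 4 := by decide

lemma primesIoc_7_prod : ∏ p ∈ primesIoc 0 7, (1 - 1 / (p : ℝ)) =
    8 / 35 := by
  rw [show primesIoc 0 7 = {2, 3, 5, 7} by decide]
  repeat rw [Finset.prod_insert (by decide)]
  norm_num

lemma primesIoc_11_card : (primesIoc 0 11).card = 5 := by decide

lemma primesIoc_11_prod : ∏ p ∈ primesIoc 0 11, (1 - 1 / (p : ℝ)) =
    16 / 77 := by
  rw [show primesIoc 0 11 = {2, 3, 5, 7, 11} by decide]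
  repeat rw [Finset.prod_insert (by decide)]
  norm_num

lemma primesIoc_13_card : (primesIoc 0 13).card = 6 := by decide

lemma primesIoc_13_prod : ∏ p ∈ primesIoc 0 13, (1 - 1 / (p : ℝ)) =
    192 / 1001 := by
  rw [show primesIoc 0 13 = {2, 3, 5, 7, 11, 13} by decide]
  repeat rw [Finset.prod_insert (by decide)]
  norm_num

lemma blockBound_3_16 : BlockBound 3 16 4 (510689312 / 10 ^ 9) (74589788 / 10 ^ 9) := by
  constructor
  · decide
  all_goals
    rw [show primesIoc 3 16 = {5, 7, 11, 13} by decide]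
    repeat rw [Finset.sum_insert (by decide)]
    norm_num

lemma blockBound_5_16 : BlockBound 5 16 3 (310689311 / 10 ^ 9) (34589787 / 10 ^ 9) := by
  constructor
  · decide
  all_goals
    rw [show primesIoc 5 16 = {7, 11, 13} by decide]
    repeat rw [Finset.sum_insert (by decide)]
    norm_num

lemma blockBound_7_16 : BlockBound 7 16 2 (167832168 / 10 ^ 9) (14181623 / 10 ^ 9) := by
  constructor
  · decide
  all_goals
    rw [show primesIoc 7 16 = {11, 13} by decide]
    repeat rw [Finset.sum_insert (by decide)]
    norm_num

lemma blockBound_11_16 : BlockBound 11 16 1 (76923077 / 10 ^ 9) (5917160 / 10 ^ 9) := by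
  constructor
  · decide
  all_goals
    rw [show primesIoc 11 16 = {13} by decide]
    norm_num

lemma blockBound_13_16 : BlockBound 13 16 0 (0 / 10 ^ 9) (0 / 10 ^ 9) := by
  constructor
  · decide
  all_goals
    rw [show primesIoc 13 16 = ∅ by decide]
    norm_num

lemma blockBound_3_32 : BlockBound 3 32 9 (732363506 / 10 ^ 9) (84940084 / 10 ^ 9) :=
  blockBound_3_16 |>.trans blockBound_16
    |>.mono (by norm_num) (by norm_num) (by norm_num)

lemma blockBound_5_32 : BlockBound 5 32 8 (532363505 / 10 ^ 9) (44940083 / 10 ^ 9) :=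
  blockBound_5_16 |>.trans blockBound_16
    |>.mono (by norm_num) (by norm_num) (by norm_num)

lemma blockBound_5_64 : BlockBound 5 64 15 (680523708 / 10 ^ 9) (48170973 / 10 ^ 9) :=
  blockBound_5_16 |>.trans blockBound_16 |>.trans blockBound_32
    |>.mono (by norm_num) (by norm_num) (by norm_num)

lemma blockBound_5_128 : BlockBound 5 128 28 (824337287 / 10 ^ 9) (49821804 / 10 ^ 9) :=
  blockBound_5_16 |>.trans blockBound_16 |>.trans blockBound_32 |>.trans blockBound_64
    |>.mono (by norm_num) (by norm_num) (by norm_num)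

lemma blockBound_7_32 : BlockBound 7 32 7 (389506362 / 10 ^ 9) (24531919 / 10 ^ 9) :=
  blockBound_7_16 |>.trans blockBound_16
    |>.mono (by norm_num) (by norm_num) (by norm_num)

lemma blockBound_7_64 : BlockBound 7 64 14 (537666565 / 10 ^ 9) (27762809 / 10 ^ 9) :=
  blockBound_7_16 |>.trans blockBound_16 |>.trans blockBound_32
    |>.mono (by norm_num) (by norm_num) (by norm_num)

lemma blockBound_7_256 : BlockBound 7 256 50 (807448749 / 10 ^ 9) (30130411 / 10 ^ 9) :=
  blockBound_7_16 |>.trans blockBound_16 |>.trans blockBound_32 |>.trans blockBound_64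
    |>.trans blockBound_128
    |>.mono (by norm_num) (by norm_num) (by norm_num)

lemma blockBound_11_64 : BlockBound 11 64 13 (446757474 / 10 ^ 9) (19498346 / 10 ^ 9) :=
  blockBound_11_16 |>.trans blockBound_16 |>.trans blockBound_32
    |>.mono (by norm_num) (by norm_num) (by norm_num)

lemma blockBound_11_128 : BlockBound 11 128 26 (590571053 / 10 ^ 9) (21149177 / 10 ^ 9) :=
  blockBound_11_16 |>.trans blockBound_16 |>.trans blockBound_32 |>.trans blockBound_64
    |>.mono (by norm_num) (by norm_num) (by norm_num)

lemma blockBound_11_256 : BlockBound 11 256 49 (716539658 / 10 ^ 9) (21865948 / 10 ^ 9) :=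
  blockBound_11_16 |>.trans blockBound_16 |>.trans blockBound_32 |>.trans blockBound_64
    |>.trans blockBound_128
    |>.mono (by norm_num) (by norm_num) (by norm_num)

lemma blockBound_11_512 : BlockBound 11 512 92 (833562740 / 10 ^ 9) (22198314 / 10 ^ 9) :=
  blockBound_11_16 |>.trans blockBound_16 |>.trans blockBound_32 |>.trans blockBound_64
    |>.trans blockBound_128 |>.trans blockBound_256
    |>.mono (by norm_num) (by norm_num) (by norm_num)

lemma blockBound_13_128 : BlockBound 13 128 25 (513647976 / 10 ^ 9) (15232017 / 10 ^ 9) :=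
  blockBound_13_16 |>.trans blockBound_16 |>.trans blockBound_32 |>.trans blockBound_64
    |>.mono (by norm_num) (by norm_num) (by norm_num)

lemma blockBound_16_256 : BlockBound 16 256 48 (639616581 / 10 ^ 9) (15948788 / 10 ^ 9) :=
  blockBound_16 |>.trans blockBound_32 |>.trans blockBound_64 |>.trans blockBound_128
    |>.mono (by norm_num) (by norm_num) (by norm_num)

lemma blockBound_16_512 : BlockBound 16 512 91 (756639663 / 10 ^ 9) (16281154 / 10 ^ 9) :=
  blockBound_16 |>.trans blockBound_32 |>.trans blockBound_64 |>.trans blockBound_128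
    |>.trans blockBound_256
    |>.mono (by norm_num) (by norm_num) (by norm_num)

lemma blockBound_16_1024 : BlockBound 16 1024 166 (857996598 / 10 ^ 9) (16423501 / 10 ^ 9) :=
  blockBound_16 |>.trans blockBound_32 |>.trans blockBound_64 |>.trans blockBound_128
    |>.trans blockBound_256 |>.trans blockBound_512
    |>.mono (by norm_num) (by norm_num) (by norm_num)

lemma blockBound_16_2048 : BlockBound 16 2048 303 (951394934 / 10 ^ 9) (16489833 / 10 ^ 9) :=
  blockBound_16 |>.trans blockBound_32 |>.trans blockBound_64 |>.trans blockBound_128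
    |>.trans blockBound_256 |>.trans blockBound_512 |>.trans blockBound_1024
    |>.mono (by norm_num) (by norm_num) (by norm_num)

lemma blockBound_32_512 : BlockBound 32 512 86 (534965469 / 10 ^ 9) (5930858 / 10 ^ 9) :=
  blockBound_32 |>.trans blockBound_64 |>.trans blockBound_128 |>.trans blockBound_256
    |>.mono (by norm_num) (by norm_num) (by norm_num)

lemma blockBound_32_1024 : BlockBound 32 1024 161 (636322404 / 10 ^ 9) (6073205 / 10 ^ 9) :=
  blockBound_32 |>.trans blockBound_64 |>.trans blockBound_128 |>.trans blockBound_256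
    |>.trans blockBound_512
    |>.mono (by norm_num) (by norm_num) (by norm_num)

lemma blockBound_32_2048 : BlockBound 32 2048 298 (729720740 / 10 ^ 9) (6139537 / 10 ^ 9) :=
  blockBound_32 |>.trans blockBound_64 |>.trans blockBound_128 |>.trans blockBound_256
    |>.trans blockBound_512 |>.trans blockBound_1024
    |>.mono (by norm_num) (by norm_num) (by norm_num)

lemma blockBound_32_4096 : BlockBound 32 4096 553 (816350558 / 10 ^ 9) (6170307 / 10 ^ 9) :=
  blockBound_32 |>.trans blockBound_64 |>.trans blockBound_128 |>.trans blockBound_256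
    |>.trans blockBound_512 |>.trans blockBound_1024 |>.trans blockBound_2048
    |>.mono (by norm_num) (by norm_num) (by norm_num)

lemma blockBound_32_8192 : BlockBound 32 8192 1017 (895188509 / 10 ^ 9) (6184477 / 10 ^ 9) :=
  blockBound_32 |>.trans blockBound_64 |>.trans blockBound_128 |>.trans blockBound_256
    |>.trans blockBound_512 |>.trans blockBound_1024 |>.trans blockBound_2048
    |>.trans blockBound_4096
    |>.mono (by norm_num) (by norm_num) (by norm_num)

lemma blockBound_64_2048 : BlockBound 64 2048 291 (581560537 / 10 ^ 9) (2908647 / 10 ^ 9) :=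
  blockBound_64 |>.trans blockBound_128 |>.trans blockBound_256 |>.trans blockBound_512
    |>.trans blockBound_1024
    |>.mono (by norm_num) (by norm_num) (by norm_num)

lemma blockBound_64_4096 : BlockBound 64 4096 546 (668190355 / 10 ^ 9) (2939417 / 10 ^ 9) :=
  blockBound_64 |>.trans blockBound_128 |>.trans blockBound_256 |>.trans blockBound_512
    |>.trans blockBound_1024 |>.trans blockBound_2048
    |>.mono (by norm_num) (by norm_num) (by norm_num)

lemma blockBound_64_8192 : BlockBound 64 8192 1010 (747028306 / 10 ^ 9) (2953587 / 10 ^ 9) :=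
  blockBound_64 |>.trans blockBound_128 |>.trans blockBound_256 |>.trans blockBound_512
    |>.trans blockBound_1024 |>.trans blockBound_2048 |>.trans blockBound_4096
    |>.mono (by norm_num) (by norm_num) (by norm_num)

lemma blockBound_64_16384 : BlockBound 64 16384 1882 (821116487 / 10 ^ 9) (2960576 / 10 ^ 9) :=
  blockBound_64 |>.trans blockBound_128 |>.trans blockBound_256 |>.trans blockBound_512
    |>.trans blockBound_1024 |>.trans blockBound_2048 |>.trans blockBound_4096
    |>.trans blockBound_8192
    |>.mono (by norm_num) (by norm_num) (by norm_num)

lemma blockBound_64_32768 : BlockBound 64 32768 3494 (889561343 / 10 ^ 9) (2964484 / 10 ^ 9) :=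
  blockBound_64 |>.trans blockBound_128 |>.trans blockBound_256 |>.trans blockBound_512
    |>.trans blockBound_1024 |>.trans blockBound_2048 |>.trans blockBound_4096
    |>.trans blockBound_8192 |>.trans blockBound_16384
    |>.mono (by norm_num) (by norm_num) (by norm_num)

lemma blockBound_128_8192 : BlockBound 128 8192 997 (603214727 / 10 ^ 9) (1302756 / 10 ^ 9) :=
  blockBound_128 |>.trans blockBound_256 |>.trans blockBound_512 |>.trans blockBound_1024
    |>.trans blockBound_2048 |>.trans blockBound_4096
    |>.mono (by norm_num) (by norm_num) (by norm_num)

lemma blockBound_128_16384 : BlockBound 128 16384 1869 (677302908 / 10 ^ 9) (1309745 / 10 ^ 9) :=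
  blockBound_128 |>.trans blockBound_256 |>.trans blockBound_512 |>.trans blockBound_1024
    |>.trans blockBound_2048 |>.trans blockBound_4096 |>.trans blockBound_8192
    |>.mono (by norm_num) (by norm_num) (by norm_num)

lemma blockBound_128_32768 : BlockBound 128 32768 3481 (745747764 / 10 ^ 9) (1313653 / 10 ^ 9) :=
  blockBound_128 |>.trans blockBound_256 |>.trans blockBound_512 |>.trans blockBound_1024
    |>.trans blockBound_2048 |>.trans blockBound_4096 |>.trans blockBound_8192
    |>.trans blockBound_16384
    |>.mono (by norm_num) (by norm_num) (by norm_num)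

lemma blockBound_256_32768 : BlockBound 256 32768 3458 (619779159 / 10 ^ 9) (596882 / 10 ^ 9) :=
  blockBound_256 |>.trans blockBound_512 |>.trans blockBound_1024 |>.trans blockBound_2048
    |>.trans blockBound_4096 |>.trans blockBound_8192 |>.trans blockBound_16384
    |>.mono (by norm_num) (by norm_num) (by norm_num)

lemma blockBound_512_32768 : BlockBound 512 32768 3415 (502756077 / 10 ^ 9) (264516 / 10 ^ 9) :=
  blockBound_512 |>.trans blockBound_1024 |>.trans blockBound_2048 |>.trans blockBound_4096
    |>.trans blockBound_8192 |>.trans blockBound_16384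
    |>.mono (by norm_num) (by norm_num) (by norm_num)

lemma blockBound_1024_32768 : BlockBound 1024 32768 3340 (401399142 / 10 ^ 9) (122169 / 10 ^ 9) :=
  blockBound_1024 |>.trans blockBound_2048 |>.trans blockBound_4096 |>.trans blockBound_8192
    |>.trans blockBound_16384
    |>.mono (by norm_num) (by norm_num) (by norm_num)

lemma blockBound_2048_32768 : BlockBound 2048 32768 3203 (308000806 / 10 ^ 9) (55837 / 10 ^ 9) :=
  blockBound_2048 |>.trans blockBound_4096 |>.trans blockBound_8192 |>.trans blockBound_16384
    |>.mono (by norm_num) (by norm_num) (by norm_num)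

lemma blockBound_4096_32768 : BlockBound 4096 32768 2948 (221370988 / 10 ^ 9) (25067 / 10 ^ 9) :=
  blockBound_4096 |>.trans blockBound_8192 |>.trans blockBound_16384
    |>.mono (by norm_num) (by norm_num) (by norm_num)

lemma blockBound_8192_32768 : BlockBound 8192 32768 2484 (142533037 / 10 ^ 9) (10897 / 10 ^ 9) :=
  blockBound_8192 |>.trans blockBound_16384
    |>.mono (by norm_num) (by norm_num) (by norm_num)

lemma blockBound_16384_32768 : BlockBound 16384 32768 1612 (68444856 / 10 ^ 9) (3908 / 10 ^ 9) :=
  blockBound_16384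
    |>.mono (by norm_num) (by norm_num) (by norm_num)

lemma le_primeCounting_of_le {T n r : ℕ} (hr : n ≤ r) (h : T ≤ Nat.primeCounting n) :
    T ≤ Nat.primeCounting r :=
  h.trans (Nat.monotone_primeCounting hr)

lemma le_primeCounting {k T r : ℕ} (hk : 1 ≤ k) (h : k * (T + 1) < 2 ^ k) (hr : 2 ^ k ≤ r) :
    T ≤ Nat.primeCounting r := by
  refine le_primeCounting_of_le hr ?_
  have h1 : 2 ≤ 2 ^ k := by
    calc 2 = 2 ^ 1 := rfl
      _ ≤ 2 ^ k := Nat.pow_le_pow_right (by norm_num) hk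
  have h2 := mul_log_primeCounting_ge h1
  have hk0 : (0 : ℝ) < k := by exact_mod_cast hk
  have hl2 := Real.log_pos one_lt_two
  have h3 : Real.log (((2 ^ k : ℕ) : ℝ) + 1) ≤ 2 * (k * Real.log 2) := by
    have h4 : (((2 ^ k : ℕ) : ℝ) + 1) ≤ (2 ^ k) ^ 2 := by
      have : (2 : ℝ) ≤ 2 ^ k := by exact_mod_cast h1
      push_cast
      nlinarith
    refine (Real.log_le_log (by positivity) h4).trans (le_of_eq ?_)
    rw [Real.log_pow, Real.log_pow]
    norm_num
  rw [Nat.cast_pow, Nat.cast_ofNat, Real.log_pow] at h2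
  rw [Nat.cast_pow, Nat.cast_ofNat] at h3
  have h4 : (2 : ℝ) ^ k ≤ k * (Nat.primeCounting (2 ^ k) + 2) := by
    refine le_of_mul_le_mul_right ?_ hl2
    nlinarith
  by_contra! hcon
  have h5 : 2 ^ k ≤ k * (Nat.primeCounting (2 ^ k) + 2) := by exact_mod_cast h4
  have h6 : k * (Nat.primeCounting (2 ^ k) + 2) ≤ k * (T + 1) := Nat.mul_le_mul_left _ (by omega)
  omega

lemma log_le_of_pow_le {x : ℝ} (hx : 0 < x) {a b : ℕ} (ha : 0 < a) (h : x ^ a ≤ 2 ^ b) :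
    Real.log x ≤ b / a * 0.6931471808 := by
  have h1 := Real.log_le_log (by positivity) h
  rw [Real.log_pow, Real.log_pow] at h1
  have ha' : (0 : ℝ) < a := by exact_mod_cast ha
  have h2 := Real.log_two_lt_d9
  rw [div_mul_eq_mul_div, le_div_iff₀ ha']
  have h3 : (b : ℝ) * Real.log 2 ≤ b * 0.6931471808 :=
    mul_le_mul_of_nonneg_left h2.le (Nat.cast_nonneg _)
  linarith

lemma BlockBound.sum_le_of_lt {z b r n : ℕ} {x s : ℝ} (h : BlockBound z b n x s) (hr : r < b) :
    ∑ p ∈ primesIoc z (r - 1), (1 : ℝ) / p ≤ x := by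
  refine (Finset.sum_le_sum_of_subset_of_nonneg (fun p hp => ?_) fun _ _ _ => by positivity).trans
    h.sum_le
  rw [mem_primesIoc] at hp ⊢
  exact ⟨hp.1, by omega, hp.2.2⟩

lemma BlockBound.sum_le_of_log {z k r n m a b : ℕ} {x s L : ℝ} (h : BlockBound z 32768 m x s)
    (hr1 : 2 ^ k ≤ r) (hr : r < 2 ^ n) (hk : 15 ≤ k) (ha : 0 < a)
    (hab : ((n : ℝ) / 15) ^ a ≤ 2 ^ b)
    (hL : x + b / a * 0.6931471808 + 1.24 / (15 * 0.6931471803) ≤ L) :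
    ∑ p ∈ primesIoc z (r - 1), (1 : ℝ) / p ≤ L := by
  have hr0 : 32768 ≤ r := (Nat.pow_le_pow_right two_pos hk : 2 ^ 15 ≤ 2 ^ k).trans hr1
  have hn : 0 < n := by
    rcases Nat.eq_zero_or_pos n with rfl | hn
    · norm_num at hr
      omega
    · exact hn
  have h1 := sum_inv_primes_Ioc_le (n := 32768) (by norm_num) hr0
  have hsub : primesIoc z (r - 1) ⊆
      primesIoc z 32768 ∪ (primesFromFive r).filter (32768 < ·) := by
    intro p hp
    rw [mem_primesIoc] at hp
    rw [Finset.mem_union, mem_primesIoc, Finset.mem_filter, mem_primesFromFive]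
    rcases Nat.lt_or_ge 32768 p with hq | hq
    · exact Or.inr ⟨⟨by omega, by omega, hp.2.2⟩, hq⟩
    · exact Or.inl ⟨hp.1, hq, hp.2.2⟩
  have h2 := (Finset.sum_le_sum_of_subset_of_nonneg (f := fun p : ℕ => (1 : ℝ) / p) hsub
    fun _ _ _ => by positivity).trans (Finset.sum_union (Finset.disjoint_left.2 fun p hp hq => by
      rw [mem_primesIoc] at hp
      rw [Finset.mem_filter] at hq
      omega)).le
  have hl2 := Real.log_two_gt_d9
  have hl0 := Real.log_pos one_lt_two
  have e1 : Real.log ((32768 : ℕ) : ℝ) = 15 * Real.log 2 := by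
    rw [show ((32768 : ℕ) : ℝ) = 2 ^ 15 by norm_num, Real.log_pow]
    norm_num
  have hrpos : (0 : ℝ) < r := by exact_mod_cast (by omega : 0 < r)
  have e2 : Real.log r ≤ n * Real.log 2 := by
    rw [← Real.log_pow]
    exact Real.log_le_log hrpos (by exact_mod_cast hr.le)
  have e0 : 0 < Real.log r := Real.log_pos (by exact_mod_cast (by omega : 1 < r))
  have e3 : Real.log (Real.log r / Real.log ((32768 : ℕ) : ℝ)) ≤ b / a * 0.6931471808 := by
    rw [e1]
    refine le_trans (Real.log_le_log (div_pos e0 (by positivity)) ?_)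
      (log_le_of_pow_le (by positivity) ha hab)
    rw [div_le_div_iff₀ (by positivity) (by norm_num)]
    nlinarith
  have e4 : 1.24 * (Real.log ((32768 : ℕ) : ℝ))⁻¹ ≤ 1.24 / (15 * 0.6931471803) := by
    rw [e1, div_eq_mul_inv]
    gcongr
  have h3 := h.sum_le
  linarith

lemma exists_rough_of_lt_two_pow_5 {r : ℕ} (hr : r.Prime) (hr1 : 17 ≤ r) (hr2 : r < 2 ^ 5)
    (a : ℕ) : ∃ n, a < n ∧ n ≤ a + Nat.primeCounting r ^ 3 ∧ ∀ p, p.Prime → p < r → ¬ p ∣ n :=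
  exists_rough_of_blockBound (T₀ := 7) (L := 732363506 / 10 ^ 9) (V := 1 / 3) (w := 2)
    (by norm_num) (by norm_num) (lt_of_lt_of_le (by norm_num) hr1) hr
    primesIoc_3_card primesIoc_3_prod
    (BlockBound.refl 3) (BlockBound.refl 3)
    (blockBound_3_32.sum_le_of_lt hr2)
    (by norm_num) (by norm_num) (by norm_num) (by norm_num) (le_primeCounting_of_le hr1 (by decide +kernel))
    (by norm_num) (by norm_num) (by norm_num) (by norm_num) (by norm_num) a

lemma exists_rough_of_lt_two_pow_6 {r : ℕ} (hr : r.Prime) (hr1 : 2 ^ 5 ≤ r) (hr2 : r < 2 ^ 6)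
    (a : ℕ) : ∃ n, a < n ∧ n ≤ a + Nat.primeCounting r ^ 3 ∧ ∀ p, p.Prime → p < r → ¬ p ∣ n :=
  exists_rough_of_blockBound (T₀ := 11) (L := 680523708 / 10 ^ 9) (V := 4 / 15) (w := 3)
    (by norm_num) (by norm_num) (lt_of_lt_of_le (by norm_num) hr1) hr
    primesIoc_5_card primesIoc_5_prod
    (BlockBound.refl 5) (BlockBound.refl 5)
    (blockBound_5_64.sum_le_of_lt hr2)
    (by norm_num) (by norm_num) (by norm_num) (by norm_num) (le_primeCounting_of_le hr1 (by decide +kernel))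
    (by norm_num) (by norm_num) (by norm_num) (by norm_num) (by norm_num) a

lemma exists_rough_of_lt_two_pow_7 {r : ℕ} (hr : r.Prime) (hr1 : 2 ^ 6 ≤ r) (hr2 : r < 2 ^ 7)
    (a : ℕ) : ∃ n, a < n ∧ n ≤ a + Nat.primeCounting r ^ 3 ∧ ∀ p, p.Prime → p < r → ¬ p ∣ n :=
  exists_rough_of_blockBound (T₀ := 18) (L := 824337287 / 10 ^ 9) (V := 4 / 15) (w := 3)
    (by norm_num) (by norm_num) (lt_of_lt_of_le (by norm_num) hr1) hr
    primesIoc_5_card primesIoc_5_prod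
    (BlockBound.refl 5) (BlockBound.refl 5)
    (blockBound_5_128.sum_le_of_lt hr2)
    (by norm_num) (by norm_num) (by norm_num) (by norm_num) (le_primeCounting_of_le hr1 (by decide +kernel))
    (by norm_num) (by norm_num) (by norm_num) (by norm_num) (by norm_num) a

lemma exists_rough_of_lt_two_pow_8 {r : ℕ} (hr : r.Prime) (hr1 : 2 ^ 7 ≤ r) (hr2 : r < 2 ^ 8)
    (a : ℕ) : ∃ n, a < n ∧ n ≤ a + Nat.primeCounting r ^ 3 ∧ ∀ p, p.Prime → p < r → ¬ p ∣ n :=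
  exists_rough_of_blockBound (T₀ := 31) (L := 807448749 / 10 ^ 9) (V := 8 / 35) (w := 4)
    (by norm_num) (by norm_num) (lt_of_lt_of_le (by norm_num) hr1) hr
    primesIoc_7_card primesIoc_7_prod
    (BlockBound.refl 7) (BlockBound.refl 7)
    (blockBound_7_256.sum_le_of_lt hr2)
    (by norm_num) (by norm_num) (by norm_num) (by norm_num) (le_primeCounting_of_le hr1 (by decide +kernel))
    (by norm_num) (by norm_num) (by norm_num) (by norm_num) (by norm_num) a

lemma exists_rough_of_lt_two_pow_9 {r : ℕ} (hr : r.Prime) (hr1 : 2 ^ 8 ≤ r) (hr2 : r < 2 ^ 9)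
    (a : ℕ) : ∃ n, a < n ∧ n ≤ a + Nat.primeCounting r ^ 3 ∧ ∀ p, p.Prime → p < r → ¬ p ∣ n :=
  exists_rough_of_blockBound (T₀ := 54) (L := 833562740 / 10 ^ 9) (V := 16 / 77) (w := 5)
    (by norm_num) (by norm_num) (lt_of_lt_of_le (by norm_num) hr1) hr
    primesIoc_11_card primesIoc_11_prod
    (BlockBound.refl 11) (BlockBound.refl 11)
    (blockBound_11_512.sum_le_of_lt hr2)
    (by norm_num) (by norm_num) (by norm_num) (by norm_num) (le_primeCounting_of_le hr1 (by decide +kernel))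
    (by norm_num) (by norm_num) (by norm_num) (by norm_num) (by norm_num) a

lemma exists_rough_of_lt_two_pow_10 {r : ℕ} (hr : r.Prime) (hr1 : 2 ^ 9 ≤ r) (hr2 : r < 2 ^ 10)
    (a : ℕ) : ∃ n, a < n ∧ n ≤ a + Nat.primeCounting r ^ 3 ∧ ∀ p, p.Prime → p < r → ¬ p ∣ n :=
  exists_rough_of_blockBound (T₀ := 55) (L := 857996598 / 10 ^ 9) (V := 4 / 15) (w := 3)
    (by norm_num) (by norm_num) (lt_of_lt_of_le (by norm_num) hr1) hr
    primesIoc_5_card primesIoc_5_prod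
    blockBound_5_16 (BlockBound.refl 16)
    (blockBound_16_1024.sum_le_of_lt hr2)
    (by norm_num) (by norm_num) (by norm_num) (by norm_num) (le_primeCounting (k := 9) (by norm_num) (by norm_num) hr1)
    (by norm_num) (by norm_num) (by norm_num) (by norm_num) (by norm_num) a

lemma exists_rough_of_lt_two_pow_11 {r : ℕ} (hr : r.Prime) (hr1 : 2 ^ 10 ≤ r) (hr2 : r < 2 ^ 11)
    (a : ℕ) : ∃ n, a < n ∧ n ≤ a + Nat.primeCounting r ^ 3 ∧ ∀ p, p.Prime → p < r → ¬ p ∣ n :=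
  exists_rough_of_blockBound (T₀ := 101) (L := 951394934 / 10 ^ 9) (V := 192 / 1001) (w := 6)
    (by norm_num) (by norm_num) (lt_of_lt_of_le (by norm_num) hr1) hr
    primesIoc_13_card primesIoc_13_prod
    blockBound_13_16 (BlockBound.refl 16)
    (blockBound_16_2048.sum_le_of_lt hr2)
    (by norm_num) (by norm_num) (by norm_num) (by norm_num) (le_primeCounting (k := 10) (by norm_num) (by norm_num) hr1)
    (by norm_num) (by norm_num) (by norm_num) (by norm_num) (by norm_num) a

lemma exists_rough_of_lt_two_pow_12 {r : ℕ} (hr : r.Prime) (hr1 : 2 ^ 11 ≤ r) (hr2 : r < 2 ^ 12)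
    (a : ℕ) : ∃ n, a < n ∧ n ≤ a + Nat.primeCounting r ^ 3 ∧ ∀ p, p.Prime → p < r → ¬ p ∣ n :=
  exists_rough_of_blockBound (T₀ := 185) (L := 816350558 / 10 ^ 9) (V := 4 / 15) (w := 3)
    (by norm_num) (by norm_num) (lt_of_lt_of_le (by norm_num) hr1) hr
    primesIoc_5_card primesIoc_5_prod
    blockBound_5_32 (BlockBound.refl 32)
    (blockBound_32_4096.sum_le_of_lt hr2)
    (by norm_num) (by norm_num) (by norm_num) (by norm_num) (le_primeCounting (k := 11) (by norm_num) (by norm_num) hr1)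
    (by norm_num) (by norm_num) (by norm_num) (by norm_num) (by norm_num) a

lemma exists_rough_of_lt_two_pow_13 {r : ℕ} (hr : r.Prime) (hr1 : 2 ^ 12 ≤ r) (hr2 : r < 2 ^ 13)
    (a : ℕ) : ∃ n, a < n ∧ n ≤ a + Nat.primeCounting r ^ 3 ∧ ∀ p, p.Prime → p < r → ¬ p ∣ n :=
  exists_rough_of_blockBound (T₀ := 340) (L := 895188509 / 10 ^ 9) (V := 4 / 15) (w := 3)
    (by norm_num) (by norm_num) (lt_of_lt_of_le (by norm_num) hr1) hr
    primesIoc_5_card primesIoc_5_prod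
    blockBound_5_32 (BlockBound.refl 32)
    (blockBound_32_8192.sum_le_of_lt hr2)
    (by norm_num) (by norm_num) (by norm_num) (by norm_num) (le_primeCounting (k := 12) (by norm_num) (by norm_num) hr1)
    (by norm_num) (by norm_num) (by norm_num) (by norm_num) (by norm_num) a

lemma exists_rough_of_lt_two_pow_14 {r : ℕ} (hr : r.Prime) (hr1 : 2 ^ 13 ≤ r) (hr2 : r < 2 ^ 14)
    (a : ℕ) : ∃ n, a < n ∧ n ≤ a + Nat.primeCounting r ^ 3 ∧ ∀ p, p.Prime → p < r → ¬ p ∣ n :=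
  exists_rough_of_blockBound (T₀ := 629) (L := 821116487 / 10 ^ 9) (V := 4 / 15) (w := 3)
    (by norm_num) (by norm_num) (lt_of_lt_of_le (by norm_num) hr1) hr
    primesIoc_5_card primesIoc_5_prod
    blockBound_5_64 (BlockBound.refl 64)
    (blockBound_64_16384.sum_le_of_lt hr2)
    (by norm_num) (by norm_num) (by norm_num) (by norm_num) (le_primeCounting (k := 13) (by norm_num) (by norm_num) hr1)
    (by norm_num) (by norm_num) (by norm_num) (by norm_num) (by norm_num) a

lemma exists_rough_of_lt_two_pow_15 {r : ℕ} (hr : r.Prime) (hr1 : 2 ^ 14 ≤ r) (hr2 : r < 2 ^ 15)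
    (a : ℕ) : ∃ n, a < n ∧ n ≤ a + Nat.primeCounting r ^ 3 ∧ ∀ p, p.Prime → p < r → ¬ p ∣ n :=
  exists_rough_of_blockBound (T₀ := 1169) (L := 889561343 / 10 ^ 9) (V := 8 / 35) (w := 4)
    (by norm_num) (by norm_num) (lt_of_lt_of_le (by norm_num) hr1) hr
    primesIoc_7_card primesIoc_7_prod
    blockBound_7_64 (BlockBound.refl 64)
    (blockBound_64_32768.sum_le_of_lt hr2)
    (by norm_num) (by norm_num) (by norm_num) (by norm_num) (le_primeCounting (k := 14) (by norm_num) (by norm_num) hr1)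
    (by norm_num) (by norm_num) (by norm_num) (by norm_num) (by norm_num) a

lemma exists_rough_of_lt_two_pow_16 {r : ℕ} (hr : r.Prime) (hr1 : 2 ^ 15 ≤ r) (hr2 : r < 2 ^ 16)
    (a : ℕ) : ∃ n, a < n ∧ n ≤ a + Nat.primeCounting r ^ 3 ∧ ∀ p, p.Prime → p < r → ¬ p ∣ n :=
  exists_rough_of_blockBound (T₀ := 2183) (L := 803587 / 1000000) (V := 16 / 77) (w := 5)
    (by norm_num) (by norm_num) (lt_of_lt_of_le (by norm_num) hr1) hr
    primesIoc_11_card primesIoc_11_prod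
    (BlockBound.refl 11) blockBound_11_256
    (blockBound_256_32768.sum_le_of_log (n := 16) (a := 247) (b := 23) hr1 hr2 (by norm_num)
      (by norm_num) (by norm_num) (by norm_num))
    (by norm_num) (by norm_num) (by norm_num) (by norm_num) (le_primeCounting (k := 15) (by norm_num) (by norm_num) hr1)
    (by norm_num) (by norm_num) (by norm_num) (by norm_num) (by norm_num) a

lemma exists_rough_of_lt_two_pow_17 {r : ℕ} (hr : r.Prime) (hr1 : 2 ^ 16 ≤ r) (hr2 : r < 2 ^ 17)
    (a : ℕ) : ∃ n, a < n ∧ n ≤ a + Nat.primeCounting r ^ 3 ∧ ∀ p, p.Prime → p < r → ¬ p ∣ n :=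
  exists_rough_of_blockBound (T₀ := 4094) (L := 216059 / 250000) (V := 4 / 15) (w := 3)
    (by norm_num) (by norm_num) (lt_of_lt_of_le (by norm_num) hr1) hr
    primesIoc_5_card primesIoc_5_prod
    blockBound_5_16 blockBound_16_256
    (blockBound_256_32768.sum_le_of_log (n := 17) (a := 227) (b := 41) hr1 hr2 (by norm_num)
      (by norm_num) (by norm_num) (by norm_num))
    (by norm_num) (by norm_num) (by norm_num) (by norm_num) (le_primeCounting (k := 16) (by norm_num) (by norm_num) hr1)
    (by norm_num) (by norm_num) (by norm_num) (by norm_num) (by norm_num) a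

lemma exists_rough_of_lt_two_pow_18 {r : ℕ} (hr : r.Prime) (hr1 : 2 ^ 17 ≤ r) (hr2 : r < 2 ^ 18)
    (a : ℕ) : ∃ n, a < n ∧ n ≤ a + Nat.primeCounting r ^ 3 ∧ ∀ p, p.Prime → p < r → ¬ p ∣ n :=
  exists_rough_of_blockBound (T₀ := 7709) (L := 804427 / 1000000) (V := 4 / 15) (w := 3)
    (by norm_num) (by norm_num) (lt_of_lt_of_le (by norm_num) hr1) hr
    primesIoc_5_card primesIoc_5_prod
    blockBound_5_16 blockBound_16_512
    (blockBound_512_32768.sum_le_of_log (n := 18) (a := 19) (b := 5) hr1 hr2 (by norm_num)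
      (by norm_num) (by norm_num) (by norm_num))
    (by norm_num) (by norm_num) (by norm_num) (by norm_num) (le_primeCounting (k := 17) (by norm_num) (by norm_num) hr1)
    (by norm_num) (by norm_num) (by norm_num) (by norm_num) (by norm_num) a

lemma exists_rough_of_lt_two_pow_19 {r : ℕ} (hr : r.Prime) (hr1 : 2 ^ 18 ≤ r) (hr2 : r < 2 ^ 19)
    (a : ℕ) : ∃ n, a < n ∧ n ≤ a + Nat.primeCounting r ^ 3 ∧ ∀ p, p.Prime → p < r → ¬ p ∣ n :=
  exists_rough_of_blockBound (T₀ := 14562) (L := 858411 / 1000000) (V := 4 / 15) (w := 3)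
    (by norm_num) (by norm_num) (lt_of_lt_of_le (by norm_num) hr1) hr
    primesIoc_5_card primesIoc_5_prod
    blockBound_5_32 blockBound_32_512
    (blockBound_512_32768.sum_le_of_log (n := 19) (a := 173) (b := 59) hr1 hr2 (by norm_num)
      (by norm_num) (by norm_num) (by norm_num))
    (by norm_num) (by norm_num) (by norm_num) (by norm_num) (le_primeCounting (k := 18) (by norm_num) (by norm_num) hr1)
    (by norm_num) (by norm_num) (by norm_num) (by norm_num) (by norm_num) a

lemma exists_rough_of_lt_two_pow_20 {r : ℕ} (hr : r.Prime) (hr1 : 2 ^ 19 ≤ r) (hr2 : r < 2 ^ 20)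
    (a : ℕ) : ∃ n, a < n ∧ n ≤ a + Nat.primeCounting r ^ 3 ∧ ∀ p, p.Prime → p < r → ¬ p ∣ n :=
  exists_rough_of_blockBound (T₀ := 27593) (L := 909741 / 1000000) (V := 8 / 35) (w := 4)
    (by norm_num) (by norm_num) (lt_of_lt_of_le (by norm_num) hr1) hr
    primesIoc_7_card primesIoc_7_prod
    blockBound_7_32 blockBound_32_512
    (blockBound_512_32768.sum_le_of_log (n := 20) (a := 53) (b := 22) hr1 hr2 (by norm_num)
      (by norm_num) (by norm_num) (by norm_num))
    (by norm_num) (by norm_num) (by norm_num) (by norm_num) (le_primeCounting (k := 19) (by norm_num) (by norm_num) hr1)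
    (by norm_num) (by norm_num) (by norm_num) (by norm_num) (by norm_num) a

lemma exists_rough_of_lt_two_pow_21 {r : ℕ} (hr : r.Prime) (hr1 : 2 ^ 20 ≤ r) (hr2 : r < 2 ^ 21)
    (a : ℕ) : ∃ n, a < n ∧ n ≤ a + Nat.primeCounting r ^ 3 ∧ ∀ p, p.Prime → p < r → ¬ p ∣ n :=
  exists_rough_of_blockBound (T₀ := 52427) (L := 428571 / 500000) (V := 8 / 35) (w := 4)
    (by norm_num) (by norm_num) (lt_of_lt_of_le (by norm_num) hr1) hr
    primesIoc_7_card primesIoc_7_prod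
    blockBound_7_32 blockBound_32_1024
    (blockBound_1024_32768.sum_le_of_log (n := 21) (a := 103) (b := 50) hr1 hr2 (by norm_num)
      (by norm_num) (by norm_num) (by norm_num))
    (by norm_num) (by norm_num) (by norm_num) (by norm_num) (le_primeCounting (k := 20) (by norm_num) (by norm_num) hr1)
    (by norm_num) (by norm_num) (by norm_num) (by norm_num) (by norm_num) a

lemma exists_rough_of_lt_two_pow_22 {r : ℕ} (hr : r.Prime) (hr1 : 2 ^ 21 ≤ r) (hr2 : r < 2 ^ 22)
    (a : ℕ) : ∃ n, a < n ∧ n ≤ a + Nat.primeCounting r ^ 3 ∧ ∀ p, p.Prime → p < r → ¬ p ∣ n :=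
  exists_rough_of_blockBound (T₀ := 99863) (L := 810319 / 1000000) (V := 8 / 35) (w := 4)
    (by norm_num) (by norm_num) (lt_of_lt_of_le (by norm_num) hr1) hr
    primesIoc_7_card primesIoc_7_prod
    blockBound_7_32 blockBound_32_2048
    (blockBound_2048_32768.sum_le_of_log (n := 22) (a := 38) (b := 21) hr1 hr2 (by norm_num)
      (by norm_num) (by norm_num) (by norm_num))
    (by norm_num) (by norm_num) (by norm_num) (by norm_num) (le_primeCounting (k := 21) (by norm_num) (by norm_num) hr1)
    (by norm_num) (by norm_num) (by norm_num) (by norm_num) (by norm_num) a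

lemma exists_rough_of_lt_two_pow_23 {r : ℕ} (hr : r.Prime) (hr1 : 2 ^ 22 ≤ r) (hr2 : r < 2 ^ 23)
    (a : ℕ) : ∃ n, a < n ∧ n ≤ a + Nat.primeCounting r ^ 3 ∧ ∀ p, p.Prime → p < r → ¬ p ∣ n :=
  exists_rough_of_blockBound (T₀ := 190649) (L := 213689 / 250000) (V := 8 / 35) (w := 4)
    (by norm_num) (by norm_num) (lt_of_lt_of_le (by norm_num) hr1) hr
    primesIoc_7_card primesIoc_7_prod
    blockBound_7_64 blockBound_64_2048
    (blockBound_2048_32768.sum_le_of_log (n := 23) (a := 227) (b := 140) hr1 hr2 (by norm_num)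
      (by norm_num) (by norm_num) (by norm_num))
    (by norm_num) (by norm_num) (by norm_num) (by norm_num) (le_primeCounting (k := 22) (by norm_num) (by norm_num) hr1)
    (by norm_num) (by norm_num) (by norm_num) (by norm_num) (by norm_num) a

lemma exists_rough_of_lt_two_pow_24 {r : ℕ} (hr : r.Prime) (hr1 : 2 ^ 23 ≤ r) (hr2 : r < 2 ^ 24)
    (a : ℕ) : ∃ n, a < n ∧ n ≤ a + Nat.primeCounting r ^ 3 ∧ ∀ p, p.Prime → p < r → ¬ p ∣ n :=
  exists_rough_of_blockBound (T₀ := 364721) (L := 162129 / 200000) (V := 8 / 35) (w := 4)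
    (by norm_num) (by norm_num) (lt_of_lt_of_le (by norm_num) hr1) hr
    primesIoc_7_card primesIoc_7_prod
    blockBound_7_64 blockBound_64_4096
    (blockBound_4096_32768.sum_le_of_log (n := 24) (a := 146) (b := 99) hr1 hr2 (by norm_num)
      (by norm_num) (by norm_num) (by norm_num))
    (by norm_num) (by norm_num) (by norm_num) (by norm_num) (le_primeCounting (k := 23) (by norm_num) (by norm_num) hr1)
    (by norm_num) (by norm_num) (by norm_num) (by norm_num) (by norm_num) a

lemma exists_rough_of_lt_two_pow_25 {r : ℕ} (hr : r.Prime) (hr1 : 2 ^ 24 ≤ r) (hr2 : r < 2 ^ 25)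
    (a : ℕ) : ∃ n, a < n ∧ n ≤ a + Nat.primeCounting r ^ 3 ∧ ∀ p, p.Prime → p < r → ¬ p ∣ n :=
  exists_rough_of_blockBound (T₀ := 699049) (L := 212883 / 250000) (V := 16 / 77) (w := 5)
    (by norm_num) (by norm_num) (lt_of_lt_of_le (by norm_num) hr1) hr
    primesIoc_11_card primesIoc_11_prod
    blockBound_11_64 blockBound_64_4096
    (blockBound_4096_32768.sum_le_of_log (n := 25) (a := 232) (b := 171) hr1 hr2 (by norm_num)
      (by norm_num) (by norm_num) (by norm_num))
    (by norm_num) (by norm_num) (by norm_num) (by norm_num) (le_primeCounting (k := 24) (by norm_num) (by norm_num) hr1)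
    (by norm_num) (by norm_num) (by norm_num) (by norm_num) (by norm_num) a

lemma exists_rough_of_lt_two_pow_26 {r : ℕ} (hr : r.Prime) (hr1 : 2 ^ 25 ≤ r) (hr2 : r < 2 ^ 26)
    (a : ℕ) : ∃ n, a < n ∧ n ≤ a + Nat.primeCounting r ^ 3 ∧ ∀ p, p.Prime → p < r → ¬ p ∣ n :=
  exists_rough_of_blockBound (T₀ := 1342176) (L := 811863 / 1000000) (V := 16 / 77) (w := 5)
    (by norm_num) (by norm_num) (lt_of_lt_of_le (by norm_num) hr1) hr
    primesIoc_11_card primesIoc_11_prod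
    blockBound_11_64 blockBound_64_8192
    (blockBound_8192_32768.sum_le_of_log (n := 26) (a := 218) (b := 173) hr1 hr2 (by norm_num)
      (by norm_num) (by norm_num) (by norm_num))
    (by norm_num) (by norm_num) (by norm_num) (by norm_num) (le_primeCounting (k := 25) (by norm_num) (by norm_num) hr1)
    (by norm_num) (by norm_num) (by norm_num) (by norm_num) (by norm_num) a

lemma exists_rough_of_lt_two_pow_27 {r : ℕ} (hr : r.Prime) (hr1 : 2 ^ 26 ≤ r) (hr2 : r < 2 ^ 27)
    (a : ℕ) : ∃ n, a < n ∧ n ≤ a + Nat.primeCounting r ^ 3 ∧ ∀ p, p.Prime → p < r → ¬ p ∣ n :=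
  exists_rough_of_blockBound (T₀ := 2581109) (L := 169917 / 200000) (V := 16 / 77) (w := 5)
    (by norm_num) (by norm_num) (lt_of_lt_of_le (by norm_num) hr1) hr
    primesIoc_11_card primesIoc_11_prod
    blockBound_11_128 blockBound_128_8192
    (blockBound_8192_32768.sum_le_of_log (n := 27) (a := 125) (b := 106) hr1 hr2 (by norm_num)
      (by norm_num) (by norm_num) (by norm_num))
    (by norm_num) (by norm_num) (by norm_num) (by norm_num) (le_primeCounting (k := 26) (by norm_num) (by norm_num) hr1)
    (by norm_num) (by norm_num) (by norm_num) (by norm_num) (by norm_num) a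

lemma exists_rough_of_lt_two_pow_28 {r : ℕ} (hr : r.Prime) (hr1 : 2 ^ 27 ≤ r) (hr2 : r < 2 ^ 28)
    (a : ℕ) : ∃ n, a < n ∧ n ≤ a + Nat.primeCounting r ^ 3 ∧ ∀ p, p.Prime → p < r → ¬ p ∣ n :=
  exists_rough_of_blockBound (T₀ := 4971025) (L := 811869 / 1000000) (V := 16 / 77) (w := 5)
    (by norm_num) (by norm_num) (lt_of_lt_of_le (by norm_num) hr1) hr
    primesIoc_11_card primesIoc_11_prod
    blockBound_11_128 blockBound_128_16384
    (blockBound_16384_32768.sum_le_of_log (n := 28) (a := 211) (b := 190) hr1 hr2 (by norm_num)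
      (by norm_num) (by norm_num) (by norm_num))
    (by norm_num) (by norm_num) (by norm_num) (by norm_num) (le_primeCounting (k := 27) (by norm_num) (by norm_num) hr1)
    (by norm_num) (by norm_num) (by norm_num) (by norm_num) (by norm_num) a

lemma exists_rough_of_lt_two_pow_29 {r : ℕ} (hr : r.Prime) (hr1 : 2 ^ 28 ≤ r) (hr2 : r < 2 ^ 29)
    (a : ℕ) : ∃ n, a < n ∧ n ≤ a + Nat.primeCounting r ^ 3 ∧ ∀ p, p.Prime → p < r → ¬ p ∣ n :=
  exists_rough_of_blockBound (T₀ := 9586979) (L := 105871 / 125000) (V := 192 / 1001) (w := 6)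
    (by norm_num) (by norm_num) (lt_of_lt_of_le (by norm_num) hr1) hr
    primesIoc_13_card primesIoc_13_prod
    blockBound_13_128 blockBound_128_16384
    (blockBound_16384_32768.sum_le_of_log (n := 29) (a := 225) (b := 214) hr1 hr2 (by norm_num)
      (by norm_num) (by norm_num) (by norm_num))
    (by norm_num) (by norm_num) (by norm_num) (by norm_num) (le_primeCounting (k := 28) (by norm_num) (by norm_num) hr1)
    (by norm_num) (by norm_num) (by norm_num) (by norm_num) (by norm_num) a

lemma exists_rough_of_lt_two_pow_30 {r : ℕ} (hr : r.Prime) (hr1 : 2 ^ 29 ≤ r) (hr2 : r < 2 ^ 30)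
    (a : ℕ) : ∃ n, a < n ∧ n ≤ a + Nat.primeCounting r ^ 3 ∧ ∀ p, p.Prime → p < r → ¬ p ∣ n :=
  exists_rough_of_blockBound (T₀ := 18512789) (L := 81241 / 100000) (V := 192 / 1001) (w := 6)
    (by norm_num) (by norm_num) (lt_of_lt_of_le (by norm_num) hr1) hr
    primesIoc_13_card primesIoc_13_prod
    blockBound_13_128 blockBound_128_32768
    ((BlockBound.refl 32768).sum_le_of_log (n := 30) (a := 1) (b := 1) hr1 hr2 (by norm_num)
      (by norm_num) (by norm_num) (by norm_num))
    (by norm_num) (by norm_num) (by norm_num) (by norm_num) (le_primeCounting (k := 29) (by norm_num) (by norm_num) hr1)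
    (by norm_num) (by norm_num) (by norm_num) (by norm_num) (by norm_num) a

lemma exists_rough_of_two_pow_lt {r : ℕ} {T : ℕ} {V : ℝ} (hr : 2 ≤ r)
    (hT : Nat.primeCounting r = T) (hV : ∏ p ∈ primesIoc 0 (r - 1), (1 - 1 / (p : ℝ)) = V)
    (h : (2 : ℝ) ^ (primesIoc 0 (r - 1)).card < T ^ 3 * V) (a : ℕ) :
    ∃ n, a < n ∧ n ≤ a + Nat.primeCounting r ^ 3 ∧ ∀ p, p.Prime → p < r → ¬ p ∣ n := by
  have he : ∀ k, esymmInv (k + 1) ∅ = 0 := fun k => by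
    rw [esymmInv, Finset.powersetCard_eq_empty.2 (by simp), Finset.sum_empty]
  obtain ⟨n, h1, h2, h3⟩ := exists_forall_not_dvd_of_blocks (W := primesIoc 0 (r - 1))
    (R := ∅) (Q := ∅) (P := ∅) (fun p hp => (mem_primesIoc.1 hp).2.2) (by simp) (by simp)
    (by simp) (by simp) (by simp) (by simp) (by simp) a (T ^ 3) (by
      rw [hV, he 0, he 1, he 2]
      simpa using h)
  refine ⟨n, h1, by rw [hT]; exact h2, fun p hp hpr => h3 p ?_⟩
  simp only [Finset.union_empty, mem_primesIoc]
  exact ⟨hp.pos, by omega, hp⟩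

lemma exists_rough_3 (a : ℕ) : ∃ n, a < n ∧ n ≤ a + Nat.primeCounting 3 ^ 3 ∧
    ∀ p, p.Prime → p < 3 → ¬ p ∣ n := by
  have hs : primesIoc 0 (3 - 1) = {2} := by decide
  refine exists_rough_of_two_pow_lt (T := 2) (V := 1 / 2) (by norm_num)
    (by decide) ?_ ?_ a
  · rw [hs]
    norm_num
  · rw [show (primesIoc 0 (3 - 1)).card = 1 by decide]
    norm_num

lemma exists_rough_5 (a : ℕ) : ∃ n, a < n ∧ n ≤ a + Nat.primeCounting 5 ^ 3 ∧
    ∀ p, p.Prime → p < 5 → ¬ p ∣ n := by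
  have hs : primesIoc 0 (5 - 1) = {2, 3} := by decide
  refine exists_rough_of_two_pow_lt (T := 3) (V := 1 / 3) (by norm_num)
    (by decide) ?_ ?_ a
  · rw [hs]
    repeat rw [Finset.prod_insert (by decide)]
    norm_num
  · rw [show (primesIoc 0 (5 - 1)).card = 2 by decide]
    norm_num

lemma exists_rough_7 (a : ℕ) : ∃ n, a < n ∧ n ≤ a + Nat.primeCounting 7 ^ 3 ∧
    ∀ p, p.Prime → p < 7 → ¬ p ∣ n := by
  have hs : primesIoc 0 (7 - 1) = {2, 3, 5} := by decide
  refine exists_rough_of_two_pow_lt (T := 4) (V := 4 / 15) (by norm_num)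
    (by decide) ?_ ?_ a
  · rw [hs]
    repeat rw [Finset.prod_insert (by decide)]
    norm_num
  · rw [show (primesIoc 0 (7 - 1)).card = 3 by decide]
    norm_num

lemma exists_rough_11 (a : ℕ) : ∃ n, a < n ∧ n ≤ a + Nat.primeCounting 11 ^ 3 ∧
    ∀ p, p.Prime → p < 11 → ¬ p ∣ n := by
  have hs : primesIoc 0 (11 - 1) = {2, 3, 5, 7} := by decide
  refine exists_rough_of_two_pow_lt (T := 5) (V := 8 / 35) (by norm_num)
    (by decide) ?_ ?_ a
  · rw [hs]
    repeat rw [Finset.prod_insert (by decide)]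
    norm_num
  · rw [show (primesIoc 0 (11 - 1)).card = 4 by decide]
    norm_num

lemma exists_rough_13 (a : ℕ) : ∃ n, a < n ∧ n ≤ a + Nat.primeCounting 13 ^ 3 ∧
    ∀ p, p.Prime → p < 13 → ¬ p ∣ n := by
  have hs : primesIoc 0 (13 - 1) = {2, 3, 5, 7, 11} := by decide
  refine exists_rough_of_two_pow_lt (T := 6) (V := 16 / 77) (by norm_num)
    (by decide) ?_ ?_ a
  · rw [hs]
    repeat rw [Finset.prod_insert (by decide)]
    norm_num
  · rw [show (primesIoc 0 (13 - 1)).card = 5 by decide]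
    norm_num

lemma exists_rough_of_prime {r : ℕ} (hrp : r.Prime) (hr : 3 ≤ r) (a : ℕ) :
    ∃ n, a < n ∧ n ≤ a + Nat.primeCounting r ^ 3 ∧ ∀ p, p.Prime → p < r → ¬ p ∣ n := by
  rcases Nat.lt_or_ge r 17 with h | h17
  · interval_cases r
    all_goals first
      | exact absurd hrp (by decide)
      | exact exists_rough_3 a
      | exact exists_rough_5 a
      | exact exists_rough_7 a
      | exact exists_rough_11 a
      | exact exists_rough_13 a
  rcases Nat.lt_or_ge r (2 ^ 5) with h | h5
  · exact exists_rough_of_lt_two_pow_5 hrp h17 h a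
  rcases Nat.lt_or_ge r (2 ^ 6) with h | h6
  · exact exists_rough_of_lt_two_pow_6 hrp h5 h a
  rcases Nat.lt_or_ge r (2 ^ 7) with h | h7
  · exact exists_rough_of_lt_two_pow_7 hrp h6 h a
  rcases Nat.lt_or_ge r (2 ^ 8) with h | h8
  · exact exists_rough_of_lt_two_pow_8 hrp h7 h a
  rcases Nat.lt_or_ge r (2 ^ 9) with h | h9
  · exact exists_rough_of_lt_two_pow_9 hrp h8 h a
  rcases Nat.lt_or_ge r (2 ^ 10) with h | h10
  · exact exists_rough_of_lt_two_pow_10 hrp h9 h a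
  rcases Nat.lt_or_ge r (2 ^ 11) with h | h11
  · exact exists_rough_of_lt_two_pow_11 hrp h10 h a
  rcases Nat.lt_or_ge r (2 ^ 12) with h | h12
  · exact exists_rough_of_lt_two_pow_12 hrp h11 h a
  rcases Nat.lt_or_ge r (2 ^ 13) with h | h13
  · exact exists_rough_of_lt_two_pow_13 hrp h12 h a
  rcases Nat.lt_or_ge r (2 ^ 14) with h | h14
  · exact exists_rough_of_lt_two_pow_14 hrp h13 h a
  rcases Nat.lt_or_ge r (2 ^ 15) with h | h15
  · exact exists_rough_of_lt_two_pow_15 hrp h14 h a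
  rcases Nat.lt_or_ge r (2 ^ 16) with h | h16
  · exact exists_rough_of_lt_two_pow_16 hrp h15 h a
  rcases Nat.lt_or_ge r (2 ^ 17) with h | h17
  · exact exists_rough_of_lt_two_pow_17 hrp h16 h a
  rcases Nat.lt_or_ge r (2 ^ 18) with h | h18
  · exact exists_rough_of_lt_two_pow_18 hrp h17 h a
  rcases Nat.lt_or_ge r (2 ^ 19) with h | h19
  · exact exists_rough_of_lt_two_pow_19 hrp h18 h a
  rcases Nat.lt_or_ge r (2 ^ 20) with h | h20
  · exact exists_rough_of_lt_two_pow_20 hrp h19 h a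
  rcases Nat.lt_or_ge r (2 ^ 21) with h | h21
  · exact exists_rough_of_lt_two_pow_21 hrp h20 h a
  rcases Nat.lt_or_ge r (2 ^ 22) with h | h22
  · exact exists_rough_of_lt_two_pow_22 hrp h21 h a
  rcases Nat.lt_or_ge r (2 ^ 23) with h | h23
  · exact exists_rough_of_lt_two_pow_23 hrp h22 h a
  rcases Nat.lt_or_ge r (2 ^ 24) with h | h24
  · exact exists_rough_of_lt_two_pow_24 hrp h23 h a
  rcases Nat.lt_or_ge r (2 ^ 25) with h | h25
  · exact exists_rough_of_lt_two_pow_25 hrp h24 h a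
  rcases Nat.lt_or_ge r (2 ^ 26) with h | h26
  · exact exists_rough_of_lt_two_pow_26 hrp h25 h a
  rcases Nat.lt_or_ge r (2 ^ 27) with h | h27
  · exact exists_rough_of_lt_two_pow_27 hrp h26 h a
  rcases Nat.lt_or_ge r (2 ^ 28) with h | h28
  · exact exists_rough_of_lt_two_pow_28 hrp h27 h a
  rcases Nat.lt_or_ge r (2 ^ 29) with h | h29
  · exact exists_rough_of_lt_two_pow_29 hrp h28 h a
  rcases Nat.lt_or_ge r (2 ^ 30) with h | h30
  · exact exists_rough_of_lt_two_pow_30 hrp h29 h a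
  exact exists_rough_of_large h30 a

lemma vdw_lower {k r m n : ℕ} (hr : 3 ≤ r) (hm : 1 ≤ m) (hmk : m < k)
    (hcop : ∀ d, 1 ≤ d → d < r → Nat.Coprime d (k - m))
    (hone : m = 1 → r ∣ k - m)
    (hn : n < r * k - m * (r - 2)) : ¬ vdwProp r (twoColors k) n := by
  obtain ⟨q, rfl⟩ : ∃ q, k = q + m := ⟨k - m, by omega⟩
  obtain ⟨s, rfl⟩ : ∃ s, r = s + 2 := ⟨r - 2, by omega⟩
  simp only [Nat.add_sub_cancel] at *
  have hq : 0 < q := by omega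
  have hn' : n + 1 ≤ (s + 2) * q + 2 * m := by
    have : (s + 2) * (q + m) - m * s = (s + 2) * q + 2 * m := by
      rw [Nat.sub_eq_iff_eq_add (by nlinarith)]; ring
    omega
  intro h
  let χ : ℕ → ℕ := fun x => if m < x ∧ q ∣ x - m ∧ (x - m) / q < s + 2 then (x - m) / q else 0
  have hχ : ∀ i, 1 ≤ i → i < s + 2 → χ (m + i * q) = i := by
    intro i h1 h2
    have h3 : (m + i * q - m) / q = i := by
      rw [Nat.add_sub_cancel_left, Nat.mul_div_cancel _ hq]
    have h4 : m < m + i * q := by have := Nat.mul_pos h1 hq; omega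
    have h5 : q ∣ m + i * q - m := by rw [Nat.add_sub_cancel_left]; exact dvd_mul_left _ _
    simp only [χ]
    rw [if_pos ⟨h4, h5, by omega⟩, h3]
  have hχ' : ∀ x i, 1 ≤ i → χ x = i → x = m + i * q := by
    intro x i hi hx
    simp only [χ] at hx
    split_ifs at hx with hc
    · obtain ⟨c, hc'⟩ := hc.2.1
      rw [hc', Nat.mul_div_cancel_left _ hq] at hx
      subst hx
      rw [mul_comm]; omega
    · omega
  obtain ⟨i, hi, a, ha, d, hd, hle, hall⟩ := h χ (by
    intro x _ _
    simp only [χ]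
    split_ifs with hc
    · exact hc.2.2
    · omega)
  rcases Nat.eq_zero_or_pos i with rfl | hi0
  · simp only [twoColors, if_true] at hle hall
    rcases Nat.lt_or_ge d (s + 2) with hds | hds
    · obtain ⟨t0, ht0, hmin⟩ : ∃ t0, m < a + t0 * d ∧ ∀ t < t0, a + t * d ≤ m := by
        have hex : ∃ t, m < a + t * d := ⟨m, by nlinarith⟩
        classical
        exact ⟨Nat.find hex, Nat.find_spec hex, fun t ht => not_lt.1 (Nat.find_min hex ht)⟩
      have ht0m : t0 ≤ m := by
        by_contra hcon
        have := hmin m (by omega)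
        nlinarith
      -- a hit in the window
      obtain ⟨t, ht1, ht2, y, hy⟩ : ∃ t, t0 ≤ t ∧ t < t0 + q ∧ ∃ y, a + t * d = m + y * q := by
        have hc := hcop d hd hds
        obtain ⟨u, hu⟩ : ∃ u : ℕ, (u * d) % q = (m + q * (a + t0 * d) - (a + t0 * d)) % q := by
          obtain ⟨u, hu⟩ := Nat.exists_mul_mod_eq_of_coprime
            ((m + q * (a + t0 * d) - (a + t0 * d))) hc hq.ne'
          exact ⟨u, by rw [mul_comm]; exact hu.2⟩
        refine ⟨t0 + u % q, by omega, by have := Nat.mod_lt u hq; omega, ?_⟩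
        have hmod : (a + (t0 + u % q) * d) ≡ m [MOD q] := by
          have e1 : u % q * d ≡ m + q * (a + t0 * d) - (a + t0 * d) [MOD q] :=
            ((Nat.mod_modEq u q).mul_right d).trans hu
          have e2 : a + (t0 + u % q) * d = (a + t0 * d) + u % q * d := by ring
          rw [e2]
          refine (e1.add_left _).trans ?_
          have : a + t0 * d + (m + q * (a + t0 * d) - (a + t0 * d)) = m + q * (a + t0 * d) := by
            have : a + t0 * d ≤ q * (a + t0 * d) := Nat.le_mul_of_pos_left _ hq
            omega
          rw [this]
          simp [Nat.ModEq]
        have hge : m ≤ a + (t0 + u % q) * d := by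
          have : a + (t0 + u % q) * d = (a + t0 * d) + u % q * d := by ring
          omega
        obtain ⟨y, hy⟩ := (Nat.modEq_iff_dvd' hge).1 hmod.symm
        exact ⟨y, by rw [mul_comm y q, ← hy]; omega⟩
      have htk : t < q + m := by omega
      have h0 := hall t htk
      rw [hy] at h0
      have hy1 : 1 ≤ y := by
        by_contra hcon
        have hy0 : y = 0 := by omega
        subst hy0
        have : t0 * d ≤ t * d := Nat.mul_le_mul_right _ ht1
        omega
      have hys : y < s + 2 := by
        by_contra hcon
        have hcon' : (s + 2) * q ≤ y * q := Nat.mul_le_mul_right _ (by omega)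
        rcases Nat.eq_zero_or_pos t0 with h00 | h00
        · subst h00
          obtain ⟨u, hu⟩ : ∃ u, q + m - 1 = t + u := ⟨q + m - 1 - t, by omega⟩
          rw [hu] at hle
          have hu' : u ≤ u * d := Nat.le_mul_of_pos_right _ hd
          have : (t + u) * d = t * d + u * d := by ring
          omega
        · have h1 := hmin (t0 - 1) (by omega)
          obtain ⟨w, rfl⟩ : ∃ w, t0 = w + 1 := ⟨t0 - 1, by omega⟩
          simp only [Nat.add_sub_cancel] at h1
          obtain ⟨v, rfl⟩ : ∃ v, t = w + v := ⟨t - w, by omega⟩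
          have hv : v ≤ q := by omega
          have : v * d < q * (s + 2) := Nat.mul_lt_mul_of_le_of_lt hv hds hq
          nlinarith
      have := hχ y hy1 hys
      omega
    · have hm1 : m = 1 := by
        by_contra hcon
        obtain ⟨c, rfl⟩ : ∃ c, m = c + 2 := ⟨m - 2, by omega⟩
        have : (q + (c + 2) - 1) * (s + 2) ≤ (q + (c + 2) - 1) * d := Nat.mul_le_mul_left _ hds
        have e : q + (c + 2) - 1 = q + c + 1 := by omega
        rw [e] at this hle
        nlinarith
      subst hm1
      simp only [Nat.add_sub_cancel] at *
      have hds' : d = s + 2 := by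
        by_contra hcon
        have : q * (s + 3) ≤ q * d := Nat.mul_le_mul_left _ (by omega)
        nlinarith
      subst hds'
      have ha1 : a = 1 := by nlinarith
      subst ha1
      obtain ⟨c, hc⟩ := hone trivial
      have hcq : c < q + 1 := by nlinarith
      have h1 := hall c hcq
      rw [show 1 + c * (s + 2) = 1 + 1 * q by rw [hc]; ring] at h1
      have := hχ 1 le_rfl (by omega)
      omega
  · have hi' : i ≠ 0 := by omega
    simp only [twoColors, hi', if_false] at hle hall
    have h0 := hχ' _ _ hi0 (hall 0 (by omega))
    have h1 := hχ' _ _ hi0 (hall 1 (by omega))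
    omega

lemma vdw_upper {k r m : ℕ} (hr : 3 ≤ r) (hm : 1 ≤ m) (hmk : m * (r - 2) ≤ k)
    (hfac : ∀ i < m, ∃ p, p.Prime ∧ p < r ∧ p ∣ k - i) :
    vdwProp r (twoColors k) (r * k - m * (r - 2)) := by
  classical
  intro χ hχ
  by_contra hno
  push Not at hno
  set n := r * k - m * (r - 2) with hn
  have hmk' : m ≤ k := le_trans (Nat.le_mul_of_pos_right _ (by omega)) hmk
  have hk0 : 0 < k := by omega
  have hrk : n + m * (r - 2) = r * k := by
    have : m * (r - 2) ≤ r * k := hmk.trans (Nat.le_mul_of_pos_left _ (by omega))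
    omega
  have hrn : r - 1 ≤ n := by
    have h1 : (r - 1) * k + k = r * k := by
      obtain ⟨s, rfl⟩ : ∃ s, r = s + 1 := ⟨r - 1, by omega⟩
      simp; ring
    have h2 : r - 1 ≤ (r - 1) * k := Nat.le_mul_of_pos_right _ hk0
    omega
  -- nonzero colors are used at most once
  have hinj : Set.InjOn χ ↑((Finset.Icc 1 n).filter (fun x => χ x ≠ 0)) := by
    have key : ∀ x y, 1 ≤ x → y ≤ n → χ x ≠ 0 → χ x = χ y → x < y → False := by
      intro x y hx hy h0 hxy hlt
      obtain ⟨t, ht, hne⟩ := hno (χ x) (hχ x hx (by omega)) x hx (y - x) (by omega)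
        (by simp only [twoColors, if_neg h0]; omega)
      simp only [twoColors, if_neg h0] at ht
      interval_cases t
      · simp at hne
      · apply hne
        rw [one_mul, Nat.add_sub_cancel' hlt.le, hxy]
    intro x hx y hy hxy
    simp only [Finset.coe_filter, Finset.mem_Icc, Set.mem_ofPred_eq] at hx hy
    rcases lt_trichotomy x y with h | h | h
    · exact (key x y hx.1.1 hy.1.2 hx.2 hxy h).elim
    · exact h
    · exact (key y x hy.1.1 hx.1.2 hy.2 hxy.symm h).elim
  have hcard : ((Finset.Icc 1 n).filter (fun x => χ x ≠ 0)).card ≤ r - 1 := by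
    have : ((Finset.Icc 1 n).filter (fun x => χ x ≠ 0)).card ≤ (Finset.Ico 1 r).card := by
      refine Finset.card_le_card_of_injOn χ ?_ hinj
      intro x hx
      simp only [Finset.coe_filter, Finset.mem_Icc, Set.mem_ofPred_eq] at hx
      simp only [Finset.coe_Ico, Set.mem_Ico]
      exact ⟨Nat.one_le_iff_ne_zero.2 hx.2, hχ x hx.1.1 hx.1.2⟩
    simpa using this
  obtain ⟨S, hS1, hS2, hS3⟩ := Finset.exists_subsuperset_card_eq
    (Finset.filter_subset _ _) hcard (by simpa using hrn)
  -- every AP hits S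
  have hhit : ∀ a d, 1 ≤ a → 1 ≤ d → a + (k - 1) * d ≤ n → ∃ t < k, a + t * d ∈ S := by
    intro a d ha hd hle
    obtain ⟨t, ht, hne⟩ := hno 0 (by omega) a ha d hd (by simpa [twoColors] using hle)
    simp only [twoColors, if_true] at ht
    refine ⟨t, ht, hS1 ?_⟩
    simp only [Finset.mem_filter, Finset.mem_Icc]
    have : t * d ≤ (k - 1) * d := Nat.mul_le_mul_right _ (by omega)
    exact ⟨⟨by omega, by omega⟩, hne⟩
  let e := S.orderEmbOfFin hS3
  let f : ℕ → ℕ := fun i => if h : 1 ≤ i ∧ i < r then e ⟨i - 1, by omega⟩ else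
    if i = 0 then 0 else n + 1
  have hf0 : f 0 = 0 := by simp [f]
  have hfr : f r = n + 1 := by simp [f]; omega
  have hfm : ∀ i, 1 ≤ i → i < r → f i ∈ S := by
    intro i h1 h2
    simp only [f, dif_pos (show 1 ≤ i ∧ i < r from ⟨h1, h2⟩)]
    exact Finset.orderEmbOfFin_mem _ _ _
  have hbd : ∀ x ∈ S, 1 ≤ x ∧ x ≤ n := fun x hx => by simpa using hS2 hx
  have hmono : ∀ i j, i < j → j ≤ r → f i < f j := by
    intro i j hij hj
    rcases Nat.eq_zero_or_pos i with rfl | hi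
    · rw [hf0]
      rcases Nat.lt_or_ge j r with h | h
      · exact (hbd _ (hfm j hij h)).1
      · rw [show j = r by omega, hfr]; omega
    · rcases Nat.lt_or_ge j r with h | h
      · simp only [f, dif_pos (show 1 ≤ i ∧ i < r by omega),
          dif_pos (show 1 ≤ j ∧ j < r by omega)]
        exact e.strictMono (by simp only [Fin.mk_lt_mk]; omega)
      · rw [show j = r by omega, hfr]
        exact Nat.lt_succ_of_le (hbd _ (hfm i hi (by omega))).2
  have hmono' : ∀ i j, i ≤ j → j ≤ r → f i ≤ f j := by
    intro i j hij hj
    rcases hij.eq_or_lt with rfl | h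
    · rfl
    · exact (hmono i j h hj).le
  have hsurj : ∀ x ∈ S, ∃ i, 1 ≤ i ∧ i < r ∧ f i = x := by
    intro x hx
    have : x ∈ Set.range e := by
      rw [Finset.range_orderEmbOfFin]; exact hx
    obtain ⟨i, rfl⟩ := this
    refine ⟨i + 1, by omega, by omega, ?_⟩
    simp only [f, dif_pos (show 1 ≤ (i : ℕ) + 1 ∧ (i : ℕ) + 1 < r by omega)]
    congr 1
  have hidx : ∀ i j x, i < j → j ≤ r → f i < x → x < f j → x ∈ S →
      ∃ l, i < l ∧ l < j ∧ f l = x := by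
    intro i j x hij hj h1 h2 hx
    obtain ⟨l, hl1, hl2, rfl⟩ := hsurj x hx
    refine ⟨l, ?_, ?_, rfl⟩
    · by_contra hc
      have := hmono' l i (by omega) (by omega)
      omega
    · by_contra hc
      have := hmono' j l (by omega) (by omega)
      omega
  have hgap : ∀ i < r, f (i + 1) ≤ f i + k := by
    intro i hi
    by_contra hc
    push Not at hc
    have hle : f (i + 1) ≤ n + 1 := hfr ▸ hmono' (i + 1) r (by omega) le_rfl
    obtain ⟨t, ht, hmem⟩ := hhit (f i + 1) 1 (by omega) le_rfl (by omega)
    obtain ⟨l, hl1, hl2, -⟩ := hidx i (i + 1) _ (by omega) (by omega) (by omega) (by omega) hmem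
    omega
  have hgaps : ∀ c i, i + c ≤ r → f (i + c) ≤ f i + c * k := by
    intro c
    induction c with
    | zero => intro i _; simp
    | succ c ih =>
      intro i hi
      have h1 := ih i (by omega)
      have h2 := hgap (i + c) (by omega)
      have h3 : (c + 1) * k = c * k + k := by ring
      have h4 : i + (c + 1) = i + c + 1 := by ring
      rw [h4, h3]; omega
  -- an inner gap of size larger than `k - m`
  obtain ⟨i, hi1, hi2, hi3⟩ : ∃ i, 1 ≤ i ∧ i + 1 < r ∧ f i + (k - m) < f (i + 1) := by
    by_contra hc
    push Not at hc
    have hsum : ∀ c, c + 1 < r → f (1 + c) ≤ f 1 + c * (k - m) := by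
      intro c
      induction c with
      | zero => intro _; simp
      | succ c ih =>
        intro hcr
        have h1 := ih (by omega)
        have h2 := hc (1 + c) (by omega) (by omega)
        have h3 : (c + 1) * (k - m) = c * (k - m) + (k - m) := by ring
        rw [← add_assoc, h3]; omega
    have h1 := hsum (r - 2) (by omega)
    have h2 := hgap 0 (by omega)
    have h3 := hgap (r - 1) (by omega)
    rw [show r - 1 + 1 = r by omega, hfr] at h3
    rw [show 1 + (r - 2) = r - 1 by omega] at h1
    rw [hf0, zero_add] at h2
    have h4 : (r - 2) * (k - m) + 2 * k + m * (r - 2) = r * k := by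
      obtain ⟨s, rfl⟩ : ∃ s, r = s + 2 := ⟨r - 2, by omega⟩
      obtain ⟨q, rfl⟩ : ∃ q, k = q + m := ⟨k - m, by omega⟩
      simp; ring
    omega
  have hgi := hgap i (by omega)
  obtain ⟨p, hp, hpr, hpd⟩ := hfac (k - (f (i + 1) - f i)) (by omega)
  rw [show k - (k - (f (i + 1) - f i)) = f (i + 1) - f i by omega] at hpd
  have hp2 := hp.two_le
  -- the window of `p` consecutive indices
  obtain ⟨a, ha1, ha2, ha3, ha4⟩ : ∃ a, a + p + 1 ≤ r ∧ a < i ∧ i + 1 < a + p + 1 ∧ True := by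
    rcases Nat.lt_or_ge r (i + p) with h | h
    · exact ⟨r - p - 1, by omega, by omega, by omega, trivial⟩
    · exact ⟨i - 1, by omega, by omega, by omega, trivial⟩
  have hlong : f a + p * k < f (a + p + 1) := by
    have h1 : f a ≤ a * k := by simpa [hf0] using hgaps a 0 (by omega)
    have h2 := hgaps (r - (a + p + 1)) (a + p + 1) (by omega)
    rw [show a + p + 1 + (r - (a + p + 1)) = r by omega, hfr] at h2
    have h3 : a * k + (r - (a + p + 1)) * k + p * k + k = r * k := by
      obtain ⟨c, rfl⟩ : ∃ c, r = a + p + 1 + c := ⟨r - (a + p + 1), by omega⟩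
      rw [Nat.add_sub_cancel_left]; ring
    omega
  have hle : f (a + p + 1) ≤ n + 1 := hfr ▸ hmono' (a + p + 1) r (by omega) le_rfl
  have hres : Set.SurjOn (fun l => f l % p) ↑(Finset.Ioo a (a + p + 1)) ↑(Finset.range p) := by
    intro c hc
    simp only [Finset.coe_range, Set.mem_Iio] at hc
    obtain ⟨b, hb1, hb2, hb3⟩ : ∃ b, f a < b ∧ b ≤ f a + p ∧ b % p = c := by
      refine ⟨f a + 1 + (c + p * (f a + 1) - (f a + 1)) % p, by omega, ?_, ?_⟩
      · have := Nat.mod_lt (c + p * (f a + 1) - (f a + 1)) (show 0 < p by omega)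
        omega
      · have h1 : f a + 1 ≤ p * (f a + 1) := Nat.le_mul_of_pos_left _ (by omega)
        rw [Nat.add_mod, Nat.mod_mod, ← Nat.add_mod, Nat.add_sub_cancel' (by omega),
          Nat.add_mul_mod_self_left, Nat.mod_eq_of_lt hc]
    have hkp : (k - 1) * p + p = p * k := by
      obtain ⟨q, rfl⟩ : ∃ q, k = q + 1 := ⟨k - 1, by omega⟩
      simp; ring
    obtain ⟨t, ht, hmem⟩ := hhit b p (by omega) (by omega) (by omega)
    have htp : t * p ≤ (k - 1) * p := Nat.mul_le_mul_right _ (by omega)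
    obtain ⟨l, hl1, hl2, hl3⟩ := hidx a (a + p + 1) _ (by omega) (by omega) (by omega)
      (by omega) hmem
    refine ⟨l, by simp only [Finset.coe_Ioo, Set.mem_Ioo]; exact ⟨hl1, hl2⟩, ?_⟩
    simp only [hl3, Nat.add_mul_mod_self_right, hb3]
  have hinj2 := Finset.injOn_of_surjOn_of_card_le (fun l => f l % p) (s := Finset.Ioo a (a + p + 1))
    (t := Finset.range p) (fun l _ => by
      simp only [Finset.coe_range, Set.mem_Iio]; exact Nat.mod_lt _ (by omega)) hres (by simp; omega)
  have heq : f i % p = f (i + 1) % p := by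
    have hlt := hmono i (i + 1) (by omega) (by omega)
    exact (Nat.modEq_iff_dvd' hlt.le).2 hpd
  have := hinj2 (by simp only [Finset.coe_Ioo, Set.mem_Ioo]; omega)
    (by simp only [Finset.coe_Ioo, Set.mem_Ioo]; omega) heq
  omega

lemma prime_dvd_primorialUpTo {p r : ℕ} (hp : p.Prime) (hpr : p ≤ r) : p ∣ primorialUpTo r :=
  Finset.dvd_prod_of_mem _ (by simp [hp]; omega)

lemma exists_prime_lt_dvd {k r i : ℕ} (hrp : r.Prime)
    (h1 : Nat.gcd (k - i) (primorialUpTo r) ≠ 1) (h2 : Nat.gcd (k - i) (primorialUpTo r) ≠ r) :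
    ∃ p, p.Prime ∧ p < r ∧ p ∣ k - i := by
  by_contra hno
  push Not at hno
  have hle : ∀ p, p.Prime → p ∣ primorialUpTo r → p ≤ r := by
    intro p hp hd
    obtain ⟨q, hq, hpq⟩ := (hp.prime.dvd_finsetProd_iff _).1 hd
    simp only [Finset.mem_filter, Finset.mem_range] at hq
    have := (Nat.prime_dvd_prime_iff_eq hp hq.2).1 hpq
    omega
  have hsq : Squarefree (primorialUpTo r) := by
    unfold primorialUpTo
    refine Finset.squarefree_prod_of_pairwise_isCoprime ?_ ?_
    · intro p hp q hq hpq
      simp only [Finset.coe_filter, Finset.mem_range, Set.mem_ofPred_eq] at hp hq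
      simp only [Function.onFun, ← Nat.coprime_iff_isRelPrime]
      exact (Nat.coprime_primes hp.2 hq.2).2 hpq
    · intro p hp
      simp only [Finset.mem_filter] at hp
      exact hp.2.prime.squarefree
  have hg : ∀ p, p.Prime → p ∣ Nat.gcd (k - i) (primorialUpTo r) → p = r := by
    intro p hp hd
    have h3 := hle p hp (hd.trans (Nat.gcd_dvd_right _ _))
    by_contra hne
    exact hno p hp (by omega) (hd.trans (Nat.gcd_dvd_left _ _))
  obtain ⟨p, hp, hpd⟩ := Nat.exists_prime_and_dvd h1
  obtain rfl := hg p hp hpd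
  obtain ⟨c, hc⟩ := hpd
  have hc1 : c ≠ 1 := by rintro rfl; exact h2 (by simpa using hc)
  obtain ⟨q, hq, hqd⟩ := Nat.exists_prime_and_dvd hc1
  obtain rfl := hg q hq (by rw [hc]; exact Dvd.dvd.mul_left hqd _)
  have : q * q ∣ primorialUpTo q := by
    refine dvd_trans ?_ (Nat.gcd_dvd_right (k - i) _)
    rw [hc]; exact mul_dvd_mul_left _ hqd
  exact hp.not_isUnit (hsq _ this)

/-- Part IV (equality): let `r` be prime, `j = j_{k,r} ≥ 2`, `ℓ = ℓ_{k,r} ≥ 1`,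
and `m = min(j, ℓ)`. If either (i) `ℓ = 1`, (ii) `m = 2` and `k ≥ 2r - 3`, or
(iii) `m ≥ 3` and `k ≥ π(r)³(r-2)`, then `w₂(k;r) = rk - m(r-2)`. -/
theorem w2_eq_of_r_prime (k r : ℕ) (hr : 2 ≤ r) (hk : r < k)
    (hrp : r.Prime) (hj : 2 ≤ jkr k r) (hl : 1 ≤ lkr k r)
    (hcase : lkr k r = 1 ∨
      (min (jkr k r) (lkr k r) = 2 ∧ 2 * r - 3 ≤ k) ∨
      (3 ≤ min (jkr k r) (lkr k r) ∧ (Nat.primeCounting r) ^ 3 * (r - 2) ≤ k)) :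
    IsLeast {n : ℕ | 0 < n ∧ vdwProp r (twoColors k) n}
      (r * k - min (jkr k r) (lkr k r) * (r - 2)) := by
  have hj1 : ∀ i < jkr k r, Nat.gcd (k - i) (primorialUpTo r) ≠ 1 := fun i hi =>
    Nat.notMem_of_lt_sInf (s := {j : ℕ | Nat.gcd (k - j) (primorialUpTo r) = 1}) hi
  have hl1 : ∀ i < lkr k r, Nat.gcd (k - i) (primorialUpTo r) ≠ r := fun i hi =>
    Nat.notMem_of_lt_sInf (s := {l : ℕ | Nat.gcd (k - l) (primorialUpTo r) = r}) hi
  have hjs : Nat.gcd (k - jkr k r) (primorialUpTo r) = 1 :=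
    Nat.sInf_mem (s := {j : ℕ | Nat.gcd (k - j) (primorialUpTo r) = 1})
      (Nat.nonempty_of_pos_sInf (show 0 < jkr k r by omega))
  have hls : Nat.gcd (k - lkr k r) (primorialUpTo r) = r :=
    Nat.sInf_mem (s := {l : ℕ | Nat.gcd (k - l) (primorialUpTo r) = r})
      (Nat.nonempty_of_pos_sInf (show 0 < lkr k r by omega))
  have hr3 : 3 ≤ r := by
    by_contra hc
    obtain rfl : r = 2 := by omega
    have h0 := exists_prime_lt_dvd Nat.prime_two (hj1 0 (by omega)) (hl1 0 (by omega))
    obtain ⟨p, hp, hp2, -⟩ := h0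
    exact absurd hp.two_le (by omega)
  set m := min (jkr k r) (lkr k r) with hm
  have hm1 : 1 ≤ m := le_min (by omega) hl
  have hfac : ∀ i < m, ∃ p, p.Prime ∧ p < r ∧ p ∣ k - i := fun i hi =>
    exists_prime_lt_dvd hrp (hj1 i (hi.trans_le (min_le_left _ _)))
      (hl1 i (hi.trans_le (min_le_right _ _)))
  have hmlt : m < k := by
    have : jkr k r ≤ k - 1 := Nat.sInf_le (by
      simp only [Set.mem_ofPred_eq]
      rw [show k - (k - 1) = 1 by omega, Nat.gcd_one_left])
    have := min_le_left (jkr k r) (lkr k r)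
    omega
  have hnd : ∀ p, p.Prime → p < r → ¬ p ∣ k - m := by
    intro p hp hpr hd
    have hd2 := prime_dvd_primorialUpTo hp hpr.le
    rcases min_choice (jkr k r) (lkr k r) with h | h
    · rw [hm, h] at hd
      have := Nat.dvd_gcd hd hd2
      rw [hjs] at this
      exact hp.one_lt.ne' (Nat.dvd_one.1 this)
    · rw [hm, h] at hd
      have := Nat.dvd_gcd hd hd2
      rw [hls] at this
      exact hpr.ne ((Nat.prime_dvd_prime_iff_eq hp hrp).1 this)
  have hmk : m * (r - 2) ≤ k := by
    rcases hcase with h | ⟨h, h'⟩ | ⟨h, h'⟩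
    · have : m = 1 := le_antisymm ((min_le_right _ _).trans h.le) hm1
      rw [this]; omega
    · rw [h]; omega
    · refine le_trans (Nat.mul_le_mul_right _ ?_) h'
      by_contra hc
      push Not at hc
      obtain ⟨n, hn1, hn2, hn3⟩ := exists_rough_of_prime hrp hr3 (k - m)
      obtain ⟨p, hp, hpr, hpd⟩ := hfac (k - n) (by omega)
      rw [show k - (k - n) = n by omega] at hpd
      exact hn3 p hp hpr hpd
  refine ⟨⟨?_, vdw_upper hr3 hm1 hmk hfac⟩, ?_⟩
  · have : k < r * k := by nlinarith
    omega
  · intro n hn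
    by_contra hc
    push Not at hc
    refine vdw_lower hr3 hm1 hmlt ?_ ?_ hc hn.2
    · intro d hd1 hd2
      refine Nat.Coprime.symm (Nat.coprime_of_dvd ?_)
      intro p hp hp1 hp2
      exact hnd p hp ((Nat.le_of_dvd hd1 hp2).trans_lt hd2) hp1
    · intro h1
      have : lkr k r = 1 := by
        rcases min_choice (jkr k r) (lkr k r) with h | h <;> omega
      rw [this] at hls
      rw [h1]
      exact hls ▸ Nat.gcd_dvd_left _ _
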